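/- There are no minimal pairs in the K-degrees of computably enumerable reals: for any two computably enumerable reals A and D, neither of which is K-trivial, there exists a computably enumerable real B which is not K-trivial and satisfies B ≤_K A and B ≤_K D. -/

import Mathlib

open Part Filter

open scoped Classical

namespace KPaper

/-- Binary strings. -/
abbrev Str := List Bool

/-! ### Oracle (Turing) reducibility -/

/-- The functions `ℕ →. ℕ` that are partial recursive relative to an oracle `O : ℕ →. ℕ`.
This mirrors Mathlib's `Nat.Partrec`, with an extra base case for the oracle. -/
inductive RecursiveIn (O : ℕ →. ℕ) : (ℕ →. ℕ) → Prop
  | oracle : RecursiveIn O O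
  | zero : RecursiveIn O (pure 0)
  | succ : RecursiveIn O ↑Nat.succ
  | left : RecursiveIn O ↑fun n : ℕ => n.unpair.1
  | right : RecursiveIn O ↑fun n : ℕ => n.unpair.2
  | pair {f g} : RecursiveIn O f → RecursiveIn O g →
      RecursiveIn O fun n => Nat.pair <$> f n <*> g n
  | comp {f g} : RecursiveIn O f → RecursiveIn O g → RecursiveIn O fun n => g n >>= f
  | prec {f g} : RecursiveIn O f → RecursiveIn O g → RecursiveIn O (Nat.unpaired fun a n =>
      n.rec (f a) fun y IH => do let i ← IH; g (Nat.pair a (Nat.pair y i)))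
  | rfind {f} : RecursiveIn O f →
      RecursiveIn O fun a => Nat.rfind fun n => (fun m => m = 0) <$> f (Nat.pair a n)

/-- The characteristic (partial) function of a set of naturals, used as a Turing oracle. -/
noncomputable def chi (A : Set ℕ) : ℕ →. ℕ := fun n => Part.some (if n ∈ A then 1 else 0)

/-- The characteristic function of an infinite binary sequence, used as a Turing oracle. -/
def chiSeq (X : ℕ → Bool) : ℕ →. ℕ := fun n => Part.some (cond (X n) 1 0)

/-- `A` is Turing reducible to `B`. -/
noncomputable def TuringLeSet (A B : Set ℕ) : Prop := RecursiveIn (chi B) (chi A)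

/-- `A` is Turing equivalent to `B`. -/
noncomputable def TuringEquivSet (A B : Set ℕ) : Prop := TuringLeSet A B ∧ TuringLeSet B A

/-- Turing equivalence between a set and an infinite binary sequence. -/
noncomputable def TuringEquivSetSeq (A : Set ℕ) (X : ℕ → Bool) : Prop :=
  RecursiveIn (chiSeq X) (chi A) ∧ RecursiveIn (chi A) (chiSeq X)

/-- The halting problem `∅'`. -/
def haltingSet : Set ℕ := {n | ((Denumerable.ofNat Nat.Partrec.Code n).eval n).Dom}

/-- A set of naturals is computably enumerable iff it is the domain of a
partial computable function. -/
def CESet (A : Set ℕ) : Prop := ∃ f : ℕ →. ℕ, Nat.Partrec f ∧ ∀ n, n ∈ A ↔ (f n).Dom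

/-! ### Machines and Kolmogorov complexity -/

/-- A (plain) machine is a partial computable map from binary strings to binary strings. -/
def PlainMachine (M : Str →. Str) : Prop := Partrec M

/-- A prefix-free machine: a partial computable map on binary strings whose
domain is an antichain under the prefix relation. -/
def PFMachine (M : Str →. Str) : Prop :=
  Partrec M ∧ ∀ ρ₁ ρ₂ : Str, (M ρ₁).Dom → (M ρ₂).Dom → ρ₁ <+: ρ₂ → ρ₁ = ρ₂

/-- The Kolmogorov complexity of a string `σ` with respect to a machine `M`:
the least length of an `M`-description of `σ` (`⊤` if there is none). -/
noncomputable def KC (M : Str →. Str) (σ : Str) : ℕ∞ :=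
  ⨅ ρ : {ρ : Str // σ ∈ M ρ}, ((ρ : Str).length : ℕ∞)

/-- An optimal prefix-free machine: a prefix-free machine whose associated complexity
is minimal, up to an additive constant, among all prefix-free machines. -/
def OptimalPF (U : Str →. Str) : Prop :=
  PFMachine U ∧ ∀ M : Str →. Str, PFMachine M → ∃ c : ℕ, ∀ σ : Str, KC U σ ≤ KC M σ + c

/-- An optimal plain machine. -/
def OptimalPlain (V : Str →. Str) : Prop :=
  PlainMachine V ∧ ∀ M : Str →. Str, PlainMachine M → ∃ c : ℕ, ∀ σ : Str, KC V σ ≤ KC M σ + c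

/-! ### Initial segments -/

/-- The first `n` bits of the characteristic sequence of a set of naturals. -/
noncomputable def restrSet (A : Set ℕ) (n : ℕ) : Str :=
  (List.range n).map fun i => decide (i ∈ A)

/-- The first `n` bits of an infinite binary sequence. -/
def restrSeq (X : ℕ → Bool) (n : ℕ) : Str := (List.range n).map X

/-- The string `0^n`; `K(n)` is identified with `K(0^n)`. -/
def zeroStr (n : ℕ) : Str := List.replicate n false

/-! ### `≤_K`, `<_K`, `K`-triviality (and the `≤_C` analogues) -/

def KLeSet (U : Str →. Str) (A B : Set ℕ) : Prop :=
  ∃ c : ℕ, ∀ n, KC U (restrSet A n) ≤ KC U (restrSet B n) + c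

def KLtSet (U : Str →. Str) (A B : Set ℕ) : Prop := KLeSet U A B ∧ ¬ KLeSet U B A

def KTrivialSet (U : Str →. Str) (A : Set ℕ) : Prop :=
  ∃ c : ℕ, ∀ n, KC U (restrSet A n) ≤ KC U (zeroStr n) + c

def KLeSeq (U : Str →. Str) (X Y : ℕ → Bool) : Prop :=
  ∃ c : ℕ, ∀ n, KC U (restrSeq X n) ≤ KC U (restrSeq Y n) + c

def KLtSeq (U : Str →. Str) (X Y : ℕ → Bool) : Prop := KLeSeq U X Y ∧ ¬ KLeSeq U Y X

def KTrivialSeq (U : Str →. Str) (X : ℕ → Bool) : Prop :=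
  ∃ c : ℕ, ∀ n, KC U (restrSeq X n) ≤ KC U (zeroStr n) + c

/-! ### Computably enumerable reals -/

/-- The real number in `[0,1]` whose binary expansion is the sequence `X`. -/
noncomputable def realOfSeq (X : ℕ → Bool) : ℝ := ∑' i : ℕ, cond (X i) ((2 : ℝ) ^ (i + 1))⁻¹ 0

/-- `X` (identified with the real it is the binary expansion of) is a computably
enumerable real: it is the limit of a nondecreasing computable sequence of
(dyadic) rationals. -/
def CEReal (X : ℕ → Bool) : Prop :=
  ∃ f : ℕ → ℤ, Computable f ∧
    (∀ s, (f s : ℝ) / 2 ^ s ≤ (f (s + 1) : ℝ) / 2 ^ (s + 1)) ∧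
    Tendsto (fun s => (f s : ℝ) / 2 ^ s) atTop (nhds (realOfSeq X))

/-- The characteristic sequence of a set of naturals. -/
noncomputable def seqOfSet (A : Set ℕ) : ℕ → Bool := fun i => decide (i ∈ A)

/-! ### Solovay reducibility -/

/-- Solovay reducibility on c.e. reals: `X ≤_S Y` iff there are nondecreasing computable
rational approximations to `X` and `Y` and a constant `c` such that at each stage the
distance to `X` is bounded by `c` times the distance to `Y`. -/
def SolovayLe (X Y : ℕ → Bool) : Prop :=
  ∃ (c : ℕ) (f g : ℕ → ℤ), Computable f ∧ Computable g ∧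
    (∀ s, (f s : ℝ) / 2 ^ s ≤ (f (s + 1) : ℝ) / 2 ^ (s + 1)) ∧
    (∀ s, (g s : ℝ) / 2 ^ s ≤ (g (s + 1) : ℝ) / 2 ^ (s + 1)) ∧
    Tendsto (fun s => (f s : ℝ) / 2 ^ s) atTop (nhds (realOfSeq X)) ∧
    Tendsto (fun s => (g s : ℝ) / 2 ^ s) atTop (nhds (realOfSeq Y)) ∧
    ∀ s, realOfSeq X - (f s : ℝ) / 2 ^ s ≤ (c : ℝ) * (realOfSeq Y - (g s : ℝ) / 2 ^ s)


/-! ### Primitive recursion infrastructure -/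
attribute [fun_prop] Primrec

section PrimInfra
variable {α β γ δ : Type*} [Primcodable α] [Primcodable β] [Primcodable γ] [Primcodable δ]

@[fun_prop] theorem pr_id : Primrec (fun a : α => a) := Primrec.id
@[fun_prop] theorem pr_const (b : β) : Primrec (fun _ : α => b) := Primrec.const b
@[fun_prop] theorem pr_comp {f : β → γ} {g : α → β} (hf : Primrec f) (hg : Primrec g) :
    Primrec (fun a => f (g a)) := hf.comp hg
@[fun_prop] theorem pr_pair {f : α → β} {g : α → γ} (hf : Primrec f) (hg : Primrec g) :
    Primrec (fun a => (f a, g a)) := hf.pair hg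
@[fun_prop] theorem pr_fst {f : α → β × γ} (hf : Primrec f) : Primrec (fun a => (f a).1) :=
  Primrec.fst.comp hf
@[fun_prop] theorem pr_snd {f : α → β × γ} (hf : Primrec f) : Primrec (fun a => (f a).2) :=
  Primrec.snd.comp hf
@[fun_prop] theorem pr_add {f g : α → ℕ} (hf : Primrec f) (hg : Primrec g) :
    Primrec (fun a => f a + g a) := Primrec.nat_add.comp hf hg
@[fun_prop] theorem pr_sub {f g : α → ℕ} (hf : Primrec f) (hg : Primrec g) :
    Primrec (fun a => f a - g a) := Primrec.nat_sub.comp hf hg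
@[fun_prop] theorem pr_mul {f g : α → ℕ} (hf : Primrec f) (hg : Primrec g) :
    Primrec (fun a => f a * g a) := Primrec.nat_mul.comp hf hg
@[fun_prop] theorem pr_div {f g : α → ℕ} (hf : Primrec f) (hg : Primrec g) :
    Primrec (fun a => f a / g a) := Primrec.nat_div.comp hf hg
@[fun_prop] theorem pr_mod {f g : α → ℕ} (hf : Primrec f) (hg : Primrec g) :
    Primrec (fun a => f a % g a) := Primrec.nat_mod.comp hf hg
@[fun_prop] theorem pr_natpair {f g : α → ℕ} (hf : Primrec f) (hg : Primrec g) :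
    Primrec (fun a => Nat.pair (f a) (g a)) := Primrec₂.natPair.comp hf hg
@[fun_prop] theorem pr_unpair {f : α → ℕ} (hf : Primrec f) :
    Primrec (fun a => Nat.unpair (f a)) := Primrec.unpair.comp hf
@[fun_prop] theorem pr_le {f g : α → ℕ} (hf : Primrec f) (hg : Primrec g) :
    Primrec (fun a => decide (f a ≤ g a)) :=
  (PrimrecRel.decide Primrec.nat_le).comp hf hg
@[fun_prop] theorem pr_lt {f g : α → ℕ} (hf : Primrec f) (hg : Primrec g) :
    Primrec (fun a => decide (f a < g a)) :=
  (PrimrecRel.decide Primrec.nat_lt).comp hf hg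
@[fun_prop] theorem pr_eq [DecidableEq β] {f g : α → β} (hf : Primrec f) (hg : Primrec g) :
    Primrec (fun a => decide (f a = g a)) :=
  (PrimrecRel.decide Primrec.eq).comp hf hg
@[fun_prop] theorem pr_cond {f g : α → β} {c : α → Bool} (hc : Primrec c) (hf : Primrec f)
    (hg : Primrec g) : Primrec (fun a => cond (c a) (f a) (g a)) :=
  Primrec.cond hc hf hg
@[fun_prop] theorem pr_and {f g : α → Bool} (hf : Primrec f) (hg : Primrec g) :
    Primrec (fun a => f a && g a) := Primrec.and.comp hf hg
@[fun_prop] theorem pr_or {f g : α → Bool} (hf : Primrec f) (hg : Primrec g) :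
    Primrec (fun a => f a || g a) := Primrec.or.comp hf hg
@[fun_prop] theorem pr_not {f : α → Bool} (hf : Primrec f) :
    Primrec (fun a => ! f a) := Primrec.not.comp hf
@[fun_prop] theorem pr_some {f : α → β} (hf : Primrec f) :
    Primrec (fun a => Option.some (f a)) := Primrec.option_some.comp hf
@[fun_prop] theorem pr_isSome {f : α → Option β} (hf : Primrec f) :
    Primrec (fun a => (f a).isSome) := Primrec.option_isSome.comp hf
@[fun_prop] theorem pr_getD {f : α → Option β} {g : α → β} (hf : Primrec f) (hg : Primrec g) :
    Primrec (fun a => (f a).getD (g a)) := Primrec.option_getD.comp hf hg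
@[fun_prop] theorem pr_obind {f : α → Option β} {g : α → β → Option γ} (hf : Primrec f)
    (hg : Primrec (fun p : α × β => g p.1 p.2)) :
    Primrec (fun a => (f a).bind (g a)) := Primrec.option_bind hf hg
@[fun_prop] theorem pr_omap {f : α → Option β} {g : α → β → γ} (hf : Primrec f)
    (hg : Primrec (fun p : α × β => g p.1 p.2)) :
    Primrec (fun a => (f a).map (g a)) := Primrec.option_map hf hg
@[fun_prop] theorem pr_map {f : α → List β} {g : α → β → γ} (hf : Primrec f)
    (hg : Primrec (fun p : α × β => g p.1 p.2)) : Primrec (fun a => (f a).map (g a)) :=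
  Primrec.list_map hf hg
@[fun_prop] theorem pr_range {f : α → ℕ} (hf : Primrec f) :
    Primrec (fun a => List.range (f a)) := Primrec.list_range.comp hf
@[fun_prop] theorem pr_length {f : α → List β} (hf : Primrec f) :
    Primrec (fun a => (f a).length) := Primrec.list_length.comp hf
@[fun_prop] theorem pr_cons {f : α → β} {g : α → List β} (hf : Primrec f) (hg : Primrec g) :
    Primrec (fun a => f a :: g a) := Primrec.list_cons.comp hf hg
@[fun_prop] theorem pr_take {f : α → ℕ} {g : α → List β} (hf : Primrec f) (hg : Primrec g) :
    Primrec (fun a => (g a).take (f a)) := Primrec.list_take.comp hf hg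
@[fun_prop] theorem pr_lgetD {f : α → ℕ} {g : α → List β} (d : β) (hf : Primrec f)
    (hg : Primrec g) :
    Primrec (fun a => (g a).getD (f a) d) := (Primrec.list_getD d).comp hg hf
@[fun_prop] theorem pr_foldr {f : α → List β} {g : α → γ} {h : α → β → γ → γ} (hf : Primrec f)
    (hg : Primrec g) (hh : Primrec (fun p : α × β × γ => h p.1 p.2.1 p.2.2)) :
    Primrec (fun a => (f a).foldr (h a) (g a)) :=
  Primrec.list_foldr (h := fun a p => h a p.1 p.2) hf hg hh
@[fun_prop] theorem pr_sum {f : α → List ℕ} (hf : Primrec f) : Primrec (fun a => (f a).sum) := by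
  have : Primrec (fun a => (f a).foldr (fun x y => x + y) 0) := by fun_prop
  exact this.of_eq (fun a => by simp [List.sum_eq_foldr])
@[fun_prop] theorem pr_all {f : α → List β} {g : α → β → Bool} (hf : Primrec f)
    (hg : Primrec (fun p : α × β => g p.1 p.2)) : Primrec (fun a => (f a).all (g a)) := by
  have : Primrec (fun a => (f a).foldr (fun x y => g a x && y) true) := by fun_prop
  exact this.of_eq (fun a => by induction f a <;> simp_all)
@[fun_prop] theorem pr_any {f : α → List β} {g : α → β → Bool} (hf : Primrec f)
    (hg : Primrec (fun p : α × β => g p.1 p.2)) : Primrec (fun a => (f a).any (g a)) := by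
  have : Primrec (fun a => (f a).foldr (fun x y => g a x || y) false) := by fun_prop
  exact this.of_eq (fun a => by induction f a <;> simp_all)
@[fun_prop] theorem pr_filter {f : α → List β} {g : α → β → Bool} (hf : Primrec f)
    (hg : Primrec (fun p : α × β => g p.1 p.2)) : Primrec (fun a => (f a).filter (g a)) := by
  have : Primrec (fun a => (f a).foldr (fun x y => cond (g a x) (x :: y) y) []) := by fun_prop
  exact this.of_eq (fun a => by
    induction f a with
    | nil => simp
    | cons b l ih => simp only [List.foldr_cons, ih, List.filter_cons]; cases g a b <;> simp)
@[fun_prop] theorem pr_findIdx {f : α → List β} {g : α → β → Bool} (hf : Primrec f)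
    (hg : Primrec (fun p : α × β => g p.1 p.2)) : Primrec (fun a => (f a).findIdx (g a)) :=
  Primrec.list_findIdx hf hg
@[fun_prop] theorem pr_mem [DecidableEq β] {f : α → List β} {g : α → β} (hf : Primrec f)
    (hg : Primrec g) : Primrec (fun a => decide (g a ∈ f a)) := by
  have : Primrec (fun a => (f a).any (fun x => decide (x = g a))) := by fun_prop
  exact this.of_eq (fun a => by rw [Bool.eq_iff_iff]; simp)
@[fun_prop] theorem pr_natrec {f : α → ℕ} {g : α → β} {h : α → ℕ → β → β} (hf : Primrec f)
    (hg : Primrec g) (hh : Primrec (fun p : α × ℕ × β => h p.1 p.2.1 p.2.2)) :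
    Primrec (fun a => Nat.rec (motive := fun _ => β) (g a) (h a) (f a)) :=
  Primrec.nat_rec' (h := fun a p => h a p.1 p.2) hf hg hh
@[fun_prop] theorem pr_pow {f g : α → ℕ} (hf : Primrec f) (hg : Primrec g) :
    Primrec (fun a => f a ^ g a) := by
  have : Primrec (fun a => Nat.rec (motive := fun _ => ℕ) 1 (fun _ y => y * f a) (g a)) := by
    fun_prop
  exact this.of_eq (fun a => by
    induction g a with
    | zero => simp
    | succ n ih => simp only [ih, pow_succ])
@[fun_prop] theorem pr_replicate {f : α → ℕ} {g : α → β} (hf : Primrec f) (hg : Primrec g) :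
    Primrec (fun a => List.replicate (f a) (g a)) := by
  have : Primrec (fun a => (List.range (f a)).map (fun _ => g a)) := by
    fun_prop
  exact this.of_eq (fun a => by simp)
@[fun_prop] theorem pr_ite {p : α → Prop} [DecidablePred p] {f g : α → β}
    (hp : Primrec (fun a => decide (p a))) (hf : Primrec f) (hg : Primrec g) :
    Primrec (fun a => if p a then f a else g a) :=
  (Primrec.cond hp hf hg).of_eq (fun a => by by_cases h : p a <;> simp [h])
@[fun_prop] theorem pr_ofNat {f : α → ℕ} (hf : Primrec f) :
    Primrec (fun a => Int.ofNat (f a)) := by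
  apply Primrec.encode_iff.1
  have : Primrec (fun a => 2 * f a) := by fun_prop
  exact this.of_eq (fun a => rfl)
@[fun_prop] theorem pr_dand {p q : α → Prop} [DecidablePred p] [DecidablePred q]
    (hp : Primrec (fun a => decide (p a))) (hq : Primrec (fun a => decide (q a))) :
    Primrec (fun a => decide (p a ∧ q a)) :=
  (Primrec.and.comp hp hq).of_eq (fun a => by simp)
@[fun_prop] theorem pr_dor {p q : α → Prop} [DecidablePred p] [DecidablePred q]
    (hp : Primrec (fun a => decide (p a))) (hq : Primrec (fun a => decide (q a))) :
    Primrec (fun a => decide (p a ∨ q a)) :=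
  (Primrec.or.comp hp hq).of_eq (fun a => by simp)
@[fun_prop] theorem pr_dnot {p : α → Prop} [DecidablePred p]
    (hp : Primrec (fun a => decide (p a))) :
    Primrec (fun a => decide (¬ p a)) :=
  (Primrec.not.comp hp).of_eq (fun a => by simp)
end PrimInfra

/-- The `m`-bit binary string of `v`. -/
def bs (m v : ℕ) : Str := (List.range m).map (fun i => decide (v / 2 ^ (m - 1 - i) % 2 = 1))

@[fun_prop] theorem pr_bs {α : Type*} [Primcodable α] {f g : α → ℕ} (hf : Primrec f) (hg : Primrec g) :
    Primrec (fun a => bs (f a) (g a)) := by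
  unfold bs; fun_prop

theorem bs_length (m v : ℕ) : (bs m v).length = m := by simp [bs]

theorem bs_take {x y : ℕ} (v : ℕ) (h : x ≤ y) : (bs y v).take x = bs x (v / 2 ^ (y - x)) := by
  unfold bs
  rw [← List.map_take, List.take_range, Nat.min_eq_left h]
  apply List.map_congr_left
  intro i hi
  rw [List.mem_range] at hi
  rw [Nat.div_div_eq_div_mul, ← pow_add]
  congr 5
  omega

theorem bs_inj {m v w : ℕ} (hv : v < 2 ^ m) (hw : w < 2 ^ m) (h : bs m v = bs m w) : v = w := by
  apply Nat.eq_of_testBit_eq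
  intro k
  by_cases hk : k < m
  · unfold bs at h
    have := List.map_inj_left.1 h (m - 1 - k) (by simp; omega)
    rw [show m - 1 - (m - 1 - k) = k by omega] at this
    rw [Nat.testBit_eq_decide_div_mod_eq, Nat.testBit_eq_decide_div_mod_eq, this]
  · rw [Nat.testBit_lt_two_pow (lt_of_lt_of_le hv (Nat.pow_le_pow_right (by norm_num) (by omega))),
      Nat.testBit_lt_two_pow (lt_of_lt_of_le hw (Nat.pow_le_pow_right (by norm_num) (by omega)))]

theorem bs_pfx {m m' v v' : ℕ} (hv : v < 2 ^ m) (hv' : v' < 2 ^ m')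
    (h : bs m v <+: bs m' v') : m ≤ m' ∧ v = v' / 2 ^ (m' - m) := by
  have hl := h.length_le
  rw [bs_length, bs_length] at hl
  refine ⟨hl, ?_⟩
  have h2 := List.prefix_iff_eq_take.1 h
  rw [bs_length, bs_take _ hl] at h2
  refine bs_inj hv ?_ h2
  rw [Nat.div_lt_iff_lt_mul (by positivity), ← pow_add]
  rwa [show m + (m' - m) = m' by omega]

/-- the weight `2^{-k}` -/
noncomputable def tp (k : ℕ) : ℝ := (2⁻¹ : ℝ) ^ k

theorem tp_pos (k : ℕ) : 0 < tp k := by unfold tp; positivity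
theorem tp_add (a b : ℕ) : tp (a + b) = tp a * tp b := pow_add _ _ _
theorem tp_succ (a : ℕ) : tp (a + 1) = tp a / 2 := by unfold tp; rw [pow_succ]; ring
theorem tp_zero : tp 0 = 1 := by simp [tp]
theorem tp_anti {a b : ℕ} (h : a ≤ b) : tp b ≤ tp a := by
  unfold tp; exact pow_le_pow_of_le_one (by norm_num) (by norm_num) h
theorem tp_le_one (a : ℕ) : tp a ≤ 1 := by rw [← tp_zero]; exact tp_anti (Nat.zero_le a)
theorem tp_mul_pow (a : ℕ) : tp a * 2 ^ a = 1 := by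
  unfold tp; rw [← mul_pow]; norm_num

/-- Kraft inequality for prefix-free finite sets. -/
theorem kraft (S : Finset Str) (hS : ∀ a ∈ S, ∀ b ∈ S, a <+: b → a = b) :
    ∑ σ ∈ S, tp σ.length ≤ 1 := by
  by_cases h0 : ([] : Str) ∈ S
  · have : S = {[]} := by
      ext x
      simp only [Finset.mem_singleton]
      constructor
      · intro hx; exact (hS _ h0 _ hx ⟨_, List.nil_append _⟩).symm
      · rintro rfl; exact h0
    rw [this]; simp [tp_zero]
  · have hud : InformationTheory.UniquelyDecodable (S : Set Str) := by
      intro L1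
      induction L1 with
      | nil =>
        intro L2 h1 h2 h
        cases L2 with
        | nil => rfl
        | cons a L =>
          simp at h
          exact absurd (h2 a (by simp)) (by rw [h.1]; simpa using h0)
      | cons a L ih =>
        intro L2 h1 h2 h
        cases L2 with
        | nil =>
          simp at h
          exact absurd (h1 a (by simp)) (by rw [h.1]; simpa using h0)
        | cons b L' =>
          simp only [List.flatten_cons] at h
          have ha := h1 a (by simp)
          have hb := h2 b (by simp)
          have hab : a = b := by
            have p1 : a <+: b ++ L'.flatten := by rw [← h]; exact List.prefix_append _ _
            have p2 : b <+: b ++ L'.flatten := List.prefix_append _ _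
            rcases (le_total a.length b.length).imp (List.prefix_of_prefix_length_le p1 p2) (List.prefix_of_prefix_length_le p2 p1) with h' | h'
            · exact hS _ (by simpa using ha) _ (by simpa using hb) h'
            · exact (hS _ (by simpa using hb) _ (by simpa using ha) h').symm
          subst hab
          rw [List.append_cancel_left_eq] at h
          rw [ih L' (fun x hx => h1 x (by simp [hx])) (fun x hx => h2 x (by simp [hx])) h]
    have := InformationTheory.kraft_mcmillan_inequality hud
    simpa [tp] using this

/-- An injective primitive recursive enumeration of the graph of `U`. -/
structure Enum (U : Str →. Str) (e : ℕ → Option (Str × Str)) : Prop where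
  prim : Primrec e
  sound : ∀ i σ τ, e i = Option.some (σ, τ) → τ ∈ U σ
  compl : ∀ σ τ, τ ∈ U σ → ∃ i, e i = Option.some (σ, τ)
  inj : ∀ i i' σ τ τ', e i = Option.some (σ, τ) → e i' = Option.some (σ, τ') → i = i'
  len1 : ∀ i σ τ, e i = Option.some (σ, τ) → σ.length ≤ i
  len2 : ∀ i σ τ, e i = Option.some (σ, τ) → τ.length ≤ i

theorem exists_enum (U : Str →. Str) (hU : Partrec U) : ∃ e, Enum U e := by
  obtain ⟨c, hc⟩ := Nat.Partrec.Code.exists_code.1 hU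
  let g : ℕ → ℕ → Option (Str × Str) := fun k n =>
    (Encodable.decode (α := Str) n).bind fun σ =>
      (Nat.Partrec.Code.evaln k c n).bind fun m =>
        (Encodable.decode (α := Str) m).bind fun τ =>
          if τ.length ≤ k ∧ Encodable.encode σ = n ∧ Encodable.encode τ = m then
            Option.some (σ, τ) else Option.none
  have hdec : ∀ {α : Type} [Primcodable α] {f : α → ℕ}, Primrec f →
      Primrec (fun a => Encodable.decode (α := Str) (f a)) :=
    fun hf => Primrec.decode.comp hf
  have hev : ∀ {α : Type} [Primcodable α] {f h : α → ℕ}, Primrec f → Primrec h →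
      Primrec (fun a => Nat.Partrec.Code.evaln (f a) c (h a)) :=
    fun hf hh => Nat.Partrec.Code.primrec_evaln.comp ((hf.pair (Primrec.const c)).pair hh)
  have hgp : Primrec (fun p : ℕ × ℕ => g p.1 p.2) := by
    refine pr_obind (hdec (by fun_prop)) ?_
    refine pr_obind (hev (by fun_prop) (by fun_prop)) ?_
    refine pr_obind (hdec (by fun_prop)) ?_
    have hen : ∀ {α : Type} [Primcodable α] {f : α → Str}, Primrec f →
      Primrec (fun a => Encodable.encode (f a)) := fun hf => Primrec.encode.comp hf
    refine pr_ite (pr_dand (by fun_prop) (pr_dand ?_ ?_)) (by fun_prop) (by fun_prop)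
    · exact pr_eq (hen (by fun_prop)) (by fun_prop)
    · exact pr_eq (hen (by fun_prop)) (by fun_prop)
  have hgsome : ∀ k n σ τ, g k n = Option.some (σ, τ) ↔
      (n = Encodable.encode σ ∧ Encodable.encode τ ∈ Nat.Partrec.Code.evaln k c n ∧ τ.length ≤ k) := by
    intro k n σ τ
    simp only [g, Option.bind_eq_some_iff]
    constructor
    · rintro ⟨σ', h1, m, h2, τ', h3, h4⟩
      split_ifs at h4 with h5
      simp only [Option.some.injEq, Prod.mk.injEq] at h4
      obtain ⟨rfl, rfl⟩ := h4
      exact ⟨h5.2.1.symm, by rw [h5.2.2]; exact h2, h5.1⟩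
    · rintro ⟨rfl, h2, h3⟩
      exact ⟨σ, by simp, _, h2, τ, by simp, by simp [h3]⟩
  have hmem : ∀ σ τ, τ ∈ U σ ↔ Encodable.encode τ ∈ Nat.Partrec.Code.eval c (Encodable.encode σ) := by
    intro σ τ
    rw [hc]
    simp
  have hmono : ∀ k k' n p, k ≤ k' → g k n = Option.some p → g k' n = Option.some p := by
    rintro k k' n ⟨σ, τ⟩ hk h
    rw [hgsome] at h ⊢
    exact ⟨h.1, Nat.Partrec.Code.evaln_mono hk h.2.1, h.2.2.trans hk⟩
  have hg0 : ∀ n, g 0 n = Option.none := by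
    intro n
    cases h : g 0 n with
    | none => rfl
    | some p =>
      obtain ⟨σ, τ⟩ := p
      rw [hgsome] at h
      exact absurd (Nat.Partrec.Code.evaln_bound h.2.1) (by omega)
  let e : ℕ → Option (Str × Str) := fun i =>
    if (g (i.unpair.2 - 1) i.unpair.1).isSome = true then Option.none else g i.unpair.2 i.unpair.1
  have hes : ∀ i σ τ, e i = Option.some (σ, τ) →
      g i.unpair.2 i.unpair.1 = Option.some (σ, τ) ∧ g (i.unpair.2 - 1) i.unpair.1 = Option.none := by
    intro i σ τ h
    simp only [e] at h
    split_ifs at h with h1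
    exact ⟨h, by simpa using h1⟩
  refine ⟨e, ?_, ?_, ?_, ?_, ?_, ?_⟩
  · have hg' : ∀ {α : Type} [Primcodable α] {f h : α → ℕ}, Primrec f → Primrec h →
      Primrec (fun a => g (f a) (h a)) := fun hf hh => hgp.comp (hf.pair hh)
    refine pr_ite ?_ (by fun_prop) (hg' (by fun_prop) (by fun_prop))
    refine pr_eq (pr_isSome (hg' (by fun_prop) (by fun_prop))) (by fun_prop)
  · intro i σ τ h
    have h1 := ((hgsome _ _ _ _).1 (hes i σ τ h).1)
    rw [hmem, ← h1.1]
    exact Nat.Partrec.Code.evaln_sound h1.2.1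
  · intro σ τ h
    rw [hmem, Nat.Partrec.Code.evaln_complete] at h
    obtain ⟨k, hk⟩ := h
    have hex : ∃ k, (g k (Encodable.encode σ)).isSome = true := by
      refine ⟨max k τ.length, ?_⟩
      rw [(hgsome _ _ σ τ).2 ⟨rfl, Nat.Partrec.Code.evaln_mono (le_max_left _ _) hk, le_max_right _ _⟩]
      rfl
    have hk0 := Nat.find_spec hex
    obtain ⟨⟨σ', τ'⟩, hk1⟩ := Option.isSome_iff_exists.1 hk0
    have hk2 := (hgsome _ _ _ _).1 hk1
    have hσ : σ' = σ := (Encodable.encode_injective hk2.1).symm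
    have hτ : τ' = τ := by
      have a1 := Nat.Partrec.Code.evaln_sound hk
      have a2 := Nat.Partrec.Code.evaln_sound hk2.2.1
      exact Encodable.encode_injective (Part.mem_unique a2 a1)
    subst hσ hτ
    refine ⟨Nat.pair (Encodable.encode σ') (Nat.find hex), ?_⟩
    simp only [e, Nat.unpair_pair]
    rw [if_neg, hk1]
    intro hcon
    have h0 : Nat.find hex ≠ 0 := by
      intro h0
      rw [h0, hg0] at hk1
      simp at hk1
    exact Nat.find_min hex (m := Nat.find hex - 1) (by omega) hcon
  · intro i i' σ τ τ' h h'
    obtain ⟨a1, a2⟩ := hes _ _ _ h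
    obtain ⟨b1, b2⟩ := hes _ _ _ h'
    have c1 := (hgsome _ _ _ _).1 a1
    have c2 := (hgsome _ _ _ _).1 b1
    have hn : i.unpair.1 = i'.unpair.1 := c1.1.trans c2.1.symm
    have hk : i.unpair.2 = i'.unpair.2 := by
      rcases lt_trichotomy i.unpair.2 i'.unpair.2 with hlt | heq | hlt
      · have := hmono _ (i'.unpair.2 - 1) _ _ (by omega) a1
        rw [hn, b2] at this; simp at this
      · exact heq
      · have := hmono _ (i.unpair.2 - 1) _ _ (by omega) b1
        rw [← hn, a2] at this; simp at this
    rw [← Nat.pair_unpair i, ← Nat.pair_unpair i', hn, hk]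
  · intro i σ τ h
    have c1 := (hgsome _ _ _ _).1 (hes _ _ _ h).1
    calc σ.length ≤ Encodable.encode σ := Encodable.length_le_encode σ
      _ = i.unpair.1 := c1.1.symm
      _ ≤ i := Nat.unpair_left_le i
  · intro i σ τ h
    have c1 := (hgsome _ _ _ _).1 (hes _ _ _ h).1
    exact c1.2.2.trans (Nat.unpair_right_le i)

/-- weight of a request -/
noncomputable def rwt (o : Option (ℕ × Str)) : ℝ := (o.map (fun p => tp p.1)).getD 0

theorem rwt_some (k : ℕ) (τ : Str) : rwt (Option.some (k, τ)) = tp k := rfl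
theorem rwt_none : rwt Option.none = 0 := rfl
theorem rwt_nonneg (o : Option (ℕ × Str)) : 0 ≤ rwt o := by
  cases o with
  | none => simp [rwt]
  | some p => exact (tp_pos _).le

/-- accumulated dyadic sum -/
def kcAcc (r : ℕ → Option (ℕ × Str)) (n : ℕ) : ℕ × ℕ :=
  Nat.rec (motive := fun _ => ℕ × ℕ) (0, 0)
    (fun i p => ((r i).map (fun q => (p.1 * 2 ^ q.1 + 2 ^ p.2, p.2 + q.1))).getD p) n

/-- numerical value of the codeword -/
def kcVal (r : ℕ → Option (ℕ × Str)) (n l : ℕ) : ℕ :=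
  ((kcAcc r n).1 * 2 ^ (l + 1) + 2 ^ (kcAcc r n).2 - 1) / 2 ^ (kcAcc r n).2

/-- codewords -/
def kcCode (r : ℕ → Option (ℕ × Str)) (n : ℕ) : Option Str :=
  (r n).map (fun q => bs (q.1 + 1) (kcVal r n q.1))

theorem kcAcc_eq (r : ℕ → Option (ℕ × Str)) (n : ℕ) :
    ((kcAcc r n).1 : ℝ) * tp (kcAcc r n).2 = ∑ i ∈ Finset.range n, rwt (r i) := by
  induction n with
  | zero => simp [kcAcc]
  | succ n ih =>
    rw [Finset.sum_range_succ, ← ih]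
    have : kcAcc r (n + 1) = ((r n).map (fun q => ((kcAcc r n).1 * 2 ^ q.1 + 2 ^ (kcAcc r n).2,
      (kcAcc r n).2 + q.1))).getD (kcAcc r n) := rfl
    rw [this]
    cases h : r n with
    | none => simp [rwt_none]
    | some q =>
      simp only [Option.map_some, Option.getD_some]
      rw [show q = (q.1, q.2) from rfl, rwt_some, tp_add]
      push_cast
      have h1 := tp_mul_pow q.1
      have h2 := tp_mul_pow (kcAcc r n).2
      linear_combination ((kcAcc r n).1 : ℝ) * tp (kcAcc r n).2 * h1 + tp q.1 * h2

theorem kcVal_bounds (r : ℕ → Option (ℕ × Str)) (n l : ℕ) :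
    (∑ i ∈ Finset.range n, rwt (r i)) ≤ kcVal r n l * tp (l + 1) ∧
    kcVal r n l * tp (l + 1) < (∑ i ∈ Finset.range n, rwt (r i)) + tp (l + 1) := by
  rw [← kcAcc_eq]
  unfold kcVal
  set N := (kcAcc r n).1
  set R := (kcAcc r n).2
  set v := (N * 2 ^ (l + 1) + 2 ^ R - 1) / 2 ^ R with hv
  have hR : 0 < 2 ^ R := by positivity
  have h1 : N * 2 ^ (l + 1) ≤ v * 2 ^ R := by
    have := Nat.div_add_mod (N * 2 ^ (l + 1) + 2 ^ R - 1) (2 ^ R)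
    have h3 := Nat.mod_lt (N * 2 ^ (l + 1) + 2 ^ R - 1) hR
    rw [← hv] at this
    rw [mul_comm v]
    omega
  have h2 : v * 2 ^ R < N * 2 ^ (l + 1) + 2 ^ R := by
    have := Nat.div_mul_le_self (N * 2 ^ (l + 1) + 2 ^ R - 1) (2 ^ R)
    rw [← hv] at this
    omega
  have h1' : (N : ℝ) * 2 ^ (l + 1) ≤ v * 2 ^ R := by exact_mod_cast h1
  have h2' : (v : ℝ) * 2 ^ R < N * 2 ^ (l + 1) + 2 ^ R := by exact_mod_cast h2
  have e1 := tp_mul_pow (l + 1)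
  have e2 := tp_mul_pow R
  have p : 0 < tp (l + 1) * tp R := mul_pos (tp_pos _) (tp_pos _)
  constructor
  · calc (N : ℝ) * tp R = (N * 2 ^ (l + 1)) * (tp (l + 1) * tp R) := by
          linear_combination (-(N : ℝ) * tp R) * e1
      _ ≤ (v * 2 ^ R) * (tp (l + 1) * tp R) := mul_le_mul_of_nonneg_right h1' p.le
      _ = v * tp (l + 1) := by linear_combination (v * tp (l + 1) : ℝ) * e2
  · calc (v : ℝ) * tp (l + 1) = (v * 2 ^ R) * (tp (l + 1) * tp R) := by
          linear_combination (-(v : ℝ) * tp (l + 1)) * e2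
      _ < (N * 2 ^ (l + 1) + 2 ^ R) * (tp (l + 1) * tp R) := mul_lt_mul_of_pos_right h2' p
      _ = N * tp R + tp (l + 1) := by
          linear_combination ((N : ℝ) * tp R) * e1 + tp (l + 1) * e2

theorem kcCode_pfx (r : ℕ → Option (ℕ × Str))
    (hs : ∀ n, ∑ i ∈ Finset.range n, rwt (r i) ≤ 1) {i i' : ℕ} {c c' : Str}
    (h : kcCode r i = Option.some c) (h' : kcCode r i' = Option.some c') (hp : c <+: c') :
    i = i' := by
  simp only [kcCode, Option.map_eq_some_iff] at h h'
  obtain ⟨⟨l, τ⟩, h1, h2⟩ := h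
  obtain ⟨⟨l', τ'⟩, h1', h2'⟩ := h'
  simp only at h2 h2'
  have key : ∀ n k ρ, r n = Option.some (k, ρ) →
      ((kcVal r n k : ℝ) + 1) * tp (k + 1) ≤ ∑ i ∈ Finset.range (n + 1), rwt (r i) := by
    intro n k ρ hn
    rw [Finset.sum_range_succ, hn, rwt_some]
    have := (kcVal_bounds r n k).2
    have h3 := tp_succ k
    nlinarith
  have hlt : ∀ n k ρ, r n = Option.some (k, ρ) → kcVal r n k < 2 ^ (k + 1) := by
    intro n k ρ hn
    have h3 := (key n k ρ hn).trans (hs _)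
    have h4 : ((kcVal r n k : ℝ) + 1) ≤ 2 ^ (k + 1) := by
      have h5 := tp_mul_pow (k + 1)
      have h6 : (0 : ℝ) < 2 ^ (k + 1) := by positivity
      nlinarith
    have : kcVal r n k + 1 ≤ 2 ^ (k + 1) := by exact_mod_cast h4
    omega
  have mono : ∀ a b, a ≤ b → ∑ i ∈ Finset.range a, rwt (r i) ≤ ∑ i ∈ Finset.range b, rwt (r i) := by
    intro a b hab
    exact Finset.sum_le_sum_of_subset_of_nonneg (Finset.range_mono hab) (fun _ _ _ => rwt_nonneg _)
  rw [← h2, ← h2'] at hp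
  obtain ⟨hm, hv⟩ := bs_pfx (hlt _ _ _ h1) (hlt _ _ _ h1') hp
  set v := kcVal r i l
  set v' := kcVal r i' l'
  set d := l' + 1 - (l + 1) with hd
  have hl' : l' + 1 = (l + 1) + d := by omega
  have b1 : v * 2 ^ d ≤ v' := by rw [hv]; exact Nat.div_mul_le_self _ _
  have b2 : v' < (v + 1) * 2 ^ d := by
    rw [hv, add_mul, one_mul]; exact Nat.lt_div_mul_add (by positivity)
  have b1' : (v : ℝ) * 2 ^ d ≤ v' := by exact_mod_cast b1
  have b2' : (v' : ℝ) < (v + 1) * 2 ^ d := by exact_mod_cast b2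
  have q := tp_mul_pow d
  have c1 : (v : ℝ) * tp (l + 1) ≤ v' * tp (l' + 1) := by
    rw [hl', tp_add (l+1)]
    have := mul_le_mul_of_nonneg_right b1' (mul_pos (tp_pos (l + 1)) (tp_pos d)).le
    linear_combination this + (v * tp (l + 1) : ℝ) * (-q)
  have c2 : (v' : ℝ) * tp (l' + 1) < (v + 1) * tp (l + 1) := by
    rw [hl', tp_add (l+1)]
    have := mul_lt_mul_of_pos_right b2' (mul_pos (tp_pos (l + 1)) (tp_pos d))
    linear_combination this + ((v + 1) * tp (l + 1) : ℝ) * q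
  have B := (kcVal_bounds r i l).1
  have B' := (kcVal_bounds r i' l').1
  have K := key i l τ h1
  have K' := key i' l' τ' h1'
  rcases lt_trichotomy i i' with hlt | heq | hgt
  · have := mono (i + 1) i' hlt
    linarith
  · exact heq
  · have := mono (i' + 1) i hgt
    have := tp_pos (l' + 1)
    nlinarith

theorem KC_le_of_mem {M : Str →. Str} {ρ τ : Str} (h : τ ∈ M ρ) : KC M τ ≤ (ρ.length : ℕ∞) :=
  iInf_le (fun ρ : {ρ : Str // τ ∈ M ρ} => ((ρ : Str).length : ℕ∞)) ⟨ρ, h⟩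

/-- Kraft-Chaitin theorem. -/
theorem kc_theorem {U : Str →. Str} (hU : OptimalPF U) (r : ℕ → Option (ℕ × Str)) (hr : Primrec r)
    (hs : ∀ n, ∑ i ∈ Finset.range n, rwt (r i) ≤ 1) :
    ∃ c : ℕ, ∀ i k τ, r i = Option.some (k, τ) → KC U τ ≤ ((k + c : ℕ) : ℕ∞) := by
  have hacc : Primrec (kcAcc r) := by unfold kcAcc; fun_prop
  have hcode : Primrec (kcCode r) := by unfold kcCode kcVal; fun_prop
  let f : Str → ℕ → Option Str := fun ρ i =>
    if kcCode r i = Option.some ρ then (r i).map Prod.snd else Option.none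
  have hf : Primrec₂ f := by
    show Primrec (fun p : Str × ℕ => f p.1 p.2)
    simp only [f]
    fun_prop
  let M : Str →. Str := fun ρ => Nat.rfindOpt (f ρ)
  have hM : Partrec M := Partrec.rfindOpt hf.to_comp
  have fsome : ∀ ρ i τ, τ ∈ f ρ i → kcCode r i = Option.some ρ ∧ ∃ k, r i = Option.some (k, τ) := by
    intro ρ i τ h
    simp only [f] at h
    split_ifs at h with h1
    · refine ⟨h1, ?_⟩
      simp at h
      exact h
    · simp at h
  have hPF : PFMachine M := by
    refine ⟨hM, ?_⟩
    intro ρ₁ ρ₂ h1 h2 hp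
    obtain ⟨n1, a1, m1⟩ := Nat.rfindOpt_dom.1 h1
    obtain ⟨n2, a2, m2⟩ := Nat.rfindOpt_dom.1 h2
    have e1 := (fsome _ _ _ m1).1
    have e2 := (fsome _ _ _ m2).1
    have := kcCode_pfx r hs e1 e2 hp
    subst this
    rw [e1] at e2
    simpa using e2
  obtain ⟨c, hc⟩ := hU.2 M hPF
  refine ⟨c + 1, fun i k τ h => ?_⟩
  have hcode' : kcCode r i = Option.some (bs (k + 1) (kcVal r i k)) := by
    simp [kcCode, h]
  have hmem : τ ∈ M (bs (k + 1) (kcVal r i k)) := by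
    have hd : (M (bs (k + 1) (kcVal r i k))).Dom :=
      Nat.rfindOpt_dom.2 ⟨i, τ, by simp [f, hcode', h]⟩
    obtain ⟨y, hy⟩ := Part.dom_iff_mem.1 hd
    obtain ⟨n, hn⟩ := Nat.rfindOpt_spec hy
    obtain ⟨e1, k', e2⟩ := fsome _ _ _ hn
    have := kcCode_pfx r hs e1 hcode' (List.prefix_refl _)
    subst this
    rw [h] at e2
    simp at e2
    rw [e2.2]; exact hy
  calc KC U τ ≤ KC M τ + c := hc τ
    _ ≤ ((bs (k + 1) (kcVal r i k)).length : ℕ∞) + c := by gcongr; exact KC_le_of_mem hmem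
    _ = ((k + (c + 1) : ℕ) : ℕ∞) := by rw [bs_length]; push_cast; ring

/-- weight of the `i`-th program -/
noncomputable def wt (e : ℕ → Option (Str × Str)) (i : ℕ) : ℝ :=
  ((e i).map (fun p => tp p.1.length)).getD 0
/-- output of the `i`-th program -/
def out (e : ℕ → Option (Str × Str)) (i : ℕ) : Str := ((e i).map Prod.snd).getD []
/-- scaled weight -/
def wtN (e : ℕ → Option (Str × Str)) (s i : ℕ) : ℕ :=
  ((e i).map (fun p => 2 ^ (s - p.1.length))).getD 0

theorem wt_nonneg (e : ℕ → Option (Str × Str)) (i : ℕ) : 0 ≤ wt e i := by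
  unfold wt
  cases e i with
  | none => simp
  | some p => exact (tp_pos _).le

section
variable {U : Str →. Str} {e : ℕ → Option (Str × Str)}

theorem out_len (he : Enum U e) (i : ℕ) : (out e i).length ≤ i := by
  unfold out
  cases h : e i with
  | none => simp
  | some p => exact he.len2 i p.1 p.2 h

theorem wtN_eq (he : Enum U e) {s i : ℕ} (h : i ≤ s) : (wtN e s i : ℝ) = 2 ^ s * wt e i := by
  unfold wtN wt
  cases h' : e i with
  | none => simp
  | some p =>
    have := he.len1 i p.1 p.2 h'
    obtain ⟨d, rfl⟩ : ∃ d, s = p.1.length + d := ⟨s - p.1.length, by omega⟩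
    simp only [Option.map_some, Option.getD_some]
    rw [Nat.add_sub_cancel_left, pow_add]
    push_cast
    linear_combination (-(2 : ℝ) ^ d) * tp_mul_pow p.1.length

theorem sum_wt_le (hU : PFMachine U) (he : Enum U e) (S : Finset ℕ) : ∑ i ∈ S, wt e i ≤ 1 := by
  have h1 : ∑ i ∈ S, wt e i = ∑ i ∈ S.filter (fun i => (e i).isSome = true), wt e i := by
    rw [Finset.sum_filter]
    refine Finset.sum_congr rfl (fun i _ => ?_)
    split_ifs with h
    · rfl
    · simp only [Option.not_isSome_iff_eq_none] at h
      simp [wt, h]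
  let pr : ℕ → Str := fun i => ((e i).map Prod.fst).getD []
  have hpr : ∀ i, (e i).isSome = true → e i = Option.some (pr i, out e i) := by
    intro i hi
    obtain ⟨p, hp⟩ := Option.isSome_iff_exists.1 hi
    simp [pr, out, hp]
  set S' := S.filter (fun i => (e i).isSome = true) with hS'
  have hS : ∀ i ∈ S', (e i).isSome = true := fun i hi => (Finset.mem_filter.1 hi).2
  have hinj : Set.InjOn pr S' := by
    intro i hi i' hi' h
    have a := hpr i (hS i hi)
    have b := hpr i' (hS i' hi')
    rw [← h] at b
    exact he.inj _ _ _ _ _ a b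
  rw [h1]
  have h2 : ∑ i ∈ S', wt e i = ∑ σ ∈ S'.image pr, tp σ.length := by
    rw [Finset.sum_image hinj]
    refine Finset.sum_congr rfl (fun i hi => ?_)
    unfold wt
    rw [hpr i (hS i hi)]
    rfl
  rw [h2]
  apply kraft
  have hd : ∀ a ∈ S'.image pr, (U a).Dom := by
    intro a ha
    obtain ⟨i, hi, rfl⟩ := Finset.mem_image.1 ha
    exact Part.dom_iff_mem.2 ⟨_, he.sound _ _ _ (hpr i (hS i hi))⟩
  intro a ha b hb hab
  exact hU.2 a b (hd a ha) (hd b hb) hab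

theorem KC_le_iff (he : Enum U e) (τ : Str) (k : ℕ) : KC U τ ≤ (k : ℕ∞) ↔
    ∃ i σ, e i = Option.some (σ, τ) ∧ σ.length ≤ k := by
  constructor
  · intro h
    have h1 : KC U τ < ((k + 1 : ℕ) : ℕ∞) := lt_of_le_of_lt h (by exact_mod_cast Nat.lt_succ_self k)
    unfold KC at h1
    rw [iInf_lt_iff] at h1
    obtain ⟨⟨ρ, hρ⟩, h2⟩ := h1
    obtain ⟨i, hi⟩ := he.compl ρ τ hρ
    refine ⟨i, ρ, hi, ?_⟩
    have : ρ.length < k + 1 := by exact_mod_cast h2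
    omega
  · rintro ⟨i, σ, h1, h2⟩
    exact (KC_le_of_mem (he.sound _ _ _ h1)).trans (by exact_mod_cast h2)

theorem KC_le_wt (he : Enum U e) {τ : Str} {k : ℕ} (h : KC U τ ≤ (k : ℕ∞)) :
    ∃ i, out e i = τ ∧ tp k ≤ wt e i := by
  obtain ⟨i, σ, h1, h2⟩ := (KC_le_iff he τ k).1 h
  exact ⟨i, by simp [out, h1], by simpa [wt, h1] using tp_anti h2⟩

/-- to prove `KC U a ≤ KC U b + c` it suffices to treat programs -/
theorem KC_le_KC (he : Enum U e) {a b : Str} {c : ℕ}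
    (h : ∀ i σ, e i = Option.some (σ, b) → KC U a ≤ ((σ.length + c : ℕ) : ℕ∞)) :
    KC U a ≤ KC U b + c := by
  by_cases hb : KC U b = ⊤
  · rw [hb]; simp
  · obtain ⟨k, hk⟩ := ENat.ne_top_iff_exists.1 hb
    obtain ⟨i, σ, h1, h2⟩ := (KC_le_iff he b k).1 hk.symm.le
    refine (h i σ h1).trans ?_
    rw [← hk]
    exact_mod_cast Nat.add_le_add_right h2 c

@[fun_prop] theorem pr_out (he : Enum U e) {α : Type*} [Primcodable α] {f : α → ℕ} (hf : Primrec f) :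
    Primrec (fun a => out e (f a)) := by
  have := he.prim
  unfold out; fun_prop
theorem pr_wtN (he : Enum U e) {α : Type*} [Primcodable α] {f g : α → ℕ} (hf : Primrec f)
    (hg : Primrec g) : Primrec (fun a => wtN e (f a) (g a)) := by
  have := he.prim
  unfold wtN; fun_prop

/-- primitive recursive approximations to a sequence, without returns to old values -/
structure Appr (X : ℕ → Bool) (P : ℕ → ℕ → Str) : Prop where
  prim : Primrec (fun p : ℕ × ℕ => P p.1 p.2)
  len : ∀ s x, (P s x).length = x
  take : ∀ s x y, x ≤ y → (P s y).take x = P s x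
  nr : ∀ s t u x, s ≤ t → t ≤ u → P s x = P u x → P t x = P s x
  lim : ∀ x, ∃ s0, ∀ s, s0 ≤ s → P s x = restrSeq X x


theorem restrSeq_length (X : ℕ → Bool) (n : ℕ) : (restrSeq X n).length = n := by simp [restrSeq]

theorem ktrivial_of_eventually_const (hU : OptimalPF U) (he : Enum U e) (X : ℕ → Bool) (N : ℕ) (c : Bool)
    (h : ∀ n, N ≤ n → X n = c) : KTrivialSeq U X := by
  have hX : ∀ n, X n = (restrSeq X N).getD n c := by
    intro n
    by_cases hn : n < N
    · simp [restrSeq, List.getD_eq_getElem?_getD, hn]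
    · simp [restrSeq, List.getD_eq_getElem?_getD, hn, h n (by omega)]
  let r : ℕ → Option (ℕ × Str) := fun i => (e i).map (fun p => (p.1.length, restrSeq X p.2.length))
  have hr : Primrec r := by
    have h0 := he.prim
    have : restrSeq X = fun n => (List.range n).map (fun i => (restrSeq X N).getD i c) := by
      funext n
      simp only [restrSeq]
      apply List.map_congr_left
      intro i _
      exact hX i
    simp only [r]
    have h2 : Primrec (restrSeq X) := by rw [this]; fun_prop
    fun_prop
  have hs : ∀ n, ∑ i ∈ Finset.range n, rwt (r i) ≤ 1 := by
    intro n
    refine le_trans (le_of_eq (Finset.sum_congr rfl (fun i _ => ?_))) (sum_wt_le hU.1 he (Finset.range n))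
    simp only [r, rwt, wt]
    cases e i <;> rfl
  obtain ⟨k, hk⟩ := kc_theorem hU r hr hs
  refine ⟨k, fun n => KC_le_KC he ?_⟩
  intro i σ hi
  refine hk i _ _ ?_
  simp [r, hi, zeroStr]

theorem bs_succ (x v : ℕ) (b : Bool) : bs (x + 1) (2 * v + b.toNat) = bs x v ++ [b] := by
  unfold bs
  rw [List.range_succ, List.map_append]
  congr 1
  · apply List.map_congr_left
    intro i hi
    rw [List.mem_range] at hi
    rw [show x + 1 - 1 - i = (x - 1 - i) + 1 by omega, pow_succ', ← Nat.div_div_eq_div_mul]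
    rw [show (2 * v + b.toNat) / 2 = v by have := Bool.toNat_lt b; omega]
  · cases b <;> simp

/-- numerical value of an initial segment -/
def nv (X : ℕ → Bool) : ℕ → ℕ
  | 0 => 0
  | n + 1 => 2 * nv X n + (X n).toNat

theorem bs_nv (X : ℕ → Bool) (x : ℕ) : bs x (nv X x) = restrSeq X x := by
  induction x with
  | zero => simp [bs, restrSeq]
  | succ n ih => rw [nv, bs_succ, ih]; simp [restrSeq, List.range_succ]

theorem sum_nv (X : ℕ → Bool) (x : ℕ) :
    ∑ i ∈ Finset.range x, (cond (X i) ((2 : ℝ) ^ (i + 1))⁻¹ 0) = nv X x * tp x := by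
  induction x with
  | zero => simp [nv]
  | succ n ih =>
    rw [Finset.sum_range_succ, ih, nv, tp_succ]
    push_cast
    have : ((2 : ℝ) ^ (n + 1))⁻¹ = tp n / 2 := by
      rw [← tp_succ, tp, inv_pow]
    rw [this]
    cases X n <;> simp <;> ring

theorem hasSum_tail (x : ℕ) : HasSum (fun i : ℕ => ((2 : ℝ) ^ (i + x + 1))⁻¹) (tp x) := by
  have := hasSum_geometric_two' (tp x)
  convert this using 2 with i
  rw [tp, inv_pow, pow_succ, pow_add]
  field_simp

theorem summable_real (X : ℕ → Bool) (x : ℕ) :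
    Summable (fun i : ℕ => (cond (X (i + x)) ((2 : ℝ) ^ (i + x + 1))⁻¹ 0)) := by
  refine Summable.of_nonneg_of_le (fun i => ?_) (fun i => ?_) (hasSum_tail x).summable
  · cases X (i + x) <;> simp
  · cases X (i + x) <;> simp

theorem real_split (X : ℕ → Bool) (x : ℕ) : realOfSeq X = nv X x * tp x +
    ∑' i : ℕ, (cond (X (i + x)) ((2 : ℝ) ^ (i + x + 1))⁻¹ 0) := by
  unfold realOfSeq
  rw [← sum_nv]
  exact ((summable_real X 0).sum_add_tsum_nat_add x).symm

theorem real_lower (X : ℕ → Bool) (x : ℕ) (h : ∃ n, x ≤ n ∧ X n = true) :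
    nv X x * tp x < realOfSeq X := by
  rw [real_split X x]
  obtain ⟨n, hn, hX⟩ := h
  have : 0 < ∑' i : ℕ, (cond (X (i + x)) ((2 : ℝ) ^ (i + x + 1))⁻¹ 0) := by
    refine (summable_real X x).tsum_pos (fun i => ?_) (n - x) ?_
    · cases X (i + x) <;> simp
    · rw [show n - x + x = n by omega, hX]; simp
  linarith

theorem real_upper (X : ℕ → Bool) (x : ℕ) (h : ∃ n, x ≤ n ∧ X n = false) :
    realOfSeq X < (nv X x + 1) * tp x := by
  rw [real_split X x]
  obtain ⟨n, hn, hX⟩ := h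
  have : ∑' i : ℕ, (cond (X (i + x)) ((2 : ℝ) ^ (i + x + 1))⁻¹ 0) < tp x := by
    rw [← (hasSum_tail x).tsum_eq]
    refine Summable.tsum_lt_tsum (i := n - x) (fun i => ?_) ?_ (summable_real X x) (hasSum_tail x).summable
    · cases X (i + x) <;> simp
    · rw [show n - x + x = n by omega, hX]; simp
  linarith
end

theorem int_toNat_encode (z : ℤ) :
    (if Encodable.encode z % 2 = 0 then Encodable.encode z / 2 else 0) = z.toNat := by
  cases z with
  | ofNat k =>
    have : Encodable.encode (Int.ofNat k) = 2 * k := rfl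
    rw [this]; simp
  | negSucc k =>
    have : Encodable.encode (Int.negSucc k) = 2 * k + 1 := rfl
    rw [this, if_neg (by omega)]; simp

theorem exists_num (X : ℕ → Bool) (hX : CEReal X) : ∃ num h : ℕ → ℕ, Primrec num ∧ Primrec h ∧
    (∀ s t, s ≤ t → num s * tp (h s) ≤ num t * tp (h t)) ∧
    (∀ s, num s * tp (h s) ≤ realOfSeq X) ∧
    (∀ y, y < realOfSeq X → ∃ s0, ∀ s, s0 ≤ s → y < num s * tp (h s)) := by
  obtain ⟨f, hf, hmono, hlim⟩ := hX
  obtain ⟨c, hc⟩ := Nat.Partrec.Code.exists_code.1 hf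
  have hev : ∀ n, Nat.Partrec.Code.eval c n = Part.some (Encodable.encode (f n)) := by
    intro n; rw [hc]; simp
  let v : ℕ → ℕ → Option ℕ := fun s m => Nat.Partrec.Code.evaln s c m
  have hvp : Primrec (fun p : ℕ × ℕ => v p.1 p.2) :=
    Nat.Partrec.Code.primrec_evaln.comp ((pr_fst pr_id |>.pair (Primrec.const c)).pair (pr_snd pr_id))
  have hvs : ∀ s m k, v s m = Option.some k → k = Encodable.encode (f m) := by
    intro s m k h
    have := Nat.Partrec.Code.evaln_sound (show k ∈ Nat.Partrec.Code.evaln s c m from h)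
    rw [hev] at this
    simpa using this
  have hvm : ∀ s t m, s ≤ t → (v s m).isSome = true → (v t m).isSome = true := by
    intro s t m hst h
    obtain ⟨k, hk⟩ := Option.isSome_iff_exists.1 h
    have := Nat.Partrec.Code.evaln_mono hst (show k ∈ Nat.Partrec.Code.evaln s c m from hk)
    exact Option.isSome_iff_exists.2 ⟨k, this⟩
  have hvb : ∀ s m, (v s m).isSome = true → m ≤ s := by
    intro s m h
    obtain ⟨k, hk⟩ := Option.isSome_iff_exists.1 h
    exact (Nat.Partrec.Code.evaln_bound (show k ∈ Nat.Partrec.Code.evaln s c m from hk)).le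
  have hvc : ∀ m, ∃ s, (v s m).isSome = true := by
    intro m
    have : Encodable.encode (f m) ∈ Nat.Partrec.Code.eval c m := by rw [hev]; simp
    obtain ⟨s, hs⟩ := Nat.Partrec.Code.evaln_complete.1 this
    exact ⟨s, Option.isSome_iff_exists.2 ⟨_, hs⟩⟩
  let h : ℕ → ℕ := fun s => Nat.findGreatest (fun m => (v s m).isSome = true) s
  have hhp : Primrec h := by
    refine Primrec.nat_findGreatest (f := fun s => s) (p := fun s m => (v s m).isSome = true) Primrec.id ?_
    refine ⟨inferInstance, ?_⟩
    fun_prop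
  let num : ℕ → ℕ := fun s =>
    if ((v s (h s)).getD 1) % 2 = 0 then ((v s (h s)).getD 1) / 2 else 0
  have hnp : Primrec num := by
    simp only [num]
    fun_prop
  have hh1 : ∀ s m, (v s m).isSome = true → m ≤ h s ∧ (v s (h s)).isSome = true := by
    intro s m hs
    refine ⟨Nat.le_findGreatest (hvb s m hs) hs, ?_⟩
    exact Nat.findGreatest_spec (P := fun m => (v s m).isSome = true) (hvb s m hs) hs
  have hnum1 : ∀ s, (v s (h s)).isSome = true → num s = (f (h s)).toNat := by
    intro s hs
    obtain ⟨k, hk⟩ := Option.isSome_iff_exists.1 hs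
    rw [← int_toNat_encode]
    simp only [num, hk, Option.getD_some]
    rw [hvs _ _ _ hk]
  have hnum2 : ∀ s, ¬ (v s (h s)).isSome = true → num s = 0 := by
    intro s hs
    simp only [Option.not_isSome_iff_eq_none] at hs
    simp [num, hs]
  have hdiv : ∀ n, (f n : ℝ) / 2 ^ n = f n * tp n := by
    intro n; rw [tp, inv_pow]; rfl
  have hmono' : Monotone (fun s => (f s : ℝ) * tp s) := by
    apply monotone_nat_of_le_succ
    intro n
    have := hmono n
    rwa [hdiv, hdiv] at this
  have hlim' : Tendsto (fun s => (f s : ℝ) * tp s) atTop (nhds (realOfSeq X)) := by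
    refine hlim.congr (fun s => ?_)
    rw [hdiv]
  have htn : ∀ z : ℤ, (z.toNat : ℝ) = max (z : ℝ) 0 := by
    intro z
    have : ((z.toNat : ℤ) : ℝ) = ((max z 0 : ℤ) : ℝ) := by rw [Int.toNat_eq_max]
    push_cast at this
    exact this
  have hval : ∀ s, (v s (h s)).isSome = true →
      (num s : ℝ) * tp (h s) = max ((f (h s) : ℝ) * tp (h s)) 0 := by
    intro s hs
    rw [hnum1 s hs, htn, max_mul_of_nonneg _ _ (tp_pos _).le, zero_mul]
  have hnn : 0 ≤ realOfSeq X := by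
    refine tsum_nonneg (fun i => ?_)
    cases X i <;> simp
  refine ⟨num, h, hnp, hhp, ?_, ?_, ?_⟩
  · intro s t hst
    by_cases hs : (v s (h s)).isSome = true
    · obtain ⟨h1, h2⟩ := hh1 t (h s) (hvm s t _ hst hs)
      rw [hval s hs, hval t h2]
      exact max_le_max_right 0 (hmono' h1)
    · rw [hnum2 s hs]
      have := tp_pos (h t)
      simp only [Nat.cast_zero, zero_mul]
      positivity
  · intro s
    by_cases hs : (v s (h s)).isSome = true
    · rw [hval s hs]
      exact max_le (hmono'.ge_of_tendsto hlim' _) hnn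
    · rw [hnum2 s hs]; simpa using hnn
  · intro y hy
    obtain ⟨m, hm⟩ := (hlim'.eventually (lt_mem_nhds hy)).exists
    obtain ⟨s0, hs0⟩ := hvc m
    refine ⟨s0, fun s hs => ?_⟩
    obtain ⟨h1, h2⟩ := hh1 s m (hvm s0 s m hs hs0)
    rw [hval s h2]
    exact lt_of_lt_of_le hm (le_trans (hmono' h1) (le_max_left _ _))

theorem exists_appr {U : Str →. Str} {e : ℕ → Option (Str × Str)} (hU : OptimalPF U) (he : Enum U e)
    (X : ℕ → Bool) (hX : CEReal X) (hnt : ¬ KTrivialSeq U X) : ∃ P, Appr X P := by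
  have hbit : ∀ (b : Bool) (x : ℕ), ∃ n, x ≤ n ∧ X n = b := by
    intro b x
    by_contra hcon
    push Not at hcon
    refine hnt (ktrivial_of_eventually_const hU he X x (!b) (fun n hn => ?_))
    have := hcon n hn
    revert this
    cases X n <;> cases b <;> simp
  obtain ⟨num, h, hnp, hhp, hm, hle, hlim⟩ := exists_num X hX
  let m : ℕ → ℕ → ℕ := fun s x => num s * 2 ^ x / 2 ^ h s
  have hlow : ∀ s x, (m s x : ℝ) * tp x ≤ num s * tp (h s) := by
    intro s x
    have h1 : m s x * 2 ^ h s ≤ num s * 2 ^ x := Nat.div_mul_le_self _ _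
    have h2 : (m s x : ℝ) * 2 ^ h s ≤ num s * 2 ^ x := by exact_mod_cast h1
    have h3 := mul_le_mul_of_nonneg_right h2 (mul_pos (tp_pos x) (tp_pos (h s))).le
    linear_combination h3 - m s x * tp x * tp_mul_pow (h s) + num s * tp (h s) * tp_mul_pow x
  have hup : ∀ s x, (num s : ℝ) * tp (h s) < (m s x + 1) * tp x := by
    intro s x
    have h1 : num s * 2 ^ x < m s x * 2 ^ h s + 2 ^ h s := Nat.lt_div_mul_add (by positivity)
    have h2 : (num s : ℝ) * 2 ^ x < m s x * 2 ^ h s + 2 ^ h s := by exact_mod_cast h1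
    have h3 := mul_lt_mul_of_pos_right h2 (mul_pos (tp_pos x) (tp_pos (h s)))
    linear_combination h3 + (m s x + 1) * tp x * tp_mul_pow (h s) - num s * tp (h s) * tp_mul_pow x
  have hmono : ∀ s t x, s ≤ t → m s x ≤ m t x := by
    intro s t x hst
    have h1 := hlow s x
    have h2 := hup t x
    have h3 := hm s t hst
    have h4 : (m s x : ℝ) * tp x < (m t x + 1) * tp x := by linarith
    have h5 : (m s x : ℝ) < m t x + 1 := lt_of_mul_lt_mul_right h4 (tp_pos x).le
    have : m s x < m t x + 1 := by exact_mod_cast h5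
    omega
  have hlt : ∀ s x, m s x < 2 ^ x := by
    intro s x
    have h1 := hlow s x
    have h2 := hle s
    have h3 := real_upper X 0 (hbit false 0)
    simp only [nv, Nat.cast_zero, zero_add, one_mul, tp_zero] at h3
    have h4 : (m s x : ℝ) * tp x < 2 ^ x * tp x := by
      rw [mul_comm ((2 : ℝ) ^ x), tp_mul_pow]; linarith
    exact_mod_cast lt_of_mul_lt_mul_right h4 (tp_pos x).le
  refine ⟨fun s x => bs x (m s x), ?_, ?_, ?_, ?_, ?_⟩
  · simp only [m]; fun_prop
  · intro s x; exact bs_length _ _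
  · intro s x y hxy
    rw [bs_take _ hxy]
    congr 1
    simp only [m]
    rw [Nat.div_div_eq_div_mul, mul_comm (2 ^ h s), ← Nat.div_div_eq_div_mul]
    congr 1
    obtain ⟨d, rfl⟩ := Nat.exists_eq_add_of_le hxy
    rw [Nat.add_sub_cancel_left, pow_add, ← mul_assoc, Nat.mul_div_cancel _ (by positivity)]
  · intro s t u x hst htu hsu
    have h1 := bs_inj (hlt s x) (hlt u x) hsu
    have h2 := hmono s t x hst
    have h3 := hmono t u x htu
    have : m t x = m s x := by omega
    simp only [this]
  · intro x
    obtain ⟨s0, hs0⟩ := hlim _ (real_lower X x (hbit true x))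
    refine ⟨s0, fun s hs => ?_⟩
    have h1 := hs0 s hs
    have h2 := hup s x
    have h3 := hlow s x
    have h4 := hle s
    have h5 := real_upper X x (hbit false x)
    have a1 : (nv X x : ℝ) < m s x + 1 := lt_of_mul_lt_mul_right (h1.trans h2) (tp_pos x).le
    have a2 : (m s x : ℝ) < nv X x + 1 :=
      lt_of_mul_lt_mul_right (lt_of_le_of_lt (h3.trans h4) h5) (tp_pos x).le
    have b1 : nv X x < m s x + 1 := by exact_mod_cast a1
    have b2 : m s x < nv X x + 1 := by exact_mod_cast a2
    have : m s x = nv X x := by omega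
    simp only [this]
    exact bs_nv X x

/-- mass of the programs with index `< s` satisfying `Q` -/
noncomputable def V (e : ℕ → Option (Str × Str)) (s : ℕ) (Q : ℕ → Bool) : ℝ :=
  ∑ i ∈ (Finset.range s).filter (fun i => Q i = true), wt e i

/-- scaled mass -/
def mN (e : ℕ → Option (Str × Str)) (s : ℕ) (Q : ℕ → Bool) : ℕ :=
  ((List.range s).map (fun i => cond (Q i) (wtN e s i) 0)).sum

theorem list_sum_range (f : ℕ → ℕ) (s : ℕ) :
    ((List.range s).map f).sum = ∑ i ∈ Finset.range s, f i := by
  induction s with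
  | zero => simp
  | succ n ih => rw [List.range_succ, List.map_append, List.sum_append, ih, Finset.sum_range_succ]; simp

theorem mN_eq {U : Str →. Str} {e : ℕ → Option (Str × Str)} (he : Enum U e) (s : ℕ) (Q : ℕ → Bool) :
    (mN e s Q : ℝ) = 2 ^ s * V e s Q := by
  unfold mN V
  rw [list_sum_range, Finset.sum_filter, Finset.mul_sum]
  push_cast
  refine Finset.sum_congr rfl (fun i hi => ?_)
  rw [Finset.mem_range] at hi
  cases Q i with
  | true => simpa using wtN_eq he hi.le
  | false => simp

theorem V_nonneg (e : ℕ → Option (Str × Str)) (s : ℕ) (Q : ℕ → Bool) : 0 ≤ V e s Q :=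
  Finset.sum_nonneg (fun i _ => wt_nonneg e i)

theorem V_mono (e : ℕ → Option (Str × Str)) {s t : ℕ} {Q Q' : ℕ → Bool}
    (hst : s ≤ t) (h : ∀ i, i < s → Q i = true → Q' i = true) : V e s Q ≤ V e t Q' := by
  unfold V
  refine Finset.sum_le_sum_of_subset_of_nonneg ?_ (fun i _ _ => wt_nonneg e i)
  intro i hi
  simp only [Finset.mem_filter, Finset.mem_range] at hi ⊢
  exact ⟨by omega, h i hi.1 hi.2⟩

/-- segment of the finite set `l` -/
def seg (l : List ℕ) (m : ℕ) : Str := (List.range m).map (fun i => decide (i ∈ l))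

@[fun_prop] theorem pr_seg {α : Type*} [Primcodable α] {f : α → List ℕ} {g : α → ℕ}
    (hf : Primrec f) (hg : Primrec g) : Primrec (fun a => seg (f a) (g a)) := by
  unfold seg; fun_prop

section
variable (e : ℕ → Option (Str × Str)) (P R : ℕ → ℕ → Str)

/-- predicate for `α` -/
def qA (s p i : ℕ) : Bool := decide (p < (out e i).length ∧
  (out e i = P s (out e i).length ∨ out e i = R s (out e i).length))
/-- predicate for `β` -/
def qB (l : List ℕ) (p i : ℕ) : Bool := decide (p < (out e i).length ∧
  out e i = seg l (out e i).length)

/-- attack at stage `s`? -/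
def attack (s : ℕ) (l : List ℕ) : Bool := decide (¬ s.unpair.1 ∈ l ∧
  mN e s (qA e P R s s.unpair.1) ≤ mN e s (qB e l s.unpair.1) ∧
  2 * 2 ^ s ≤ s.unpair.1 * mN e s (qB e l s.unpair.1))

/-- stages of `B` -/
def Bst (s : ℕ) : List ℕ := Nat.rec (motive := fun _ => List ℕ) []
  (fun s l => cond (attack e P R s l) (s.unpair.1 :: l) l) s

/-- the sequence `B` -/
noncomputable def Bseq (i : ℕ) : Bool := decide (∃ s, i ∈ Bst e P R s)

/-- requests for `B ≤_K A` -/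
def rqN (Q : ℕ → ℕ → Str) (k : ℕ) : Option (ℕ × Str) :=
  if (k.unpair.2 ≤ k.unpair.1 ∧ out e k.unpair.2 = Q (k.unpair.1 + 1) (out e k.unpair.2).length ∧
    ¬ (k.unpair.2 < k.unpair.1 ∧ out e k.unpair.2 = Q k.unpair.1 (out e k.unpair.2).length ∧
      seg (Bst e P R k.unpair.1) (out e k.unpair.2).length =
        seg (Bst e P R (k.unpair.1 + 1)) (out e k.unpair.2).length)) then
    (e k.unpair.2).map (fun p => (p.1.length + 1,
      seg (Bst e P R (k.unpair.1 + 1)) (out e k.unpair.2).length))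
  else Option.none
end

section
variable {U : Str →. Str} {e : ℕ → Option (Str × Str)} {P R : ℕ → ℕ → Str} {A D : ℕ → Bool}

theorem Bst_succ (s : ℕ) : Bst e P R (s + 1) =
    cond (attack e P R s (Bst e P R s)) (s.unpair.1 :: Bst e P R s) (Bst e P R s) := rfl

theorem pr_out' (he : Enum U e) : Primrec (out e) := pr_out he pr_id
theorem pr_wtN' (he : Enum U e) : Primrec (fun p : ℕ × ℕ => wtN e p.1 p.2) :=
  pr_wtN he (pr_fst pr_id) (pr_snd pr_id)

theorem pr_mN (he : Enum U e) {α : Type*} [Primcodable α] {f : α → ℕ} {Q : α → ℕ → Bool}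
    (hf : Primrec f) (hQ : Primrec (fun p : α × ℕ => Q p.1 p.2)) :
    Primrec (fun a => mN e (f a) (Q a)) := by
  have := pr_wtN' he
  unfold mN
  fun_prop

theorem pr_Bst (he : Enum U e) (hP : Appr A P) (hR : Appr D R) : Primrec (Bst e P R) := by
  have h1 := pr_out' he
  have h2 := hP.prim
  have h3 := hR.prim
  have hqA : Primrec (fun p : ℕ × ℕ × ℕ => qA e P R p.1 p.2.1 p.2.2) := by
    unfold qA; fun_prop
  have hqB : Primrec (fun p : List ℕ × ℕ × ℕ => qB e p.1 p.2.1 p.2.2) := by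
    unfold qB; fun_prop
  have hmA : Primrec (fun p : ℕ × ℕ => mN e p.1 (qA e P R p.1 p.2)) :=
    pr_mN he (by fun_prop) (by fun_prop)
  have hmB : Primrec (fun p : ℕ × List ℕ × ℕ => mN e p.1 (qB e p.2.1 p.2.2)) :=
    pr_mN he (by fun_prop) (by fun_prop)
  have hat : Primrec (fun p : ℕ × List ℕ => attack e P R p.1 p.2) := by
    unfold attack
    refine pr_dand (by fun_prop) (pr_dand (pr_le ?_ ?_) (pr_le (by fun_prop) (pr_mul (by fun_prop) ?_)))
    · exact hmA.comp (pr_pair (f := fun p : ℕ × List ℕ => p.1) (by fun_prop) (g := fun p => p.1.unpair.1) (by fun_prop))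
    · exact hmB.comp (f := fun p : ℕ × List ℕ × ℕ => mN e p.1 (qB e p.2.1 p.2.2)) (g := fun p : ℕ × List ℕ => (p.1, p.2, p.1.unpair.1)) (by fun_prop)
    · exact hmB.comp (f := fun p : ℕ × List ℕ × ℕ => mN e p.1 (qB e p.2.1 p.2.2)) (g := fun p : ℕ × List ℕ => (p.1, p.2, p.1.unpair.1)) (by fun_prop)
  unfold Bst
  fun_prop

theorem Bst_mono {s t i : ℕ} (hst : s ≤ t) (h : i ∈ Bst e P R s) : i ∈ Bst e P R t := by
  induction hst with
  | refl => exact h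
  | step _ ih =>
    rw [Bst_succ]
    cases attack e P R _ _ <;> simp [ih]

theorem Bst_lt {s i : ℕ} (h : i ∈ Bst e P R s) : i < s := by
  induction s with
  | zero => simp [Bst] at h
  | succ n ih =>
    rw [Bst_succ] at h
    cases hc : attack e P R n (Bst e P R n) with
    | false => rw [hc] at h; exact (ih h).trans (Nat.lt_succ_self n)
    | true =>
      rw [hc] at h
      simp only [cond_true, List.mem_cons] at h
      rcases h with rfl | h
      · exact Nat.lt_succ_of_le (Nat.unpair_left_le n)
      · exact (ih h).trans (Nat.lt_succ_self n)

theorem Bseq_lim (i : ℕ) : ∃ s0, ∀ s, s0 ≤ s → decide (i ∈ Bst e P R s) = Bseq e P R i := by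
  by_cases h : ∃ s, i ∈ Bst e P R s
  · obtain ⟨s0, hs0⟩ := h
    refine ⟨s0, fun s hs => ?_⟩
    rw [Bseq, decide_eq_true (Bst_mono hs hs0), decide_eq_true ⟨s0, hs0⟩]
  · refine ⟨0, fun s _ => ?_⟩
    rw [Bseq, decide_eq_false h, decide_eq_false (fun h' => h ⟨s, h'⟩)]

theorem seg_lim (x : ℕ) : ∃ s0, ∀ s, s0 ≤ s → seg (Bst e P R s) x = restrSeq (Bseq e P R) x := by
  induction x with
  | zero => exact ⟨0, fun s _ => by simp [seg, restrSeq]⟩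
  | succ n ih =>
    obtain ⟨s0, h0⟩ := ih
    obtain ⟨s1, h1⟩ := Bseq_lim (e := e) (P := P) (R := R) n
    refine ⟨max s0 s1, fun s hs => ?_⟩
    have a := h0 s (le_trans (le_max_left _ _) hs)
    have b := h1 s (le_trans (le_max_right _ _) hs)
    simp only [seg, restrSeq] at a ⊢
    rw [List.range_succ, List.map_append, List.map_append, a]
    simp [b]

theorem cereal_B (he : Enum U e) (hP : Appr A P) (hR : Appr D R) : CEReal (Bseq e P R) := by
  have hp := pr_Bst he hP hR
  let f : ℕ → ℕ := fun s =>
    ((List.range s).map (fun i => cond (decide (i ∈ Bst e P R s)) (2 ^ (s - 1 - i)) 0)).sum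
  have hf : Primrec f := by simp only [f]; fun_prop
  have hval : ∀ s, ((Int.ofNat (f s) : ℤ) : ℝ) / 2 ^ s =
      ∑' i, cond (decide (i ∈ Bst e P R s)) ((2 : ℝ) ^ (i + 1))⁻¹ 0 := by
    intro s
    rw [tsum_eq_sum (s := Finset.range s)]
    · simp only [f, list_sum_range]
      rw [show ∀ n : ℕ, Int.ofNat n = (n : ℤ) from fun _ => rfl]
      push_cast
      rw [Finset.sum_div]
      refine Finset.sum_congr rfl (fun i hi => ?_)
      rw [Finset.mem_range] at hi
      by_cases h : i ∈ Bst e P R s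
      · simp only [h, decide_true, cond_true]
        push_cast
        rw [div_eq_iff (by positivity), eq_comm, inv_mul_eq_iff_eq_mul₀ (by positivity), ← pow_add]
        congr 1; omega
      · simp [h]
    · intro i hi
      have : i ∉ Bst e P R s := fun h => hi (Finset.mem_range.2 (Bst_lt h))
      simp [this]
  have hsum0 : Summable (fun i : ℕ => ((2 : ℝ) ^ (i + 1))⁻¹) := (hasSum_tail 0).summable
  have hsum : ∀ X : ℕ → Bool, Summable (fun i : ℕ => cond (X i) ((2 : ℝ) ^ (i + 1))⁻¹ 0) :=
    fun X => summable_real X 0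
  refine ⟨fun s => Int.ofNat (f s), (pr_ofNat hf).to_comp, fun s => ?_, ?_⟩
  · rw [hval, hval]
    refine Summable.tsum_le_tsum (fun i => ?_) (hsum _) (hsum _)
    by_cases h : i ∈ Bst e P R s
    · rw [decide_eq_true h, decide_eq_true (Bst_mono (Nat.le_succ s) h)]
    · rw [decide_eq_false h]
      cases decide (i ∈ Bst e P R (s + 1)) <;> simp
  · simp_rw [hval]
    unfold realOfSeq
    refine tendsto_tsum_of_dominated_convergence hsum0 (fun i => ?_) (Eventually.of_forall (fun s i => ?_))
    · obtain ⟨s0, h0⟩ := Bseq_lim (e := e) (P := P) (R := R) i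
      refine tendsto_const_nhds.congr' ?_
      filter_upwards [eventually_ge_atTop s0] with s hs
      rw [h0 s hs]
    · cases decide (i ∈ Bst e P R s) <;> simp

/-- `p` is attacked at `s` -/
def att (e : ℕ → Option (Str × Str)) (P R : ℕ → ℕ → Str) (s : ℕ) : Prop :=
  attack e P R s (Bst e P R s) = true

theorem att_spec (he : Enum U e) {s : ℕ} : att e P R s ↔ s.unpair.1 ∉ Bst e P R s ∧
    V e s (qA e P R s s.unpair.1) ≤ V e s (qB e (Bst e P R s) s.unpair.1) ∧
    2 ≤ s.unpair.1 * V e s (qB e (Bst e P R s) s.unpair.1) := by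
  unfold att attack
  rw [decide_eq_true_iff]
  refine and_congr Iff.rfl (and_congr ?_ ?_)
  · rw [← Nat.cast_le (α := ℝ), mN_eq he, mN_eq he]
    exact mul_le_mul_iff_right₀ (by positivity)
  · rw [← Nat.cast_le (α := ℝ)]
    push_cast
    rw [mN_eq he, mul_left_comm, mul_comm (2 : ℝ)]
    exact mul_le_mul_iff_right₀ (by positivity)

theorem seg_ne {l l' : List ℕ} {p m : ℕ} (hp : p < m) (h : p ∉ l) (h' : p ∈ l') : seg l m ≠ seg l' m := by
  intro hcon
  have := List.map_inj_left.1 hcon p (List.mem_range.2 hp)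
  simp [h, h'] at this

theorem seg_congr_of {l l' : List ℕ} {m : ℕ} (h : ∀ i, i < m → (i ∈ l ↔ i ∈ l')) : seg l m = seg l' m := by
  refine List.map_congr_left (fun i hi => ?_)
  simp [h i (List.mem_range.1 hi)]

theorem att_mem {s : ℕ} (h : att e P R s) : s.unpair.1 ∈ Bst e P R (s + 1) := by
  rw [Bst_succ, show attack e P R s (Bst e P R s) = true from h]; simp

theorem sum_beta_le (hU : PFMachine U) (he : Enum U e) (S : Finset ℕ) (hS : ∀ s ∈ S, att e P R s) :
    ∑ s ∈ S, V e s (qB e (Bst e P R s) s.unpair.1) ≤ 1 := by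
  unfold V
  rw [← Finset.sum_biUnion]
  · exact sum_wt_le hU he _
  · have key : ∀ s ∈ S, ∀ t ∈ S, s < t → Disjoint
        ((Finset.range s).filter (fun i => qB e (Bst e P R s) s.unpair.1 i = true))
        ((Finset.range t).filter (fun i => qB e (Bst e P R t) t.unpair.1 i = true)) := by
      intro s hs t ht hst
      rw [Finset.disjoint_left]
      intro i hi hi'
      simp only [Finset.mem_filter, qB, decide_eq_true_iff] at hi hi'
      refine seg_ne hi.2.1 ((att_spec he).1 (hS s hs)).1 (Bst_mono hst (att_mem (hS s hs))) ?_
      rw [← hi.2.2, ← hi'.2.2]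
    intro s hs t ht hne
    rcases lt_or_gt_of_ne hne with h | h
    · exact key s hs t ht h
    · exact (key t ht s hs h).symm

theorem sum_pair_le (g : ℕ → ℝ) (hg : ∀ k, 0 ≤ g k) (n : ℕ) :
    ∑ k ∈ Finset.range n, g k ≤ ∑ s ∈ Finset.range n, ∑ i ∈ Finset.range n, g (Nat.pair s i) := by
  rw [← Finset.sum_product']
  have : ∑ k ∈ Finset.range n, g k =
      ∑ p ∈ (Finset.range n).image Nat.unpair, g (Nat.pair p.1 p.2) := by
    rw [Finset.sum_image]
    · simp
    · intro a _ b _ h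
      rw [← Nat.pair_unpair a, h, Nat.pair_unpair]
  rw [this]
  refine Finset.sum_le_sum_of_subset_of_nonneg ?_ (fun p _ _ => hg _)
  intro p hp
  obtain ⟨k, hk, rfl⟩ := Finset.mem_image.1 hp
  rw [Finset.mem_range] at hk
  simp only [Finset.mem_product, Finset.mem_range]
  exact ⟨lt_of_le_of_lt (Nat.unpair_left_le k) hk, lt_of_le_of_lt (Nat.unpair_right_le k) hk⟩

theorem rqN_sum (hU : PFMachine U) (he : Enum U e) {X : ℕ → Bool} {Q : ℕ → ℕ → Str} (hQ : Appr X Q)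
    (hQPR : Q = P ∨ Q = R) (n : ℕ) :
    ∑ k ∈ Finset.range n, rwt (rqN e P R Q k) ≤ 1 := by
  refine (sum_pair_le _ (fun k => rwt_nonneg _) n).trans ?_
  let first : ℕ → ℕ → Prop := fun s i => i ≤ s ∧ out e i = Q (s + 1) (out e i).length ∧
    ¬ (i < s ∧ out e i = Q s (out e i).length)
  let chg : ℕ → ℕ → Prop := fun s i => i < s ∧ out e i = Q s (out e i).length ∧
    seg (Bst e P R s) (out e i).length ≠ seg (Bst e P R (s + 1)) (out e i).length
  have hb : ∀ s i, rwt (rqN e P R Q (Nat.pair s i)) ≤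
      ((if first s i then wt e i else 0) + (if chg s i then wt e i else 0)) / 2 := by
    intro s i
    have hw := wt_nonneg e i
    have h0 : rwt ((e i).map (fun p => (p.1.length + 1,
      seg (Bst e P R (s + 1)) (out e i).length))) = wt e i / 2 := by
      unfold rwt wt
      cases e i with
      | none => simp
      | some p => simp [tp_succ]
    unfold rqN
    simp only [Nat.unpair_pair]
    split_ifs with h1 h2 h3 h3 h2 h3
    all_goals try rw [h0]
    all_goals try rw [rwt_none]
    all_goals try linarith
    exfalso
    simp only [first, chg] at h2 h3
    tauto
  have hfirst : ∀ i, ∑ s ∈ Finset.range n, (if first s i then wt e i else 0) ≤ wt e i := by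
    intro i
    rw [← Finset.sum_filter, Finset.sum_const, nsmul_eq_mul]
    have : ((Finset.range n).filter (fun s => first s i)).card ≤ 1 := by
      rw [Finset.card_le_one]
      have key : ∀ s t, first s i → first t i → ¬ s < t := by
        intro s t h1 h2 hst
        refine h2.2.2 ⟨lt_of_le_of_lt h1.1 hst, ?_⟩
        have := hQ.nr (s + 1) t (t + 1) (out e i).length hst (Nat.le_succ t) (h1.2.1.symm.trans h2.2.1)
        rw [this]; exact h1.2.1
      intro s hs t ht
      have h1 := (Finset.mem_filter.1 hs).2
      have h2 := (Finset.mem_filter.1 ht).2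
      have := key s t h1 h2
      have := key t s h2 h1
      omega
    have h2 : (((Finset.range n).filter (fun s => first s i)).card : ℝ) ≤ 1 := by exact_mod_cast this
    have := wt_nonneg e i
    nlinarith
  have hchg : ∀ s, ∑ i ∈ Finset.range n, (if chg s i then wt e i else 0) ≤
      if att e P R s then V e s (qB e (Bst e P R s) s.unpair.1) else 0 := by
    intro s
    by_cases hs : att e P R s
    · rw [if_pos hs]
      refine le_trans ?_ ((att_spec he).1 hs).2.1
      rw [← Finset.sum_filter]
      unfold V
      refine Finset.sum_le_sum_of_subset_of_nonneg ?_ (fun i _ _ => wt_nonneg e i)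
      intro i hi
      have hc := (Finset.mem_filter.1 hi).2
      simp only [Finset.mem_filter, Finset.mem_range, qA, decide_eq_true_iff]
      refine ⟨hc.1, ?_, ?_⟩
      · by_contra hlt
        refine hc.2.2 (seg_congr_of (fun x hx => ?_))
        rw [Bst_succ, show attack e P R s (Bst e P R s) = true from hs]
        simp only [cond_true, List.mem_cons]
        constructor
        · exact Or.inr
        · rintro (h | h)
          · omega
          · exact h
      · rcases hQPR with h | h
        · left; rw [← h]; exact hc.2.1
        · right; rw [← h]; exact hc.2.1
    · rw [if_neg hs]
      refine le_of_eq (Finset.sum_eq_zero (fun i _ => ?_))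
      rw [if_neg]
      intro hc
      refine hc.2.2 ?_
      have : attack e P R s (Bst e P R s) = false := by simpa [att] using hs
      rw [Bst_succ, this]; rfl
  calc ∑ s ∈ Finset.range n, ∑ i ∈ Finset.range n, rwt (rqN e P R Q (Nat.pair s i))
      ≤ ∑ s ∈ Finset.range n, ∑ i ∈ Finset.range n,
        ((if first s i then wt e i else 0) + (if chg s i then wt e i else 0)) / 2 :=
        Finset.sum_le_sum (fun s _ => Finset.sum_le_sum (fun i _ => hb s i))
    _ = (∑ i ∈ Finset.range n, ∑ s ∈ Finset.range n, (if first s i then wt e i else 0) +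
        ∑ s ∈ Finset.range n, ∑ i ∈ Finset.range n, (if chg s i then wt e i else 0)) / 2 := by
        rw [Finset.sum_comm (s := Finset.range n) (t := Finset.range n)
          (f := fun i s => if first s i then wt e i else 0)]
        rw [← Finset.sum_add_distrib, Finset.sum_div]
        refine Finset.sum_congr rfl (fun s _ => ?_)
        rw [← Finset.sum_add_distrib, Finset.sum_div]
    _ ≤ (∑ i ∈ Finset.range n, wt e i + ∑ s ∈ Finset.range n,
        (if att e P R s then V e s (qB e (Bst e P R s) s.unpair.1) else 0)) / 2 := by
        have h1 := Finset.sum_le_sum (fun i (_ : i ∈ Finset.range n) => hfirst i)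
        have h2 := Finset.sum_le_sum (fun s (_ : s ∈ Finset.range n) => hchg s)
        linarith
    _ ≤ (1 + 1) / 2 := by
        have h1 := sum_wt_le hU he (Finset.range n)
        have h2 := sum_beta_le (P := P) (R := R) hU he ((Finset.range n).filter (fun s => att e P R s))
          (fun s hs => (Finset.mem_filter.1 hs).2)
        rw [Finset.sum_filter] at h2
        linarith
    _ = 1 := by norm_num

theorem B_le (hU : OptimalPF U) (he : Enum U e) (hP : Appr A P) (hR : Appr D R)
    {X : ℕ → Bool} {Q : ℕ → ℕ → Str} (hQ : Appr X Q) (hQPR : Q = P ∨ Q = R) :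
    KLeSeq U (Bseq e P R) X := by
  have hpr : Primrec (rqN e P R Q) := by
    have h1 := pr_out' he
    have h2 := hQ.prim
    have h3 := pr_Bst he hP hR
    have h4 := he.prim
    unfold rqN
    fun_prop
  obtain ⟨c, hc⟩ := kc_theorem hU _ hpr (rqN_sum hU.1 he hQ hQPR)
  have key : ∀ s i, i < s → out e i = Q s (out e i).length → ∀ σ, e i = Option.some (σ, out e i) →
      ∃ k, rqN e P R Q k = Option.some (σ.length + 1, seg (Bst e P R s) (out e i).length) := by
    intro s
    induction s with
    | zero => intro i hi; omega
    | succ s ih =>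
      intro i hi ho σ hσ
      by_cases hold : i < s ∧ out e i = Q s (out e i).length ∧
        seg (Bst e P R s) (out e i).length = seg (Bst e P R (s + 1)) (out e i).length
      · rw [← hold.2.2]
        exact ih i hold.1 hold.2.1 σ hσ
      · refine ⟨Nat.pair s i, ?_⟩
        unfold rqN
        simp only [Nat.unpair_pair]
        rw [if_pos ⟨by omega, ho, hold⟩, hσ]
        rfl
  refine ⟨1 + c, fun n => KC_le_KC he ?_⟩
  intro i σ hi
  obtain ⟨s0, h0⟩ := hQ.lim n
  obtain ⟨s1, h1⟩ := seg_lim (e := e) (P := P) (R := R) n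
  have ho : out e i = restrSeq X n := by simp [out, hi]
  have hl : (out e i).length = n := by rw [ho, restrSeq_length]
  set s := max (max s0 s1) (i + 1) with hs
  have e0 : s0 ≤ s := by omega
  have e1 : s1 ≤ s := by omega
  obtain ⟨k, hk⟩ := key s i (by omega) (by rw [hl, h0 s e0, ho]) σ (by rw [ho]; exact hi)
  rw [hl, h1 s e1] at hk
  rw [← add_assoc]
  exact hc k _ _ hk
end

section
variable {U : Str →. Str} {e : ℕ → Option (Str × Str)} {P R : ℕ → ℕ → Str} {A D : ℕ → Bool}

theorem mem_att {s p : ℕ} (h : p ∈ Bst e P R s) : ∃ s', att e P R s' ∧ s'.unpair.1 = p := by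
  induction s with
  | zero => simp [Bst] at h
  | succ n ih =>
    rw [Bst_succ] at h
    by_cases ha : att e P R n
    · have ha' : attack e P R n (Bst e P R n) = true := ha
      rw [ha'] at h
      simp only [cond_true, List.mem_cons] at h
      rcases h with h | h
      · exact ⟨n, ha, h.symm⟩
      · exact ih h
    · have ha' : attack e P R n (Bst e P R n) = false := by
        simpa [att] using ha
      rw [ha'] at h
      exact ih h

theorem exists_nonmem (hU : PFMachine U) (he : Enum U e) {x : ℕ} (hx : 1 ≤ x) :
    ∃ p, x ≤ p ∧ p < 4 * x ∧ ∀ s, p ∉ Bst e P R s := by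
  by_contra hcon
  push Not at hcon
  have h1 : ∀ p, ∃ s', x ≤ p → p < 4 * x → att e P R s' ∧ s'.unpair.1 = p := by
    intro p
    by_cases h : x ≤ p ∧ p < 4 * x
    · obtain ⟨s, hs⟩ := hcon p h.1 h.2
      obtain ⟨s', hs'⟩ := mem_att hs
      exact ⟨s', fun _ _ => hs'⟩
    · exact ⟨0, fun h1 h2 => absurd ⟨h1, h2⟩ h⟩
  choose g hg using h1
  have hinj : Set.InjOn g (Finset.Ico x (4 * x)) := by
    intro p hp q hq hpq
    simp only [Finset.coe_Ico, Set.mem_Ico] at hp hq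
    have := (hg p hp.1 hp.2).2
    rw [hpq, (hg q hq.1 hq.2).2] at this
    exact this.symm
  have h2 := sum_beta_le (P := P) (R := R) hU he ((Finset.Ico x (4 * x)).image g) (by
    intro s hs
    obtain ⟨p, hp, rfl⟩ := Finset.mem_image.1 hs
    rw [Finset.mem_Ico] at hp
    exact (hg p hp.1 hp.2).1)
  rw [Finset.sum_image hinj] at h2
  have hx0 : (0 : ℝ) < x := by exact_mod_cast hx
  have h3 : ∑ p ∈ Finset.Ico x (4 * x), (1 / (2 * (x : ℝ))) ≤ 1 := by
    refine le_trans (Finset.sum_le_sum (fun p hp => ?_)) h2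
    rw [Finset.mem_Ico] at hp
    obtain ⟨ha, hb⟩ := hg p hp.1 hp.2
    have := ((att_spec he).1 ha).2.2
    have hv := V_nonneg e (g p) (qB e (Bst e P R (g p)) (g p).unpair.1)
    set v := V e (g p) (qB e (Bst e P R (g p)) (g p).unpair.1)
    rw [hb] at this
    have hp4 : (p : ℝ) ≤ 4 * x := by exact_mod_cast hp.2.le
    rw [div_le_iff₀ (by positivity)]
    nlinarith
  rw [Finset.sum_const, Nat.card_Ico, nsmul_eq_mul, show 4 * x - x = 3 * x by omega] at h3
  push_cast at h3
  have : 3 * (x : ℝ) * (1 / (2 * x)) = 3 / 2 := by field_simp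
  rw [this] at h3
  norm_num at h3

theorem beta_lower (he : Enum U e) {b : ℕ}
    (hb : ∀ n, KC U (restrSeq (Bseq e P R) n) ≤ KC U (zeroStr n) + b) (p : ℕ)
    {ι : Type*} (F : Finset ι) (y k : ι → ℕ) (hy : Set.InjOn y F)
    (hp : ∀ j ∈ F, p < y j) (hk : ∀ j ∈ F, KC U (zeroStr (y j)) ≤ (k j : ℕ∞)) :
    ∃ s1, ∀ s, s1 ≤ s → tp b * ∑ j ∈ F, tp (k j) ≤ V e s (qB e (Bst e P R s) p) := by
  have h1 : ∀ j, ∃ i, j ∈ F → out e i = restrSeq (Bseq e P R) (y j) ∧ tp (k j + b) ≤ wt e i := by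
    intro j
    by_cases hj : j ∈ F
    · have : KC U (restrSeq (Bseq e P R) (y j)) ≤ ((k j + b : ℕ) : ℕ∞) := by
        refine (hb _).trans ?_
        push_cast
        exact add_le_add_left (hk j hj) _
      obtain ⟨i, hi⟩ := KC_le_wt he this
      exact ⟨i, fun _ => hi⟩
    · exact ⟨0, fun h => absurd h hj⟩
  choose g hg using h1
  have hinj : Set.InjOn g F := by
    intro j hj j' hj' h
    have h1 := (hg j hj).1
    have h2 := (hg j' hj').1
    rw [← h, h1] at h2
    have := congrArg List.length h2
    rw [restrSeq_length, restrSeq_length] at this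
    exact hy hj hj' this
  choose s0 hs0 using fun x => seg_lim (e := e) (P := P) (R := R) x
  refine ⟨F.sup (fun j => max (s0 (y j)) (g j + 1)), fun s hs => ?_⟩
  have hss : ∀ j ∈ F, s0 (y j) ≤ s ∧ g j + 1 ≤ s := by
    intro j hj
    have := (Finset.le_sup (f := fun j => max (s0 (y j)) (g j + 1)) hj).trans hs
    exact ⟨(le_max_left _ _).trans this, (le_max_right _ _).trans this⟩
  calc tp b * ∑ j ∈ F, tp (k j) = ∑ j ∈ F, tp (k j + b) := by
        rw [Finset.mul_sum]; exact Finset.sum_congr rfl (fun j _ => by rw [tp_add, mul_comm])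
    _ ≤ ∑ j ∈ F, wt e (g j) := Finset.sum_le_sum (fun j hj => (hg j hj).2)
    _ = ∑ i ∈ F.image g, wt e i := (Finset.sum_image hinj).symm
    _ ≤ _ := by
        refine Finset.sum_le_sum_of_subset_of_nonneg ?_ (fun i _ _ => wt_nonneg e i)
        intro i hi
        obtain ⟨j, hj, rfl⟩ := Finset.mem_image.1 hi
        obtain ⟨h1, h2⟩ := hss j hj
        rw [Finset.mem_filter, Finset.mem_range]
        refine ⟨h2, ?_⟩
        simp only [qB, decide_eq_true_eq]
        rw [(hg j hj).1, restrSeq_length]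
        exact ⟨hp j hj, (hs0 _ s h1).symm⟩

theorem tail_small (hU : PFMachine U) (he : Enum U e) {v : ℝ} (hv : 0 < v) :
    ∃ n0, ∀ s Q, n0 ≤ s → V e s Q ≤ V e n0 Q + v := by
  have hsm : Summable (wt e) := summable_of_sum_le (wt_nonneg e) (sum_wt_le hU he)
  have := hsm.hasSum.tendsto_sum_nat
  have h2 := (this.eventually (lt_mem_nhds (show (∑' i, wt e i) - v < ∑' i, wt e i by linarith))).exists
  obtain ⟨n0, hn0⟩ := h2
  refine ⟨n0, fun s Q hs => ?_⟩
  have h3 : ∑ i ∈ Finset.range s, wt e i ≤ ∑' i, wt e i := hsm.sum_le_tsum _ (fun i _ => wt_nonneg e i)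
  have h4 := Finset.sum_range_add_sum_Ico (wt e) hs
  have h5 : V e s Q ≤ V e n0 Q + ∑ i ∈ Finset.Ico n0 s, wt e i := by
    unfold V
    rw [Finset.sum_filter, Finset.sum_filter, ← Finset.sum_range_add_sum_Ico _ hs]
    refine add_le_add le_rfl (Finset.sum_le_sum (fun i _ => ?_))
    split_ifs
    · exact le_rfl
    · exact wt_nonneg e i
  linarith

theorem alpha_stab (hU : PFMachine U) (he : Enum U e) (hP : Appr A P) (hR : Appr D R) (p : ℕ) {v : ℝ} (hv : 0 < v)
    (h : ∀ n, ∃ s, n ≤ s ∧ v ≤ V e s (qA e P R s p)) :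
    ∃ s1, ∀ s, s1 ≤ s → v / 2 ≤ V e s (qA e P R s p) := by
  obtain ⟨n0, hn0⟩ := tail_small hU he (half_pos hv)
  choose a ha using hP.lim
  choose b hb using hR.lim
  let s1 := max n0 ((Finset.range n0).sup (fun i => max (a (out e i).length) (b (out e i).length)))
  have hs1 : ∀ s s' i, s1 ≤ s → s1 ≤ s' → i < n0 → qA e P R s p i = qA e P R s' p i := by
    intro s s' i hs hs' hi
    have := (Finset.le_sup (f := fun i => max (a (out e i).length) (b (out e i).length))
      (Finset.mem_range.2 hi)).trans (le_max_right n0 _)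
    have h1 := this.trans hs
    have h2 := this.trans hs'
    simp only [max_le_iff] at h1 h2
    unfold qA
    rw [ha _ s h1.1, ha _ s' h2.1, hb _ s h1.2, hb _ s' h2.2]
  refine ⟨s1, fun s hs => ?_⟩
  obtain ⟨s', hs', hv'⟩ := h s1
  have hn1 : n0 ≤ s1 := le_max_left _ _
  have h1 := hn0 s' (qA e P R s' p) (hn1.trans hs')
  have h2 : V e n0 (qA e P R s' p) ≤ V e s (qA e P R s p) := by
    refine V_mono e (hn1.trans hs) (fun i hi hq => ?_)
    rw [hs1 s s' i hs hs' hi]; exact hq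
  linarith

theorem sum_tp_succ (n : ℕ) : ∑ i ∈ Finset.range n, tp (i + 1) = 1 - tp n := by
  induction n with
  | zero => simp [tp_zero]
  | succ n ih => rw [Finset.sum_range_succ, ih, tp_succ]; ring

theorem four_pow (hU : OptimalPF U) : ∃ c, ∀ i, KC U (zeroStr (4 ^ i)) ≤ ((i + 1 + c : ℕ) : ℕ∞) := by
  obtain ⟨c, hc⟩ := kc_theorem hU (fun i => Option.some (i + 1, zeroStr (4 ^ i)))
    (by unfold zeroStr; fun_prop) (by
      intro n
      simp only [rwt_some]
      rw [sum_tp_succ]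
      have := tp_pos n
      linarith)
  exact ⟨c, fun i => hc i _ _ rfl⟩

theorem lemma_E (hU : OptimalPF U) (he : Enum U e) (hP : Appr A P) (hR : Appr D R)
    (hB : KTrivialSeq U (Bseq e P R)) :
    ∃ d x0, ∀ x, x0 ≤ x → ∀ {ι : Type} (F : Finset ι) (y k : ι → ℕ), Set.InjOn y F →
      (∀ j ∈ F, 4 * x < y j) → (∀ j ∈ F, KC U (zeroStr (y j)) ≤ (k j : ℕ∞)) →
      ∃ s1, ∀ s, s1 ≤ s → tp d * ∑ j ∈ F, tp (k j) ≤ V e s (qA e P R s x) := by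
  obtain ⟨b, hb⟩ := hB
  obtain ⟨c, hc⟩ := four_pow hU
  refine ⟨b + 1, 4 ^ (c + b + 5), ?_⟩
  intro x hx ι F y k hinj hy hk
  have hx1 : 1 ≤ x := le_trans (Nat.one_le_pow _ _ (by norm_num)) hx
  obtain ⟨p, hp1, hp2, hp3⟩ := exists_nonmem (P := P) (R := R) hU.1 he hx1
  obtain ⟨s1, hs1⟩ := beta_lower he hb p F y k hinj (fun j hj => hp2.trans (hy j hj)) hk
  have hex : ∃ i, p < 4 ^ i := ⟨p, Nat.lt_pow_self (by norm_num)⟩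
  set i := Nat.find hex with hi
  have hpi : p < 4 ^ i := Nat.find_spec hex
  have hi1 : c + b + 5 < i := by
    by_contra hcon
    have : 4 ^ i ≤ 4 ^ (c + b + 5) := Nat.pow_le_pow_right (by norm_num) (by omega)
    omega
  have hpi' : 4 ^ (i - 1) ≤ p := by
    have := Nat.find_min hex (m := i - 1) (by omega)
    omega
  obtain ⟨s2, hs2⟩ := beta_lower he hb p {i} (fun i => 4 ^ i) (fun i => i + 1 + c) (by simp)
    (by simpa using hpi) (fun j _ => hc j)
  simp only [Finset.sum_singleton] at hs2
  have hbig : 2 ≤ (p : ℝ) * (tp b * tp (i + 1 + c)) := by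
    obtain ⟨m, hm⟩ : ∃ m, i = m + (c + b + 6) := ⟨i - (c + b + 6), by omega⟩
    have h1 : (2 : ℝ) ^ (2 * (m + c + b + 5)) ≤ p := by
      rw [pow_mul]
      norm_num
      have : i - 1 = m + c + b + 5 := by omega
      rw [this] at hpi'
      exact_mod_cast hpi'
    have h2 : tp b * tp (i + 1 + c) = tp (b + (i + 1 + c)) := (tp_add _ _).symm
    rw [h2]
    have h3 := tp_mul_pow (b + (i + 1 + c))
    have h4 : (2 : ℝ) ^ (2 * (m + c + b + 5)) = 2 ^ (m + 3) * 2 ^ (b + (i + 1 + c)) := by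
      rw [← pow_add]; congr 1; omega
    have h5 : (2 : ℝ) ≤ 2 ^ (m + 3) := by
      calc (2 : ℝ) = 2 ^ 1 := by norm_num
        _ ≤ _ := pow_le_pow_right₀ (by norm_num) (by omega)
    calc (2 : ℝ) ≤ 2 ^ (m + 3) * (tp (b + (i + 1 + c)) * 2 ^ (b + (i + 1 + c))) := by rw [h3]; linarith
      _ = 2 ^ (2 * (m + c + b + 5)) * tp (b + (i + 1 + c)) := by rw [h4]; ring
      _ ≤ _ := mul_le_mul_of_nonneg_right h1 (tp_pos _).le
  have hmono : ∀ s, V e s (qA e P R s p) ≤ V e s (qA e P R s x) := by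
    intro s
    refine V_mono e le_rfl (fun i _ h => ?_)
    simp only [qA, decide_eq_true_eq] at h ⊢
    exact ⟨by omega, h.2⟩
  set v := tp b * ∑ j ∈ F, tp (k j) with hv
  have hdv : tp (b + 1) * ∑ j ∈ F, tp (k j) = v / 2 := by rw [tp_succ, hv]; ring
  rw [hdv]
  by_cases hv0 : 0 < v
  · obtain ⟨s3, hs3⟩ := alpha_stab hU.1 he hP hR p hv0 (by
      intro n
      let m := max n (max s1 s2)
      have hm : m ≤ Nat.pair p m := Nat.right_le_pair p m
      have h1 : n ≤ m := le_max_left _ _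
      have h2 : s1 ≤ m := (le_max_left _ _).trans (le_max_right _ _)
      have h3 : s2 ≤ m := (le_max_right _ _).trans (le_max_right _ _)
      refine ⟨Nat.pair p m, by omega, ?_⟩
      have hna : ¬ att e P R (Nat.pair p m) := by
        intro h
        have := att_mem h
        rw [Nat.unpair_pair] at this
        exact hp3 _ this
      rw [att_spec he, Nat.unpair_pair] at hna
      have e1 := hs1 (Nat.pair p m) (by omega)
      have e2 := hs2 (Nat.pair p m) (by omega)
      by_contra hcon
      push Not at hcon
      refine hna ⟨hp3 _, (hcon.le.trans e1), hbig.trans ?_⟩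
      exact mul_le_mul_of_nonneg_left e2 (Nat.cast_nonneg p))
    exact ⟨s3, fun s hs => (hs3 s hs).trans (hmono s)⟩
  · exact ⟨0, fun s _ => le_trans (by linarith) (V_nonneg _ _ _)⟩
end

section
variable (e : ℕ → Option (Str × Str)) (P R : ℕ → ℕ → Str)

/-- mass of programs for strings that were initial segments by time `τ` -/
noncomputable def EE (Q : ℕ → ℕ → Str) (a u τ : ℕ) : ℝ :=
  V e τ (fun i => decide (a < (out e i).length ∧ (out e i).length ≤ u ∧
    ∃ v, v ≤ τ ∧ out e i = Q v (out e i).length))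
/-- mass of programs for strings that were initial segments before time `τ` but no longer -/
noncomputable def DD (Q : ℕ → ℕ → Str) (a u τ : ℕ) : ℝ :=
  V e τ (fun i => decide (a < (out e i).length ∧ (out e i).length ≤ u ∧
    (∃ v, v ≤ τ ∧ out e i = Q v (out e i).length) ∧ out e i ≠ Q τ (out e i).length))
/-- mass at return -/
noncomputable def Cm (r a u τ : ℕ) : ℝ :=
  if r % 2 = 0 then DD e P a u τ + DD e R a u τ else DD e P a u τ + EE e R a u τ
/-- mass at store -/
noncomputable def Gm (r a u : ℕ) : ℝ :=
  if r % 2 = 0 then EE e P a u u + EE e R a u u else DD e P a u u + EE e R a u u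
/-- the approximation for row `r` -/
def XX (r s x : ℕ) : Str := if r % 2 = 0 then P s x else R s x
end

section
variable {U : Str →. Str} {e : ℕ → Option (Str × Str)} {P R Q : ℕ → ℕ → Str} {A D X : ℕ → Bool}

theorem V_split {s : ℕ} {q q1 q2 : ℕ → Bool} (h1 : ∀ i, q1 i = true → q i = true)
    (h2 : ∀ i, q2 i = true → q i = true) (h : ∀ i, q1 i = true → q2 i = true → False) :
    V e s q1 + V e s q2 ≤ V e s q := by
  unfold V
  rw [← Finset.sum_union]
  · refine Finset.sum_le_sum_of_subset_of_nonneg ?_ (fun i _ _ => wt_nonneg e i)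
    intro i hi
    simp only [Finset.mem_union, Finset.mem_filter] at hi ⊢
    rcases hi with hi | hi
    · exact ⟨hi.1, h1 i hi.2⟩
    · exact ⟨hi.1, h2 i hi.2⟩
  · rw [Finset.disjoint_left]
    intro i hi hi'
    exact h i (Finset.mem_filter.1 hi).2 (Finset.mem_filter.1 hi').2

theorem EE_split {a b c τ : ℕ} (hab : a ≤ b) (hbc : b ≤ c) :
    EE e Q a b τ + EE e Q b c τ ≤ EE e Q a c τ := by
  refine V_split ?_ ?_ ?_
  · intro i; simp only [decide_eq_true_eq]; rintro ⟨h1, h2, h3⟩; exact ⟨h1, by omega, h3⟩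
  · intro i; simp only [decide_eq_true_eq]; rintro ⟨h1, h2, h3⟩; exact ⟨by omega, h2, h3⟩
  · intro i; simp only [decide_eq_true_eq]; rintro ⟨h1, h2, h3⟩ ⟨h4, h5, h6⟩; omega

theorem DD_split {a b c τ : ℕ} (hab : a ≤ b) (hbc : b ≤ c) :
    DD e Q a b τ + DD e Q b c τ ≤ DD e Q a c τ := by
  refine V_split ?_ ?_ ?_
  · intro i; simp only [decide_eq_true_eq]; rintro ⟨h1, h2, h3⟩; exact ⟨h1, by omega, h3⟩
  · intro i; simp only [decide_eq_true_eq]; rintro ⟨h1, h2, h3⟩; exact ⟨by omega, h2, h3⟩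
  · intro i; simp only [decide_eq_true_eq]; rintro ⟨h1, h2, h3⟩ ⟨h4, h5, h6⟩; omega

theorem Cm_split {r a b c τ : ℕ} (hab : a ≤ b) (hbc : b ≤ c) :
    Cm e P R r a b τ + Cm e P R r b c τ ≤ Cm e P R r a c τ := by
  have h1 := DD_split (e := e) (Q := P) (τ := τ) hab hbc
  have h2 := DD_split (e := e) (Q := R) (τ := τ) hab hbc
  have h3 := EE_split (e := e) (Q := R) (τ := τ) hab hbc
  unfold Cm
  split_ifs <;> linarith

theorem Cm_nonneg (r a u τ : ℕ) : 0 ≤ Cm e P R r a u τ := by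
  unfold Cm DD EE
  split_ifs <;> exact add_nonneg (V_nonneg _ _ _) (V_nonneg _ _ _)

theorem Cm_le (hU : PFMachine U) (he : Enum U e) (r a u τ : ℕ) : Cm e P R r a u τ ≤ 2 := by
  unfold Cm DD EE V
  split_ifs
  · linarith [sum_wt_le hU he ((Finset.range τ).filter (fun i => decide (a < (out e i).length ∧ (out e i).length ≤ u ∧
    (∃ v, v ≤ τ ∧ out e i = P v (out e i).length) ∧ out e i ≠ P τ (out e i).length) = true)),
      sum_wt_le hU he ((Finset.range τ).filter (fun i => decide (a < (out e i).length ∧ (out e i).length ≤ u ∧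
    (∃ v, v ≤ τ ∧ out e i = R v (out e i).length) ∧ out e i ≠ R τ (out e i).length) = true))]
  · linarith [sum_wt_le hU he ((Finset.range τ).filter (fun i => decide (a < (out e i).length ∧ (out e i).length ≤ u ∧
    (∃ v, v ≤ τ ∧ out e i = P v (out e i).length) ∧ out e i ≠ P τ (out e i).length) = true)),
      sum_wt_le hU he ((Finset.range τ).filter (fun i => decide (a < (out e i).length ∧ (out e i).length ≤ u ∧
    (∃ v, v ≤ τ ∧ out e i = R v (out e i).length)) = true))]

theorem EE_mono {a u τ τ' : ℕ} (h : τ ≤ τ') : EE e Q a u τ ≤ EE e Q a u τ' := by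
  refine V_mono e h ?_
  intro i _
  simp only [decide_eq_true_eq]
  rintro ⟨h1, h2, v, h3, h4⟩
  exact ⟨h1, h2, v, by omega, h4⟩

theorem DD_mono (hQ : Appr X Q) {a u τ τ' : ℕ} (h : τ ≤ τ') : DD e Q a u τ ≤ DD e Q a u τ' := by
  refine V_mono e h ?_
  intro i _
  simp only [decide_eq_true_eq]
  rintro ⟨h1, h2, ⟨v, h3, h4⟩, h5⟩
  refine ⟨h1, h2, ⟨v, by omega, h4⟩, fun h6 => h5 ?_⟩
  have := hQ.nr v τ τ' _ h3 h (h4.symm.trans h6)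
  rw [this]; exact h4

theorem DD_lost (hQ : Appr X Q) {a u t : ℕ} (h : u ≤ t) (hl : Q u a ≠ Q t a) :
    EE e Q a u u ≤ DD e Q a u t := by
  refine V_mono e h ?_
  intro i _
  simp only [decide_eq_true_eq]
  rintro ⟨h1, h2, v, h3, h4⟩
  refine ⟨h1, h2, ⟨v, by omega, h4⟩, fun h6 => hl ?_⟩
  have h7 : Q v a = Q t a := by
    rw [← hQ.take v a _ h1.le, ← hQ.take t a _ h1.le, ← h4, ← h6]
  have := hQ.nr v u t a h3 h h7
  rw [this, h7]

theorem Gm_le_Cm (hP : Appr A P) (hR : Appr D R) {r a u t : ℕ} (h : u ≤ t)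
    (hl : XX P R r u a ≠ XX P R r t a) : Gm e P R r a u ≤ Cm e P R (r + 1) a u t := by
  unfold Gm Cm
  unfold XX at hl
  by_cases hr : r % 2 = 0
  · rw [if_pos hr, if_neg (by omega)]
    rw [if_pos hr, if_pos hr] at hl
    exact add_le_add (DD_lost hP h hl) (EE_mono h)
  · rw [if_neg hr, if_pos (by omega)]
    rw [if_neg hr, if_neg hr] at hl
    exact add_le_add (DD_mono hP h) (DD_lost hR h hl)

theorem V_union {s : ℕ} {q q1 q2 : ℕ → Bool} (h : ∀ i, i < s → q i = true → q1 i = true ∨ q2 i = true) :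
    V e s q ≤ V e s q1 + V e s q2 := by
  unfold V
  rw [Finset.sum_filter, Finset.sum_filter, Finset.sum_filter, ← Finset.sum_add_distrib]
  refine Finset.sum_le_sum (fun i hi => ?_)
  have := h i (Finset.mem_range.1 hi)
  have hw := wt_nonneg e i
  cases hq : q i <;> cases hq1 : q1 i <;> cases hq2 : q2 i <;> simp_all

theorem store_even (he : Enum U e) (a t : ℕ) :
    DD e P a t t + DD e R a t t + V e t (qA e P R t a) ≤ EE e P a t t + EE e R a t t := by
  have key : ∀ Q : ℕ → ℕ → Str, DD e Q a t t +
      V e t (fun i => decide (a < (out e i).length ∧ out e i = Q t (out e i).length)) ≤ EE e Q a t t := by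
    intro Q
    have : ∀ i, i < t → (out e i).length ≤ t := fun i hi => (out_len he i).trans hi.le
    unfold DD EE V
    rw [← Finset.sum_union]
    · refine Finset.sum_le_sum_of_subset_of_nonneg ?_ (fun i _ _ => wt_nonneg e i)
      intro i hi
      simp only [Finset.mem_union, Finset.mem_filter, Finset.mem_range, decide_eq_true_eq] at hi ⊢
      rcases hi with ⟨h0, h1, h2, h3, h4⟩ | ⟨h0, h1, h2⟩
      · exact ⟨h0, h1, h2, h3⟩
      · exact ⟨h0, h1, this i h0, t, le_rfl, h2⟩
    · rw [Finset.disjoint_left]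
      intro i hi hi'
      simp only [Finset.mem_filter, decide_eq_true_eq] at hi hi'
      exact hi.2.2.2.2 hi'.2.2
  have h3 : V e t (qA e P R t a) ≤
      V e t (fun i => decide (a < (out e i).length ∧ out e i = P t (out e i).length)) +
      V e t (fun i => decide (a < (out e i).length ∧ out e i = R t (out e i).length)) := by
    refine V_union (fun i _ h => ?_)
    simp only [qA, decide_eq_true_eq] at h ⊢
    tauto
  linarith [key P, key R]

theorem store_ok (he : Enum U e) {r a t : ℕ} {w : ℝ}
    (hC : (((r + 1) / 2 : ℕ) : ℝ) * w ≤ Cm e P R r a t t) (hg : w ≤ V e t (qA e P R t a)) :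
    (((r + 2) / 2 : ℕ) : ℝ) * w ≤ Gm e P R r a t := by
  unfold Cm at hC
  unfold Gm
  by_cases hr : r % 2 = 0
  · rw [if_pos hr] at hC ⊢
    have h1 : (r + 2) / 2 = (r + 1) / 2 + 1 := by omega
    rw [h1]
    push_cast
    have := store_even (P := P) (R := R) he a t
    linarith
  · rw [if_neg hr] at hC ⊢
    have h1 : (r + 2) / 2 = (r + 1) / 2 := by omega
    rw [h1]
    exact hC

theorem XX_nr (hP : Appr A P) (hR : Appr D R) {r u t t' x : ℕ} (h1 : u ≤ t) (h2 : t ≤ t')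
    (h : XX P R r u x ≠ XX P R r t x) : XX P R r u x ≠ XX P R r t' x := by
  unfold XX at *
  split_ifs at * with hr
  · exact fun h' => h (hP.nr u t t' x h1 h2 h').symm
  · exact fun h' => h (hR.nr u t t' x h1 h2 h').symm
end

/-! ### scaled sums of lists of exponents -/

/-- scaled sum of `2^-k` -/
def scS (l : List ℕ) : ℕ := (l.map (fun k => 2 ^ (l.sum - k))).sum
/-- sum of `2^-k` -/
noncomputable def tps (l : List ℕ) : ℝ := (l.map tp).sum

theorem scS_eq (l : List ℕ) : (scS l : ℝ) = 2 ^ l.sum * tps l := by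
  have : ∀ (m : List ℕ) (N : ℕ), (∀ k ∈ m, k ≤ N) →
      (((m.map (fun k => 2 ^ (N - k))).sum : ℕ) : ℝ) = 2 ^ N * (m.map tp).sum := by
    intro m N
    induction m with
    | nil => simp
    | cons a m ih =>
      intro h
      simp only [List.map_cons, List.sum_cons]
      push_cast
      rw [mul_add, ← ih (fun k hk => h k (List.mem_cons_of_mem _ hk))]
      obtain ⟨d, hd⟩ : ∃ d, N = a + d := ⟨N - a, by have := h a (by simp); omega⟩
      have := tp_mul_pow a
      subst hd
      rw [Nat.add_sub_cancel_left, pow_add]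
      push_cast
      linear_combination (-(2 : ℝ) ^ d) * this
  exact this l l.sum (fun k hk => List.le_sum_of_mem hk)

@[fun_prop] theorem pr_scS {α : Type*} [Primcodable α] {f : α → List ℕ} (hf : Primrec f) :
    Primrec (fun a => scS (f a)) := by
  unfold scS; fun_prop

theorem tps_nonneg (l : List ℕ) : 0 ≤ tps l := by
  unfold tps
  refine List.sum_nonneg ?_
  intro x hx
  obtain ⟨k, _, rfl⟩ := List.mem_map.1 hx
  exact (tp_pos k).le

/-- label, start, end -/
abbrev Chunk := ℕ × ℕ × ℕ
/-- label, start, stored chunks -/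
abbrev Frame := ℕ × ℕ × List Chunk
/-- frames and elements (position, exponent) -/
abbrev St := List Frame × List (ℕ × ℕ)

/-- number of frames -/
def LL (j : ℕ) : ℕ := 2 ^ (2 * j + 5)
/-- base exponent -/
def ell (j : ℕ) : ℕ := 2 * j + 7

section
variable (e : ℕ → Option (Str × Str)) (P R : ℕ → ℕ → Str)

/-- the `i`-th label: program length and `n` if the `i`-th program describes `0^n` -/
def labl (i : ℕ) : ℕ × ℕ :=
  ((e i).bind (fun p => if p.2 = zeroStr p.2.length then Option.some (p.1.length, p.2.length)
    else Option.none)).getD (i + 1, 0)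
/-- exponent of the weight of a label -/
def xp (j i : ℕ) : ℕ := ell j + (labl e i).1
/-- is the chunk lost? -/
def lostc (r t : ℕ) (c : Chunk) : Bool := decide (¬ XX P R r c.2.2 c.2.1 = XX P R r t c.2.1)
/-- exponents of lost chunks -/
def lexp (j r t : ℕ) (ch : List Chunk) : List ℕ :=
  (ch.filter (fun c => lostc P R r t c)).map (fun c => xp e j c.1)
/-- does the row return? -/
def retb (j r t : ℕ) (ch : List Chunk) : Bool :=
  decide (2 ^ (lexp e P R j r t ch).sum ≤ scS (lexp e P R j r t ch))
/-- finish the current chunk -/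
def chp (t : ℕ) (F : Frame) : List Chunk := (F.1, F.2.1, t) :: F.2.2
/-- labels of chunks not lost -/
def labsU (r t : ℕ) (ch : List Chunk) : List ℕ :=
  (ch.filter (fun c => !lostc P R r t c)).map (fun c => c.1)
/-- least label without a surviving chunk -/
def fresh (r t : ℕ) (ch : List Chunk) : ℕ :=
  (List.range (ch.length + 1)).findIdx (fun a => !decide (a ∈ labsU P R r t ch))
/-- access to frames -/
def fget (fs : List Frame) (r : ℕ) : Frame := fs.getD r (0, 0, [])
/-- first row that does not return -/
def nidx (j t : ℕ) (fs : List Frame) : ℕ :=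
  (List.range (LL j)).findIdx (fun r => !retb e P R j r t (chp t (fget fs r)))
/-- the new row `r` -/
def newF (j t : ℕ) (fs : List Frame) (r : ℕ) : Frame :=
  if r < nidx e P R j t fs then (0, t, [])
  else if r = nidx e P R j t fs then (fresh P R r t (chp t (fget fs r)), t, chp t (fget fs r))
  else fget fs r
/-- new frames -/
def newFs (j t : ℕ) (fs : List Frame) : List Frame :=
  (List.range (LL j)).map (fun r => newF e P R j t fs r)
/-- exponent of the new element -/
def newexp (j : ℕ) (fs : List Frame) : ℕ :=
  2 + ((List.range (LL j)).map (fun r => xp e j (fget fs r).1)).sum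
/-- exponents of elements beyond `x` -/
def eexp (x : ℕ) (els : List (ℕ × ℕ)) : List ℕ :=
  (els.filter (fun p => decide (x < p.1))).map (fun p => p.2)
/-- scaled `α` -/
def alN (t x : ℕ) : ℕ := mN e t (qA e P R t x)
/-- may we act? -/
def goodb (j t : ℕ) (els : List (ℕ × ℕ)) : Bool :=
  decide (j < t) && (List.range t).all (fun x => decide (x < j) ||
    decide (scS (eexp x els) * 2 ^ t ≤ alN e P R t x * 2 ^ (eexp x els).sum * 2 ^ (2 * j)))
/-- action -/
def stepS (j t : ℕ) (S : St) : St :=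
  (newFs e P R j t S.1, (t + 1, newexp e j (newFs e P R j t S.1)) :: S.2)
/-- initial frames -/
def initF (j : ℕ) : List Frame := (List.range (LL j)).map (fun _ => (0, j, []))
/-- initial state -/
def initS (j : ℕ) : St := (initF j, [(j + 1, newexp e j (initF j))])
/-- state before stage `t` -/
def sta (j t : ℕ) : St := Nat.rec (motive := fun _ => St) (initS e j)
  (fun t S => cond (goodb e P R j t S.2) (stepS e P R j t S) S) t
/-- action at stage `t`? -/
def act (j t : ℕ) : Bool := goodb e P R j t (sta e P R j t).2
end

section
variable {U : Str →. Str} {e : ℕ → Option (Str × Str)} {P R : ℕ → ℕ → Str} {A D : ℕ → Bool}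

theorem pr_labl (he : Enum U e) : Primrec (labl e) := by
  have := he.prim
  unfold labl zeroStr; fun_prop

theorem pr_XX (hP : Appr A P) (hR : Appr D R) : Primrec (fun p : ℕ × ℕ × ℕ => XX P R p.1 p.2.1 p.2.2) := by
  have h2 := hP.prim
  have h3 := hR.prim
  unfold XX; fun_prop

theorem pr_alN (he : Enum U e) (hP : Appr A P) (hR : Appr D R) : Primrec (fun p : ℕ × ℕ => alN e P R p.1 p.2) := by
  have h1 := pr_out' he
  have h2 := hP.prim
  have h3 := hR.prim
  have hqA : Primrec (fun p : ℕ × ℕ × ℕ => qA e P R p.1 p.2.1 p.2.2) := by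
    unfold qA; fun_prop
  unfold alN
  exact pr_mN he (by fun_prop) (by fun_prop)

theorem pr_xp (he : Enum U e) : Primrec (fun p : ℕ × ℕ => xp e p.1 p.2) := by
  have := pr_labl he
  unfold xp ell; fun_prop

theorem pr_lostc (hP : Appr A P) (hR : Appr D R) :
    Primrec (fun p : ℕ × ℕ × Chunk => lostc P R p.1 p.2.1 p.2.2) := by
  have := pr_XX hP hR
  unfold lostc; fun_prop

theorem pr_fget : Primrec (fun p : List Frame × ℕ => fget p.1 p.2) := by
  unfold fget; fun_prop

theorem pr_chp : Primrec (fun p : ℕ × Frame => chp p.1 p.2) := by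
  unfold chp; fun_prop

theorem pr_lexp (he : Enum U e) (hP : Appr A P) (hR : Appr D R) :
    Primrec (fun p : ℕ × ℕ × ℕ × List Chunk => lexp e P R p.1 p.2.1 p.2.2.1 p.2.2.2) := by
  have h1 := pr_xp he
  have h2 := pr_lostc hP hR
  unfold lexp; fun_prop

theorem pr_retb (he : Enum U e) (hP : Appr A P) (hR : Appr D R) :
    Primrec (fun p : ℕ × ℕ × ℕ × List Chunk => retb e P R p.1 p.2.1 p.2.2.1 p.2.2.2) := by
  have h1 := pr_lexp he hP hR
  unfold retb; fun_prop

theorem pr_fresh (hP : Appr A P) (hR : Appr D R) :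
    Primrec (fun p : ℕ × ℕ × List Chunk => fresh P R p.1 p.2.1 p.2.2) := by
  have h2 := pr_lostc hP hR
  unfold fresh labsU; fun_prop

theorem pr_nidx (he : Enum U e) (hP : Appr A P) (hR : Appr D R) :
    Primrec (fun p : ℕ × ℕ × List Frame => nidx e P R p.1 p.2.1 p.2.2) := by
  have h1 := pr_retb he hP hR
  have h2 := pr_chp
  have h3 := pr_fget
  unfold nidx LL; fun_prop

theorem pr_newF (he : Enum U e) (hP : Appr A P) (hR : Appr D R) :
    Primrec (fun p : ℕ × ℕ × List Frame × ℕ => newF e P R p.1 p.2.1 p.2.2.1 p.2.2.2) := by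
  have h1 := pr_nidx he hP hR
  have h2 := pr_chp
  have h3 := pr_fget
  have h4 := pr_fresh hP hR
  unfold newF; fun_prop

theorem pr_newFs (he : Enum U e) (hP : Appr A P) (hR : Appr D R) :
    Primrec (fun p : ℕ × ℕ × List Frame => newFs e P R p.1 p.2.1 p.2.2) := by
  have h1 := pr_newF he hP hR
  unfold newFs LL; fun_prop

theorem pr_newexp (he : Enum U e) : Primrec (fun p : ℕ × List Frame => newexp e p.1 p.2) := by
  have h1 := pr_xp he
  have h3 := pr_fget
  unfold newexp LL; fun_prop

theorem pr_goodb (he : Enum U e) (hP : Appr A P) (hR : Appr D R) :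
    Primrec (fun p : ℕ × ℕ × List (ℕ × ℕ) => goodb e P R p.1 p.2.1 p.2.2) := by
  have h1 := pr_alN he hP hR
  unfold goodb eexp; fun_prop

theorem pr_stepS (he : Enum U e) (hP : Appr A P) (hR : Appr D R) :
    Primrec (fun p : ℕ × ℕ × St => stepS e P R p.1 p.2.1 p.2.2) := by
  have h1 := pr_newFs he hP hR
  have h2 := pr_newexp he
  unfold stepS; fun_prop

theorem pr_initS (he : Enum U e) : Primrec (initS e) := by
  have h2 := pr_newexp he
  have h1 : Primrec initF := by unfold initF LL; fun_prop
  unfold initS; fun_prop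

theorem pr_sta (he : Enum U e) (hP : Appr A P) (hR : Appr D R) :
    Primrec (fun p : ℕ × ℕ => sta e P R p.1 p.2) := by
  have h1 := pr_goodb he hP hR
  have h2 := pr_stepS he hP hR
  have h3 := pr_initS he
  unfold sta; fun_prop

theorem pr_act (he : Enum U e) (hP : Appr A P) (hR : Appr D R) :
    Primrec (fun p : ℕ × ℕ => act e P R p.1 p.2) := by
  have h1 := pr_goodb he hP hR
  have h2 := pr_sta he hP hR
  unfold act; fun_prop

theorem sta_zero (j : ℕ) : sta e P R j 0 = initS e j := rfl
theorem sta_succ (j t : ℕ) : sta e P R j (t + 1) =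
    if act e P R j t = true then stepS e P R j t (sta e P R j t) else sta e P R j t := by
  show cond (act e P R j t) _ _ = _
  cases act e P R j t <;> rfl
end

section
variable {U : Str →. Str} {e : ℕ → Option (Str × Str)} {P R : ℕ → ℕ → Str} {A D : ℕ → Bool}

theorem labl_zero {i n : ℕ} {σ : Str} (h : e i = Option.some (σ, zeroStr n)) : labl e i = (σ.length, n) := by
  simp [labl, h, zeroStr]

theorem labl_le (he : Enum U e) (i : ℕ) : (labl e i).2 ≤ i := by
  unfold labl
  cases h : e i with
  | none => simp
  | some p =>
    have := he.len2 i p.1 p.2 h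
    simp only [Option.bind_some]
    split_ifs
    · simpa using this
    · simp

theorem labl_sum (hU : PFMachine U) (he : Enum U e) (S : Finset ℕ) : ∑ i ∈ S, tp (labl e i).1 ≤ 2 := by
  have h1 : ∀ i, tp (labl e i).1 ≤ wt e i + tp (i + 1) := by
    intro i
    unfold labl wt
    have h0 := (tp_pos (i + 1)).le
    cases h : e i with
    | none => simp
    | some p =>
      have h2 := (tp_pos p.1.length).le
      simp only [Option.bind_some, Option.map_some, Option.getD_some]
      split_ifs
      · simpa using h0
      · simpa using h2
  have h2 : ∑ i ∈ S, tp (i + 1) ≤ 1 := by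
    have : ∑ i ∈ S, tp (i + 1) ≤ ∑ i ∈ Finset.range (S.sup id + 1), tp (i + 1) := by
      refine Finset.sum_le_sum_of_subset_of_nonneg ?_ (fun i _ _ => (tp_pos _).le)
      intro i hi
      have := Finset.le_sup (f := id) hi
      simp only [id] at this
      exact Finset.mem_range.2 (by omega)
    rw [sum_tp_succ] at this
    linarith [tp_pos (S.sup id + 1)]
  have h3 := sum_wt_le hU he S
  calc _ ≤ ∑ i ∈ S, (wt e i + tp (i + 1)) := Finset.sum_le_sum (fun i _ => h1 i)
    _ = _ := Finset.sum_add_distrib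
    _ ≤ 2 := by linarith

theorem retb_iff (j r t : ℕ) (ch : List Chunk) :
    retb e P R j r t ch = true ↔ 1 ≤ tps (lexp e P R j r t ch) := by
  unfold retb
  rw [decide_eq_true_eq]
  have h := scS_eq (lexp e P R j r t ch)
  have h2 : (0 : ℝ) < 2 ^ (lexp e P R j r t ch).sum := by positivity
  rw [← Nat.cast_le (α := ℝ), h]
  push_cast
  constructor
  · intro h3
    by_contra hc
    nlinarith
  · intro h3
    nlinarith

theorem range_findIdx (n : ℕ) (q : ℕ → Bool) :
    (List.range n).findIdx q ≤ n ∧ (∀ a, a < (List.range n).findIdx q → q a = false) ∧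
    ((List.range n).findIdx q < n → q ((List.range n).findIdx q) = true) := by
  have h0 : (List.range n).findIdx q ≤ n := by
    simpa using List.findIdx_le_length (xs := List.range n) (p := q)
  refine ⟨h0, ?_, ?_⟩
  · intro a ha
    have := List.not_of_lt_findIdx ha
    simpa using this
  · intro h
    have := List.findIdx_getElem (xs := List.range n) (p := q) (w := by simpa using h)
    simpa using this

theorem fresh_spec (r t : ℕ) (ch : List Chunk) : fresh P R r t ch ≤ ch.length ∧
    fresh P R r t ch ∉ labsU P R r t ch ∧ ∀ a, a < fresh P R r t ch → a ∈ labsU P R r t ch := by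
  obtain ⟨h1, h2, h3⟩ := range_findIdx (ch.length + 1) (fun a => !decide (a ∈ labsU P R r t ch))
  have h4 : fresh P R r t ch ≠ ch.length + 1 := by
    intro hf
    have hsub : Finset.range (ch.length + 1) ⊆ (labsU P R r t ch).toFinset := by
      intro a ha
      have := h2 a (by unfold fresh at hf; rw [hf]; exact Finset.mem_range.1 ha)
      simpa using this
    have := Finset.card_le_card hsub
    have h5 := List.toFinset_card_le (labsU P R r t ch)
    have h6 : (labsU P R r t ch).length ≤ ch.length := by
      unfold labsU
      rw [List.length_map]
      exact List.length_filter_le _ _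
    rw [Finset.card_range] at this
    omega
  have h5 : fresh P R r t ch ≤ ch.length := by
    have : fresh P R r t ch ≤ ch.length + 1 := h1
    omega
  refine ⟨h5, ?_, ?_⟩
  · have := h3 (by show fresh P R r t ch < _; omega)
    simpa [fresh] using this
  · intro a ha
    have := h2 a ha
    simpa using this

theorem nidx_spec (j t : ℕ) (fs : List Frame) : nidx e P R j t fs ≤ LL j ∧
    (∀ r, r < nidx e P R j t fs → retb e P R j r t (chp t (fget fs r)) = true) ∧
    (nidx e P R j t fs < LL j → retb e P R j (nidx e P R j t fs) t (chp t (fget fs (nidx e P R j t fs))) = false) := by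
  obtain ⟨h1, h2, h3⟩ := range_findIdx (LL j) (fun r => !retb e P R j r t (chp t (fget fs r)))
  refine ⟨h1, fun r hr => ?_, fun h => ?_⟩
  · simpa using h2 r hr
  · simpa [nidx] using h3 h

theorem fget_map (f : ℕ → Frame) {n r : ℕ} (h : r < n) : fget ((List.range n).map f) r = f r := by
  unfold fget
  simp [List.getD_eq_getElem?_getD, h]

theorem fget_new {j t r : ℕ} (fs : List Frame) (h : r < LL j) : fget (newFs e P R j t fs) r = newF e P R j t fs r :=
  fget_map _ h

theorem fget_init {j r : ℕ} (h : r < LL j) : fget (initF j) r = (0, j, []) := fget_map _ h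

theorem goodb_iff (he : Enum U e) (j t : ℕ) (els : List (ℕ × ℕ)) : goodb e P R j t els = true ↔
    j < t ∧ ∀ x, j ≤ x → x < t → tp (2 * j) * tps (eexp x els) ≤ V e t (qA e P R t x) := by
  unfold goodb
  simp only [Bool.and_eq_true, decide_eq_true_eq, List.all_eq_true, List.mem_range, Bool.or_eq_true]
  refine and_congr_right (fun _ => forall_congr' (fun x => ?_))
  have h1 : scS (eexp x els) * 2 ^ t ≤ alN e P R t x * 2 ^ (eexp x els).sum * 2 ^ (2 * j) ↔
      tp (2 * j) * tps (eexp x els) ≤ V e t (qA e P R t x) := by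
    rw [← Nat.cast_le (α := ℝ)]
    push_cast
    unfold alN
    rw [scS_eq, mN_eq he]
    have a1 := tp_mul_pow (2 * j)
    have a2 : (0 : ℝ) < 2 ^ (eexp x els).sum := by positivity
    have a3 : (0 : ℝ) < 2 ^ t := by positivity
    have a4 : (0 : ℝ) < 2 ^ (2 * j) := by positivity
    set T := (2 : ℝ) ^ t
    set N := (2 : ℝ) ^ (eexp x els).sum
    set J := (2 : ℝ) ^ (2 * j)
    set v := V e t (qA e P R t x)
    set w := tps (eexp x els)
    have a5 : w = J * (tp (2 * j) * w) := by linear_combination (-w) * a1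
    have a6 : N * w * T = (N * T * J) * (tp (2 * j) * w) := by
      linear_combination (-N * T * w) * a1
    rw [a6, show T * v * N * J = (N * T * J) * v by ring]
    exact mul_le_mul_iff_right₀ (by positivity)
  rw [h1]
  constructor
  · intro h hj hx
    rcases h hx with h | h
    · omega
    · exact h
  · intro h hx
    by_cases hj : x < j
    · exact Or.inl hj
    · exact Or.inr (h (by omega) hx)
end

/-- mass of elements in `(a,b]` -/
noncomputable def mass (els : List (ℕ × ℕ)) (a b : ℕ) : ℝ :=
  (els.map (fun p => if a < p.1 ∧ p.1 ≤ b then tp p.2 else 0)).sum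

theorem mass_nonneg (els : List (ℕ × ℕ)) (a b : ℕ) : 0 ≤ mass els a b := by
  unfold mass
  refine List.sum_nonneg ?_
  intro x hx
  obtain ⟨p, _, rfl⟩ := List.mem_map.1 hx
  split_ifs
  · exact (tp_pos _).le
  · exact le_rfl

theorem mass_self (els : List (ℕ × ℕ)) (a : ℕ) : mass els a a = 0 := by
  unfold mass
  refine List.sum_eq_zero ?_
  intro x hx
  obtain ⟨p, _, rfl⟩ := List.mem_map.1 hx
  rw [if_neg (by omega)]

theorem mass_add (els : List (ℕ × ℕ)) {a b c : ℕ} (h1 : a ≤ b) (h2 : b ≤ c) :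
    mass els a c = mass els a b + mass els b c := by
  unfold mass
  induction els with
  | nil => simp
  | cons p l ih =>
    simp only [List.map_cons, List.sum_cons]
    rw [ih]
    have : (if a < p.1 ∧ p.1 ≤ c then tp p.2 else 0) = (if a < p.1 ∧ p.1 ≤ b then tp p.2 else 0) +
        (if b < p.1 ∧ p.1 ≤ c then tp p.2 else 0) := by
      split_ifs <;> first | omega | simp
    rw [this]; ring

theorem mass_cons (p : ℕ × ℕ) (els : List (ℕ × ℕ)) {a b : ℕ} (h : b < p.1) :
    mass (p :: els) a b = mass els a b := by
  unfold mass
  simp only [List.map_cons, List.sum_cons]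
  rw [if_neg (by omega), zero_add]

theorem mass_le_eexp (els : List (ℕ × ℕ)) (a b : ℕ) : mass els a b ≤ tps (eexp a els) := by
  unfold mass tps eexp
  induction els with
  | nil => simp
  | cons p l ih =>
    have := (tp_pos p.2).le
    rw [List.filter_cons]
    simp only [List.map_cons, List.sum_cons, decide_eq_true_eq]
    by_cases h : a < p.1
    · rw [if_pos h]
      simp only [List.map_cons, List.sum_cons]
      refine add_le_add ?_ ih
      split_ifs <;> linarith
    · rw [if_neg h, if_neg (by tauto), zero_add]
      exact ih

theorem eexp_le_mass (els : List (ℕ × ℕ)) (a b : ℕ) (h : ∀ p ∈ els, p.1 ≤ b) :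
    tps (eexp a els) ≤ mass els a b := by
  unfold mass tps eexp
  induction els with
  | nil => simp
  | cons p l ih =>
    have ih' := ih (fun q hq => h q (List.mem_cons_of_mem _ hq))
    rw [List.filter_cons]
    simp only [List.map_cons, List.sum_cons, decide_eq_true_eq]
    by_cases h1 : a < p.1
    · rw [if_pos h1, if_pos ⟨h1, h p (by simp)⟩]
      simp only [List.map_cons, List.sum_cons]
      linarith
    · rw [if_neg h1, if_neg (by tauto), zero_add]
      exact ih'

/-- consecutive chunks filling `(a,b]` -/
def Chn (a : ℕ) : List Chunk → ℕ → Prop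
  | [], b => a = b
  | c :: cs, b => c.2.2 = b ∧ c.2.1 < b ∧ Chn a cs c.2.1

theorem Chn_le {a : ℕ} : ∀ {ch : List Chunk} {b : ℕ}, Chn a ch b → a ≤ b ∧ ∀ c ∈ ch, c.2.2 ≤ b
  | [], b, h => ⟨le_of_eq h, by simp⟩
  | c :: cs, b, h => by
    obtain ⟨h1, h2, h3⟩ := h
    obtain ⟨h4, h5⟩ := Chn_le h3
    refine ⟨by omega, fun d hd => ?_⟩
    rcases List.mem_cons.1 hd with rfl | hd
    · omega
    · have := h5 d hd; omega

/-- overhead factor -/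
noncomputable def lam (j : ℕ) : ℝ := 1 + 3 * tp (ell j)

theorem one_le_lam (j : ℕ) : 1 ≤ lam j := by unfold lam; linarith [tp_pos (ell j)]

theorem lam_pow (j : ℕ) : lam j ^ LL j ≤ 4 := by
  have h1 : lam j ≤ Real.exp (3 * tp (ell j)) := by
    unfold lam
    rw [add_comm]
    exact Real.add_one_le_exp _
  have h2 : (LL j : ℝ) * (3 * tp (ell j)) = 3 / 4 := by
    have h3 := tp_mul_pow (ell j)
    have h4 : (2 : ℝ) ^ (ell j) = LL j * 4 := by
      unfold ell LL
      push_cast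
      rw [show 2 * j + 7 = 2 * j + 5 + 2 by omega, pow_add]
      norm_num
    rw [h4] at h3
    linarith
  calc lam j ^ LL j ≤ Real.exp (3 * tp (ell j)) ^ LL j :=
        pow_le_pow_left₀ (by linarith [one_le_lam j]) h1 _
    _ = Real.exp (3 / 4) := by rw [← Real.exp_nat_mul, h2]
    _ ≤ Real.exp 1 := Real.exp_le_exp.2 (by norm_num)
    _ ≤ 4 := by linarith [Real.exp_one_lt_d9]

section
variable (e : ℕ → Option (Str × Str)) (P R : ℕ → ℕ → Str)

/-- start of row `r` -/
def strt (j : ℕ) (fs : List Frame) (r : ℕ) : ℕ := if r < LL j then (fget fs r).2.1 else j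
/-- weight of the current chunk of row `r` -/
noncomputable def gg (j : ℕ) (fs : List Frame) (r : ℕ) : ℝ :=
  tp (2 + ∑ k ∈ Finset.Ico r (LL j), xp e j (fget fs k).1)

/-- invariant of chunks -/
structure ChunkOK (j r : ℕ) (g : ℝ) (els : List (ℕ × ℕ)) (c : Chunk) : Prop where
  lab : c.1 ≤ c.2.1
  G : (((r + 2) / 2 : ℕ) : ℝ) * (tp (2 * j) * (g * tp (xp e j c.1))) ≤ Gm e P R r c.2.1 c.2.2
  lo : g * tp (xp e j c.1) ≤ mass els c.2.1 c.2.2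
  hi : mass els c.2.1 c.2.2 ≤ lam j ^ r * (g * tp (xp e j c.1))

/-- weights of chunks -/
noncomputable def cw (j : ℕ) (ch : List Chunk) : ℝ := tps (ch.map (fun c => xp e j c.1))

/-- invariant of rows -/
structure FInv (j r a : ℕ) (g : ℝ) (els : List (ℕ × ℕ)) (F : Frame) : Prop where
  chn : Chn a F.2.2 F.2.1
  ok : ∀ c ∈ F.2.2, ChunkOK e P R j r g els c
  wgt : cw e j F.2.2 + tp (xp e j F.1) ≤ lam j
  nod : (labsU P R r F.2.1 F.2.2).Nodup
  cur : F.1 ∉ labsU P R r F.2.1 F.2.2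
  lab : F.1 ≤ F.2.1
  len : F.2.2.length ≤ F.2.1

/-- what a returning row delivers -/
structure RetOK (j r a : ℕ) (g : ℝ) (els : List (ℕ × ℕ)) (t : ℕ) : Prop where
  C : (((r + 1) / 2 : ℕ) : ℝ) * (tp (2 * j) * g) ≤ Cm e P R r a t t
  lo : g ≤ mass els a t
  hi : mass els a t ≤ lam j ^ r * g

/-- invariant of states; `s` is the last action -/
structure SInv (j s : ℕ) (S : St) : Prop where
  st0 : strt j S.1 0 = s
  fr : ∀ r, r < LL j → FInv e P R j r (strt j S.1 (r + 1)) (gg e j S.1 (r + 1)) S.2 (fget S.1 r)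
  els : ∃ tl, S.2 = (s + 1, newexp e j S.1) :: tl ∧ ∀ p ∈ tl, p.1 ≤ s
  elsj : ∀ p ∈ S.2, j < p.1
  nod : (S.2.map Prod.fst).Nodup
  js : j ≤ s
end

section
variable {U : Str →. Str} {e : ℕ → Option (Str × Str)} {P R : ℕ → ℕ → Str} {A D : ℕ → Bool}

theorem gg_pos (j : ℕ) (fs : List Frame) (r : ℕ) : 0 < gg e j fs r := tp_pos _

theorem gg_succ {j r : ℕ} (fs : List Frame) (h : r < LL j) :
    gg e j fs r = gg e j fs (r + 1) * tp (xp e j (fget fs r).1) := by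
  unfold gg
  rw [Finset.sum_eq_sum_Ico_succ_bot h, ← tp_add]
  congr 1
  ring

theorem gg_top (j : ℕ) (fs : List Frame) : gg e j fs (LL j) = 1 / 4 := by
  unfold gg
  simp [tp]; norm_num

theorem gg_zero (j : ℕ) (fs : List Frame) : gg e j fs 0 = tp (newexp e j fs) := by
  unfold gg newexp
  rw [list_sum_range, Finset.range_eq_Ico]

theorem lexp_le (j r t : ℕ) (ch : List Chunk) : tps (lexp e P R j r t ch) ≤ cw e j ch := by
  unfold cw tps lexp
  induction ch with
  | nil => simp
  | cons c cs ih =>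
    have := (tp_pos (xp e j c.1)).le
    rw [List.filter_cons]
    split_ifs
    · simp only [List.map_cons, List.sum_cons]; linarith
    · simp only [List.map_cons, List.sum_cons]; linarith

theorem cw_cons (j : ℕ) (c : Chunk) (ch : List Chunk) : cw e j (c :: ch) = tp (xp e j c.1) + cw e j ch := by
  simp [cw, tps]

theorem chain_up (hP : Appr A P) (hR : Appr D R) {j r a t : ℕ} {g : ℝ} {els : List (ℕ × ℕ)} :
    ∀ {ch : List Chunk} {b : ℕ}, Chn a ch b → b ≤ t → (∀ c ∈ ch, ChunkOK e P R j r g els c) →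
    (((r + 2) / 2 : ℕ) : ℝ) * (tp (2 * j) * g) * tps (lexp e P R j r t ch) ≤ Cm e P R (r + 1) a b t ∧
    g * cw e j ch ≤ mass els a b ∧ mass els a b ≤ lam j ^ r * g * cw e j ch
  | [], b, h, _, _ => by
    have h' : a = b := h
    subst h'
    rw [mass_self]
    simp [lexp, tps, cw, Cm_nonneg]
  | c :: cs, b, h, hb, hok => by
    obtain ⟨h1, h2, h3⟩ := h
    obtain ⟨i1, i2, i3⟩ := chain_up (t := t) hP hR h3 (by omega) (fun c hc => hok c (List.mem_cons_of_mem _ hc))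
    have hac := (Chn_le h3).1
    have hc := hok c (by simp)
    have hG := hc.G
    have hlo := hc.lo
    have hhi := hc.hi
    rw [h1] at hG hlo hhi
    rw [cw_cons, mass_add els hac h2.le]
    refine ⟨?_, by linarith, by nlinarith⟩
    have hsp := Cm_split (e := e) (P := P) (R := R) (r := r + 1) (τ := t) hac h2.le
    have hn := Cm_nonneg (e := e) (P := P) (R := R) (r + 1) c.2.1 b t
    by_cases hl : lostc P R r t c = true
    · have : tps (lexp e P R j r t (c :: cs)) = tp (xp e j c.1) + tps (lexp e P R j r t cs) := by
        simp [tps, lexp, hl]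
      rw [this]
      have hg := Gm_le_Cm (e := e) hP hR (r := r) (a := c.2.1) (u := b) (t := t) (by omega) (by
        simpa [lostc, h1] using hl)
      nlinarith
    · have : tps (lexp e P R j r t (c :: cs)) = tps (lexp e P R j r t cs) := by
        simp [tps, lexp, hl]
      rw [this]
      linarith

theorem ret_up (hP : Appr A P) (hR : Appr D R) {j r a t : ℕ} {g : ℝ} (hg : 0 < g) {els : List (ℕ × ℕ)}
    {ch : List Chunk} (h1 : Chn a ch t) (h2 : ∀ c ∈ ch, ChunkOK e P R j r g els c)
    (h3 : 1 ≤ tps (lexp e P R j r t ch)) (h4 : cw e j ch ≤ lam j) :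
    RetOK e P R j (r + 1) a g els t := by
  obtain ⟨i1, i2, i3⟩ := chain_up hP hR h1 le_rfl h2
  have h5 := lexp_le (e := e) (P := P) (R := R) j r t ch
  have h6 : 0 < lam j := by linarith [one_le_lam j]
  have h7 : (0 : ℝ) ≤ (((r + 2) / 2 : ℕ) : ℝ) * (tp (2 * j) * g) :=
    mul_nonneg (Nat.cast_nonneg _) (mul_nonneg (tp_pos _).le hg.le)
  refine ⟨?_, by nlinarith, ?_⟩
  · refine le_trans ?_ i1
    rw [show r + 1 + 1 = r + 2 by omega]
    nlinarith
  · refine i3.trans ?_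
    rw [pow_succ]
    have : 0 < lam j ^ r * g := by positivity
    nlinarith

theorem strt_le {j s : ℕ} {S : St} (h : SInv e P R j s S) : ∀ r, r ≤ LL j → strt j S.1 r ≤ s ∧ j ≤ strt j S.1 r := by
  have hstep : ∀ r, r < LL j → strt j S.1 (r + 1) ≤ strt j S.1 r := by
    intro r hr
    have := (Chn_le (h.fr r hr).chn).1
    have h2 : strt j S.1 r = (fget S.1 r).2.1 := by rw [strt, if_pos hr]
    rw [h2]
    exact this
  intro r hr
  constructor
  · induction r with
    | zero => exact h.st0.le
    | succ r ih => exact (hstep r (by omega)).trans (ih (by omega))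
  · obtain ⟨d, hd⟩ : ∃ d, LL j = r + d := ⟨LL j - r, by omega⟩
    induction d generalizing r with
    | zero => rw [strt, if_neg (by omega)]
    | succ d ih => exact (ih (r + 1) (by omega) (by omega)).trans (hstep r (by omega))

theorem mass_zero {j s : ℕ} {S : St} (h : SInv e P R j s S) {t : ℕ} (ht : s < t) :
    mass S.2 s t = gg e j S.1 0 := by
  obtain ⟨tl, h1, h2⟩ := h.els
  rw [h1, gg_zero, mass]
  simp only [List.map_cons, List.sum_cons]
  rw [if_pos ⟨by omega, by omega⟩]
  have : (tl.map (fun p => if s < p.1 ∧ p.1 ≤ t then tp p.2 else 0)).sum = 0 := by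
    refine List.sum_eq_zero ?_
    intro x hx
    obtain ⟨p, hp, rfl⟩ := List.mem_map.1 hx
    have := h2 p hp
    rw [if_neg (by omega)]
  rw [this, add_zero]

theorem total_mass (hP : Appr A P) (hR : Appr D R) {j s : ℕ} {S : St} (h : SInv e P R j s S) : tps (S.2.map Prod.snd) ≤ 1 := by
  have hle : ∀ p ∈ S.2, p.1 ≤ s + 1 := by
    obtain ⟨tl, h1, h2⟩ := h.els
    rw [h1]
    intro p hp
    rcases List.mem_cons.1 hp with rfl | hp
    · exact le_rfl
    · exact (h2 p hp).trans (by omega)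
  have key : ∀ r, r ≤ LL j → mass S.2 (strt j S.1 r) (s + 1) ≤ lam j ^ r * gg e j S.1 r := by
    intro r
    induction r with
    | zero => intro _; rw [h.st0, mass_zero h (by omega), pow_zero, one_mul]
    | succ r ih =>
      intro hr
      have ih := ih (by omega)
      have hF := h.fr r (by omega)
      have hs : strt j S.1 r = (fget S.1 r).2.1 := by rw [strt, if_pos (by omega)]
      obtain ⟨_, _, i3⟩ := chain_up hP hR hF.chn le_rfl hF.ok
      rw [← hs] at i3
      have hle1 : strt j S.1 (r + 1) ≤ strt j S.1 r := by rw [hs]; exact (Chn_le hF.chn).1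
      rw [mass_add S.2 hle1 (by have := (strt_le h r (by omega)).1; omega)]
      rw [gg_succ S.1 (show r < LL j by omega)] at ih
      have hw := hF.wgt
      have h1 : 0 < lam j ^ r * gg e j S.1 (r + 1) :=
        mul_pos (pow_pos (by linarith [one_le_lam j]) _) (gg_pos _ _ _)
      rw [pow_succ]
      nlinarith
  have h1 := key (LL j) le_rfl
  rw [gg_top, strt, if_neg (by omega)] at h1
  have h2 := lam_pow j
  have h3 := eexp_le_mass S.2 j (s + 1) hle
  have h4 : eexp j S.2 = S.2.map Prod.snd := by
    unfold eexp
    rw [List.filter_eq_self.2]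
    intro p hp
    simpa using h.elsj p hp
  rw [h4] at h3
  linarith

theorem labsU_chp (hP : Appr A P) (hR : Appr D R) {j r a t : ℕ} {g : ℝ} {els : List (ℕ × ℕ)} {F : Frame} (h : FInv e P R j r a g els F)
    (ht : F.2.1 < t) : (labsU P R r t (chp t F)).Nodup := by
  have h1 : labsU P R r t (chp t F) = F.1 :: labsU P R r t F.2.2 := by
    simp [labsU, chp, lostc]
  have h2 : List.Sublist (labsU P R r t F.2.2) (labsU P R r F.2.1 F.2.2) := by
    unfold labsU
    refine List.Sublist.map _ ?_
    rw [show F.2.2.filter (fun c => !lostc P R r t c) = (F.2.2.filter (fun c => !lostc P R r F.2.1 c)).filter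
      (fun c => !lostc P R r t c) by
        rw [List.filter_filter]
        refine List.filter_congr (fun c hc => ?_)
        have hu := (Chn_le h.chn).2 c hc
        by_cases hl : lostc P R r F.2.1 c = true
        · have : lostc P R r t c = true := by
            unfold lostc at hl ⊢
            rw [decide_eq_true_eq] at hl ⊢
            exact XX_nr hP hR hu ht.le hl
          simp [hl, this]
        · simp [hl]]
    exact List.filter_sublist
  rw [h1, List.nodup_cons]
  exact ⟨fun hm => h.cur (h2.subset hm), h2.nodup h.nod⟩

theorem cw_split (j r t : ℕ) (ch : List Chunk) :
    cw e j ch = tps (lexp e P R j r t ch) + tps ((labsU P R r t ch).map (xp e j)) := by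
  unfold cw tps lexp labsU
  induction ch with
  | nil => simp
  | cons c cs ih =>
    rw [List.filter_cons, List.filter_cons]
    by_cases hl : lostc P R r t c = true
    · simp only [hl, List.map_cons, List.sum_cons, ih, if_true, Bool.not_true, Bool.false_eq_true, if_false]
      ring
    · simp only [hl, List.map_cons, List.sum_cons, ih, if_true, Bool.not_false, Bool.false_eq_true, if_false]
      ring

theorem tps_labels (hU : PFMachine U) (he : Enum U e) {j : ℕ} {l : List ℕ} (hl : l.Nodup) :
    tps (l.map (xp e j)) ≤ 2 * tp (ell j) := by
  have h1 : tps (l.map (xp e j)) = ∑ i ∈ l.toFinset, tp (xp e j i) := by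
    rw [List.sum_toFinset _ hl]
    simp only [tps, List.map_map]
    rfl
  rw [h1]
  have h2 : ∀ i, tp (xp e j i) = tp (ell j) * tp (labl e i).1 := fun i => tp_add _ _
  simp only [h2]
  rw [← Finset.mul_sum]
  have := labl_sum hU he l.toFinset
  have := tp_pos (ell j)
  nlinarith

theorem wgt_new (hU : PFMachine U) (he : Enum U e) {j r t : ℕ} {ch : List Chunk}
    (h1 : (labsU P R r t ch).Nodup) (h2 : retb e P R j r t ch = false) :
    cw e j ch + tp (xp e j (fresh P R r t ch)) ≤ lam j := by
  have h3 : tps (lexp e P R j r t ch) < 1 := by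
    by_contra hc
    push Not at hc
    rw [(retb_iff j r t ch).2 hc] at h2
    exact Bool.noConfusion h2
  rw [cw_split (P := P) (R := R) j r t]
  have h4 := tps_labels hU he (j := j) (l := fresh P R r t ch :: labsU P R r t ch)
    (List.nodup_cons.2 ⟨(fresh_spec r t ch).2.1, h1⟩)
  have h5 : tps ((fresh P R r t ch :: labsU P R r t ch).map (xp e j)) =
    tp (xp e j (fresh P R r t ch)) + tps ((labsU P R r t ch).map (xp e j)) := by simp [tps]
  rw [h5] at h4
  unfold lam
  have := tp_pos (ell j)
  linarith

end

section
variable {U : Str →. Str} {e : ℕ → Option (Str × Str)} {P R : ℕ → ℕ → Str} {A D : ℕ → Bool}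

theorem strt_of_lt {j r : ℕ} {fs : List Frame} (h : r < LL j) : strt j fs r = (fget fs r).2.1 := by
  rw [strt, if_pos h]

theorem chp_ok (he : Enum U e) {j s t r : ℕ} {S : St} (h : SInv e P R j s S) (hst : s < t)
    (hg : goodb e P R j t S.2 = true) (hr : r < LL j)
    (hret : RetOK e P R j r (strt j S.1 r) (gg e j S.1 r) S.2 t) :
    Chn (strt j S.1 (r + 1)) (chp t (fget S.1 r)) t ∧
    ∀ c ∈ chp t (fget S.1 r), ChunkOK e P R j r (gg e j S.1 (r + 1)) S.2 c := by
  have hF := h.fr r hr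
  have hs := strt_of_lt (fs := S.1) hr
  obtain ⟨hle, hj⟩ := strt_le h r hr.le
  refine ⟨⟨rfl, by show (fget S.1 r).2.1 < t; omega, hF.chn⟩, ?_⟩
  intro c hc
  rcases List.mem_cons.1 hc with rfl | hc
  · obtain ⟨h1, h2, h3⟩ := hret
    rw [gg_succ S.1 hr, hs] at h1 h2 h3
    refine ⟨hF.lab, store_ok he h1 ?_, h2, h3⟩
    refine le_trans ?_ (((goodb_iff he j t S.2).1 hg).2 (fget S.1 r).2.1 (hs ▸ hj) (by omega))
    exact mul_le_mul_of_nonneg_left (h2.trans (mass_le_eexp _ _ _)) (tp_pos _).le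
  · exact hF.ok c hc

theorem ret_all (he : Enum U e) (hP : Appr A P) (hR : Appr D R) {j s t : ℕ} {S : St}
    (h : SInv e P R j s S) (hst : s < t) (hg : goodb e P R j t S.2 = true) (r : ℕ)
    (hr : r ≤ nidx e P R j t S.1) :
    RetOK e P R j r (strt j S.1 r) (gg e j S.1 r) S.2 t := by
  obtain ⟨hn1, hn2, _⟩ := nidx_spec (e := e) (P := P) (R := R) j t S.1
  induction r with
  | zero =>
    rw [h.st0]
    have := mass_zero h hst
    exact ⟨by simpa using Cm_nonneg _ _ _ _, this.ge, by rw [this]; simp⟩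
  | succ r ih =>
    obtain ⟨h1, h2⟩ := chp_ok he h hst hg (by omega) (ih (by omega))
    have hF := h.fr r (by omega)
    refine ret_up hP hR (gg_pos _ _ _) h1 h2 ((retb_iff _ _ _ _).1 (hn2 r (by omega))) ?_
    unfold chp
    rw [cw_cons]
    linarith [hF.wgt]

theorem nidx_lt (hU : PFMachine U) (he : Enum U e) (hP : Appr A P) (hR : Appr D R) {j s t : ℕ} {S : St}
    (h : SInv e P R j s S) (hst : s < t) (hg : goodb e P R j t S.2 = true) :
    nidx e P R j t S.1 < LL j := by
  by_contra hc
  have hn1 := (nidx_spec (e := e) (P := P) (R := R) j t S.1).1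
  have hr := (ret_all he hP hR h hst hg (LL j) (by omega)).C
  have h2 := Cm_le (P := P) (R := R) hU he (LL j) (strt j S.1 (LL j)) t t
  rw [gg_top] at hr
  have h3 : (LL j + 1) / 2 = 16 * 2 ^ (2 * j) := by
    unfold LL
    rw [pow_add]
    omega
  rw [h3] at hr
  push_cast at hr
  have := tp_mul_pow (2 * j)
  nlinarith

theorem ChunkOK.congr {j r : ℕ} {g : ℝ} {els : List (ℕ × ℕ)} {p : ℕ × ℕ} {c : Chunk}
    (h : ChunkOK e P R j r g els c) (hp : c.2.2 < p.1) : ChunkOK e P R j r g (p :: els) c :=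
  ⟨h.lab, h.G, by rw [mass_cons _ _ hp]; exact h.lo, by rw [mass_cons _ _ hp]; exact h.hi⟩

theorem SInv_step (hU : PFMachine U) (he : Enum U e) (hP : Appr A P) (hR : Appr D R) {j s t : ℕ} {S : St}
    (h : SInv e P R j s S) (hst : s < t) (hg : goodb e P R j t S.2 = true) :
    SInv e P R j t (stepS e P R j t S) := by
  have hnL := nidx_lt hU he hP hR h hst hg
  have hns := (nidx_spec (e := e) (P := P) (R := R) j t S.1).2.2 hnL
  have hjt := ((goodb_iff he j t S.2).1 hg).1
  obtain ⟨tl, hel1, hel2⟩ := h.els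
  have hles : ∀ p ∈ S.2, p.1 ≤ s + 1 := by
    rw [hel1]
    intro p hp
    rcases List.mem_cons.1 hp with rfl | hp
    · exact le_rfl
    · exact (hel2 p hp).trans (by omega)
  have hret := ret_all he hP hR h hst hg _ le_rfl
  obtain ⟨hc1, hc2⟩ := chp_ok he h hst hg hnL hret
  have hf1 : ∀ r, r < nidx e P R j t S.1 → fget (newFs e P R j t S.1) r = (0, t, []) := by
    intro r hr
    rw [fget_new S.1 (by omega), newF, if_pos hr]
  have hf2 : fget (newFs e P R j t S.1) (nidx e P R j t S.1) =
      (fresh P R (nidx e P R j t S.1) t (chp t (fget S.1 (nidx e P R j t S.1))), t,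
        chp t (fget S.1 (nidx e P R j t S.1))) := by
    rw [fget_new S.1 hnL, newF, if_neg (by omega), if_pos rfl]
  have hf3 : ∀ r, nidx e P R j t S.1 < r → r < LL j → fget (newFs e P R j t S.1) r = fget S.1 r := by
    intro r hr hr'
    rw [fget_new S.1 hr', newF, if_neg (by omega), if_neg (by omega)]
  have hs1 : ∀ r, r ≤ nidx e P R j t S.1 → strt j (newFs e P R j t S.1) r = t := by
    intro r hr
    rw [strt_of_lt (by omega)]
    rcases Nat.lt_or_eq_of_le hr with hr | rfl
    · rw [hf1 r hr]
    · rw [hf2]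
  have hs2 : ∀ r, nidx e P R j t S.1 < r → strt j (newFs e P R j t S.1) r = strt j S.1 r := by
    intro r hr
    by_cases hr' : r < LL j
    · rw [strt_of_lt hr', strt_of_lt hr', hf3 r hr hr']
    · rw [strt, strt, if_neg hr', if_neg hr']
  have hgg : ∀ r, nidx e P R j t S.1 < r → gg e j (newFs e P R j t S.1) r = gg e j S.1 r := by
    intro r hr
    unfold gg
    congr 2
    refine Finset.sum_congr rfl (fun k hk => ?_)
    rw [Finset.mem_Ico] at hk
    rw [hf3 k (by omega) hk.2]
  refine ⟨hs1 0 (by omega), ?_, ⟨S.2, rfl, fun p hp => (hles p hp).trans (by omega)⟩, ?_, ?_, by omega⟩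
  · intro r hr
    show FInv e P R j r (strt j (newFs e P R j t S.1) (r + 1)) (gg e j (newFs e P R j t S.1) (r + 1))
      ((t + 1, _) :: S.2) (fget (newFs e P R j t S.1) r)
    rcases lt_trichotomy r (nidx e P R j t S.1) with hlt | heq | hgt
    · rw [hf1 r hlt, hs1 (r + 1) (by omega)]
      refine ⟨rfl, by simp, ?_, by simp [labsU], by simp [labsU], Nat.zero_le _, Nat.zero_le _⟩
      show cw e j [] + tp (xp e j 0) ≤ lam j
      have h1 : cw e j [] = 0 := by simp [cw, tps]
      have := tp_le_one (xp e j 0)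
      linarith [one_le_lam j]
    · subst heq
      rw [hf2, hs2 _ (Nat.lt_succ_self _), hgg _ (Nat.lt_succ_self _)]
      have hF := h.fr _ hnL
      have hlt : (fget S.1 (nidx e P R j t S.1)).2.1 < t := by
        have := (strt_le h _ hnL.le).1
        rw [strt_of_lt hnL] at this
        omega
      have hnd := labsU_chp hP hR hF hlt
      obtain ⟨f1, f2, _⟩ := fresh_spec (P := P) (R := R) (nidx e P R j t S.1) t (chp t (fget S.1 (nidx e P R j t S.1)))
      have hlen : (chp t (fget S.1 (nidx e P R j t S.1))).length ≤ t := by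
        have := hF.len
        simp only [chp, List.length_cons]
        omega
      refine ⟨hc1, ?_, wgt_new hU he hnd hns, hnd, f2, f1.trans hlen, hlen⟩
      intro c hc
      refine (hc2 c hc).congr ?_
      have := (Chn_le hc1).2 c hc
      show c.2.2 < t + 1
      omega
    · rw [hf3 r hgt hr, hs2 _ (by omega), hgg _ (by omega)]
      have hF := h.fr r hr
      refine ⟨hF.chn, ?_, hF.wgt, hF.nod, hF.cur, hF.lab, hF.len⟩
      intro c hc
      refine (hF.ok c hc).congr ?_
      have h1 := (Chn_le hF.chn).2 c hc
      have h2 := (strt_le h r hr.le).1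
      rw [strt_of_lt hr] at h2
      show c.2.2 < t + 1
      omega
  · intro p hp
    rcases List.mem_cons.1 hp with rfl | hp
    · show j < t + 1
      omega
    · exact h.elsj p hp
  · show (((t + 1, _) :: S.2).map Prod.fst).Nodup
    rw [List.map_cons, List.nodup_cons]
    refine ⟨?_, h.nod⟩
    intro hm
    obtain ⟨p, hp, hpe⟩ := List.mem_map.1 hm
    have := hles p hp
    simp only at hpe
    omega

theorem SInv_init (j : ℕ) : SInv e P R j j (initS e j) := by
  have hs : ∀ r, strt j (initF j) r = j := by
    intro r
    by_cases hr : r < LL j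
    · rw [strt_of_lt hr, fget_init hr]
    · rw [strt, if_neg hr]
  refine ⟨hs 0, ?_, ⟨[], rfl, by simp⟩, ?_, ?_, le_rfl⟩
  · intro r hr
    show FInv e P R j r (strt j (initF j) (r + 1)) _ _ (fget (initF j) r)
    rw [fget_init hr, hs]
    refine ⟨rfl, by simp, ?_, by simp [labsU], by simp [labsU], Nat.zero_le _, Nat.zero_le _⟩
    show cw e j [] + tp (xp e j 0) ≤ lam j
    have h1 : cw e j [] = 0 := by simp [cw, tps]
    have := tp_le_one (xp e j 0)
    linarith [one_le_lam j]
  · simp [initS]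
  · simp [initS]

theorem SInv_sta (hU : PFMachine U) (he : Enum U e) (hP : Appr A P) (hR : Appr D R) (j t : ℕ) :
    ∃ s, SInv e P R j s (sta e P R j t) ∧ (s < t ∨ s = j) := by
  induction t with
  | zero => exact ⟨j, SInv_init j, Or.inr rfl⟩
  | succ t ih =>
    obtain ⟨s, h1, h2⟩ := ih
    rw [sta_succ]
    split_ifs with ha
    · have hjt := ((goodb_iff he j t _).1 ha).1
      exact ⟨t, SInv_step hU he hP hR h1 (by omega) ha, Or.inl (by omega)⟩
    · exact ⟨s, h1, by omega⟩

/-- invariants at an action -/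
theorem SInv_act (hU : PFMachine U) (he : Enum U e) (hP : Appr A P) (hR : Appr D R) {j t : ℕ}
    (ha : act e P R j t = true) : ∃ s, s < t ∧ SInv e P R j s (sta e P R j t) := by
  obtain ⟨s, h1, h2⟩ := SInv_sta hU he hP hR j t
  have hjt := ((goodb_iff he j t _).1 ha).1
  exact ⟨s, by omega, h1⟩

end

/-- requests for the elements -/
def rqM (e : ℕ → Option (Str × Str)) (P R : ℕ → ℕ → Str) (k : ℕ) : Option (ℕ × Str) :=
  if k.unpair.2 = 0 ∨ act e P R k.unpair.1 (k.unpair.2 - 1) = true then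
    Option.some (((sta e P R k.unpair.1 k.unpair.2).2.getD 0 (0, 0)).2 + k.unpair.1 + 1,
      zeroStr (4 * ((sta e P R k.unpair.1 k.unpair.2).2.getD 0 (0, 0)).1))
  else Option.none

section
variable {U : Str →. Str} {e : ℕ → Option (Str × Str)} {P R : ℕ → ℕ → Str} {A D : ℕ → Bool}

theorem pr_rqM (he : Enum U e) (hP : Appr A P) (hR : Appr D R) : Primrec (rqM e P R) := by
  have h1 := pr_act he hP hR
  have h2 := pr_sta he hP hR
  unfold rqM zeroStr
  refine pr_ite (pr_dor (by fun_prop) ?_) (by fun_prop) (by fun_prop)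
  exact pr_eq (by fun_prop) (by fun_prop)

theorem rqM_sum_j (j m : ℕ) : ∑ t ∈ Finset.range (m + 1), rwt (rqM e P R (Nat.pair j t)) =
    tp (j + 1) * tps ((sta e P R j m).2.map Prod.snd) := by
  induction m with
  | zero =>
    simp [rqM, Nat.unpair_pair, sta_zero, initS, rwt_some, tps]
    rw [← tp_add]; congr 1; ring
  | succ m ih =>
    rw [Finset.sum_range_succ, ih]
    unfold rqM
    simp only [Nat.unpair_pair]
    by_cases ha : act e P R j m = true
    · rw [if_pos (Or.inr (by simpa using ha)), rwt_some, sta_succ, if_pos ha]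
      simp only [stepS, List.map_cons, tps, List.sum_cons, List.getD_cons_zero]
      rw [mul_add, ← tp_add, add_comm]
      congr 2; ring
    · rw [if_neg (by simpa using ha), rwt_none, sta_succ, if_neg ha, add_zero]

theorem rqM_sum (hU : PFMachine U) (he : Enum U e) (hP : Appr A P) (hR : Appr D R) (n : ℕ) :
    ∑ k ∈ Finset.range n, rwt (rqM e P R k) ≤ 1 := by
  refine (sum_pair_le _ (fun k => rwt_nonneg _) n).trans ?_
  have h1 : ∀ j, ∑ t ∈ Finset.range n, rwt (rqM e P R (Nat.pair j t)) ≤ tp (j + 1) := by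
    intro j
    have h2 : ∑ t ∈ Finset.range n, rwt (rqM e P R (Nat.pair j t)) ≤
        ∑ t ∈ Finset.range (n + 1), rwt (rqM e P R (Nat.pair j t)) := by
      rw [Finset.sum_range_succ]
      linarith [rwt_nonneg (rqM e P R (Nat.pair j n))]
    rw [rqM_sum_j] at h2
    obtain ⟨s, hs, _⟩ := SInv_sta hU he hP hR j n
    have := total_mass hP hR hs
    have h3 := tp_pos (j + 1)
    nlinarith
  refine (Finset.sum_le_sum (fun j _ => h1 j)).trans ?_
  rw [sum_tp_succ]
  linarith [tp_pos n]

theorem els_KC (hU : OptimalPF U) (he : Enum U e) (hP : Appr A P) (hR : Appr D R) :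
    ∃ c, ∀ j t, ∀ p ∈ (sta e P R j t).2, KC U (zeroStr (4 * p.1)) ≤ ((p.2 + j + 1 + c : ℕ) : ℕ∞) := by
  obtain ⟨c, hc⟩ := kc_theorem hU _ (pr_rqM he hP hR) (rqM_sum hU.1 he hP hR)
  refine ⟨c, fun j t => ?_⟩
  induction t with
  | zero =>
    intro p hp
    have h := hc (Nat.pair j 0)
    simp only [rqM, Nat.unpair_pair, true_or, if_true, sta_zero, initS, List.getD_cons_zero] at h
    simp only [sta_zero, initS, List.mem_singleton] at hp
    subst hp
    exact h _ _ rfl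
  | succ t ih =>
    intro p hp
    rw [sta_succ] at hp
    split_ifs at hp with ha
    · rcases List.mem_cons.1 hp with rfl | hp
      · have h := hc (Nat.pair j (t + 1))
        unfold rqM at h
        simp only [Nat.unpair_pair] at h
        rw [if_pos (Or.inr (by simpa using ha)), sta_succ, if_pos ha] at h
        simp only [stepS, List.getD_cons_zero] at h
        exact h _ _ rfl
      · exact ih p hp
    · exact ih p hp

theorem act_inf (hU : OptimalPF U) (he : Enum U e) (hP : Appr A P) (hR : Appr D R)
    (hB : KTrivialSeq U (Bseq e P R)) :
    ∃ j, ∀ T, ∃ t, T ≤ t ∧ act e P R j t = true := by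
  obtain ⟨d, x0, hE⟩ := lemma_E hU he hP hR hB
  obtain ⟨c, hc⟩ := els_KC hU he hP hR
  refine ⟨x0 + d + c + 1, ?_⟩
  set j := x0 + d + c + 1 with hj
  by_contra hcon
  push Not at hcon
  obtain ⟨T, hT⟩ := hcon
  have hconst : ∀ t, T ≤ t → sta e P R j t = sta e P R j T := by
    intro t ht
    induction t, ht using Nat.le_induction with
    | base => rfl
    | succ t ht ih => rw [sta_succ, if_neg (by simpa using hT t ht), ih]
  set S := sta e P R j T with hS
  obtain ⟨s, hs, _⟩ := SInv_sta hU.1 he hP hR j T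
  rw [← hS] at hs
  have hfin : ∀ x, ∃ s1, j ≤ x → ∀ t, s1 ≤ t → tp (2 * j) * tps (eexp x S.2) ≤ V e t (qA e P R t x) := by
    intro x
    by_cases hx : j ≤ x
    · have hnd : (S.2.filter (fun p => decide (x < p.1))).Nodup := (hs.nod.of_map _).filter _
      obtain ⟨s1, hs1⟩ := hE x (by omega) (S.2.filter (fun p => decide (x < p.1))).toFinset
        (fun p => 4 * p.1) (fun p => p.2 + j + 1 + c) (by
          intro p hp q hq hpq
          simp only [List.coe_toFinset, List.mem_filter, Set.mem_ofPred_eq] at hp hq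
          have h4 : p.1 = q.1 := by simp only at hpq; omega
          exact List.inj_on_of_nodup_map hs.nod hp.1 hq.1 h4) (by
          intro p hp
          simp only [List.mem_toFinset, List.mem_filter, decide_eq_true_eq] at hp
          omega) (by
          intro p hp
          simp only [List.mem_toFinset, List.mem_filter, decide_eq_true_eq] at hp
          exact hc j T p hp.1)
      refine ⟨s1, fun _ t ht => le_trans ?_ (hs1 t ht)⟩
      have h1 : tps (eexp x S.2) = ∑ p ∈ (S.2.filter (fun p => decide (x < p.1))).toFinset, tp p.2 := by
        rw [List.sum_toFinset _ hnd]
        simp only [tps, eexp, List.map_map]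
        rfl
      have h2 : ∀ p : ℕ × ℕ, tp (p.2 + j + 1 + c) = tp (j + 1 + c) * tp p.2 := by
        intro p; rw [← tp_add]; congr 1; ring
      simp only [h2]
      rw [← Finset.mul_sum, ← h1, ← mul_assoc, ← tp_add]
      exact mul_le_mul_of_nonneg_right (tp_anti (by omega)) (tps_nonneg _)
    · exact ⟨0, fun h => absurd h hx⟩
  choose s1 hs1 using hfin
  obtain ⟨tl, hel1, hel2⟩ := hs.els
  have hles : ∀ p ∈ S.2, p.1 ≤ s + 1 := by
    rw [hel1]
    intro p hp
    rcases List.mem_cons.1 hp with rfl | hp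
    · exact le_rfl
    · exact (hel2 p hp).trans (by omega)
  let t := max (max T (j + 1)) ((Finset.range (s + 1)).sup s1)
  have ht1 : T ≤ t := (le_max_left _ _).trans (le_max_left _ _)
  have ht2 : j + 1 ≤ t := (le_max_right _ _).trans (le_max_left _ _)
  refine hT t ht1 ?_
  unfold act
  rw [hconst t ht1, goodb_iff he]
  refine ⟨ht2, fun x hx _ => ?_⟩
  by_cases hxs : x < s + 1
  · exact hs1 x hx t ((Finset.le_sup (Finset.mem_range.2 hxs)).trans (le_max_right _ _))
  · have : eexp x S.2 = [] := by
      unfold eexp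
      rw [List.map_eq_nil_iff, List.filter_eq_nil_iff]
      intro p hp
      have := hles p hp
      simp only [decide_eq_true_eq]
      omega
    rw [this]
    simp [tps, V_nonneg]
end

section
variable {U : Str →. Str} {e : ℕ → Option (Str × Str)} {P R : ℕ → ℕ → Str} {A D : ℕ → Bool}

/-- row `k` before stage `t` -/
def frk (e : ℕ → Option (Str × Str)) (P R : ℕ → ℕ → Str) (j k t : ℕ) : Frame :=
  fget (sta e P R j t).1 k

/-- an event for row `k` -/
def hev (e : ℕ → Option (Str × Str)) (P R : ℕ → ℕ → Str) (j k t : ℕ) : Prop :=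
  act e P R j t = true ∧ nidx e P R j t (sta e P R j t).1 = k

/-- row `k` is stuck from stage `T0` on -/
structure Stuck (e : ℕ → Option (Str × Str)) (P R : ℕ → ℕ → Str) (j k T0 : ℕ) : Prop where
  lt : k < LL j
  nil : (frk e P R j k T0).2.2 = []
  le : ∀ t, T0 ≤ t → act e P R j t = true → nidx e P R j t (sta e P R j t).1 ≤ k
  inf : ∀ T, ∃ t, T ≤ t ∧ hev e P R j k t

theorem exists_stuck (hU : PFMachine U) (he : Enum U e) (hP : Appr A P) (hR : Appr D R) {j : ℕ}
    (h : ∀ T, ∃ t, T ≤ t ∧ act e P R j t = true) : ∃ k T0, Stuck e P R j k T0 := by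
  have hlt : ∀ t, act e P R j t = true → nidx e P R j t (sta e P R j t).1 < LL j := by
    intro t ht
    obtain ⟨s, hs, hS⟩ := SInv_act hU he hP hR ht
    exact nidx_lt hU he hP hR hS hs ht
  have hex : ∃ k, ∃ T, ∀ t, T ≤ t → act e P R j t = true → nidx e P R j t (sta e P R j t).1 < k :=
    ⟨LL j, 0, fun t _ ht => hlt t ht⟩
  have hk := Nat.find_spec hex
  have hmin := fun m => Nat.find_min (m := m) hex
  set k1 := Nat.find hex
  have hk0 : k1 ≠ 0 := by
    intro h0
    obtain ⟨T, hT⟩ := hk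
    obtain ⟨t, ht, ha⟩ := h T
    have := hT t ht ha
    omega
  obtain ⟨k, hkk⟩ := Nat.exists_eq_succ_of_ne_zero hk0
  rw [hkk] at hk hmin
  have hT := Nat.find_spec hk
  have hTmin := fun m => Nat.find_min (m := m) hk
  set T0 := Nat.find hk
  have hinf : ∀ T, ∃ t, T ≤ t ∧ hev e P R j k t := by
    intro T
    by_contra hc
    refine hmin k (by omega) ⟨max T T0, fun t ht ha => ?_⟩
    have h1 := hT t (by omega) ha
    by_contra h2
    exact hc ⟨t, by omega, ha, by omega⟩
  have hkL : k < LL j := by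
    obtain ⟨t, _, ht⟩ := hinf 0
    have := hlt t ht.1
    rw [ht.2] at this
    exact this
  refine ⟨k, T0, hkL, ?_, fun t ht ha => by have := hT t ht ha; omega, hinf⟩
  rcases Nat.eq_zero_or_pos T0 with h0 | h0
  · rw [h0, frk, sta_zero]
    simp only [initS, fget_init hkL]
  · have h1 := hTmin (T0 - 1) (by omega)
    push Not at h1
    obtain ⟨t, ht, ha, hn⟩ := h1
    have h2 : t = T0 - 1 := by
      by_contra hne
      have := hT t (by omega) ha
      omega
    have h3 : T0 = t + 1 := by omega
    rw [h3, frk, sta_succ, if_pos ha]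
    simp only [stepS]
    rw [fget_new _ hkL, newF, if_pos (by omega)]

namespace Stuck
variable {j k T0 : ℕ}

theorem step (h : Stuck e P R j k T0) {t : ℕ} (hev' : hev e P R j k t) :
    frk e P R j k (t + 1) = (fresh P R k t (chp t (frk e P R j k t)), t, chp t (frk e P R j k t)) := by
  rw [frk, sta_succ, if_pos hev'.1]
  simp only [stepS]
  rw [fget_new _ h.lt, newF, if_neg (by have := hev'.2; omega), if_pos hev'.2.symm]
  rfl

theorem stay (h : Stuck e P R j k T0) {t : ℕ} (ht : T0 ≤ t) (hev' : ¬ hev e P R j k t) :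
    frk e P R j k (t + 1) = frk e P R j k t := by
  rw [frk, sta_succ]
  split_ifs with ha
  · have h1 := h.le t ht ha
    have h2 : nidx e P R j t (sta e P R j t).1 ≠ k := fun h2 => hev' ⟨ha, h2⟩
    simp only [stepS]
    rw [fget_new _ h.lt, newF, if_neg (by omega), if_neg (by omega)]
    rfl
  · rfl

theorem next (h : Stuck e P R j k T0) {t : ℕ} (ht : T0 ≤ t) :
    ∃ s, t ≤ s ∧ hev e P R j k s ∧ frk e P R j k s = frk e P R j k t := by
  have hex := h.inf t
  have h1 := Nat.find_spec hex
  have h2 := fun m => Nat.find_min (m := m) hex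
  set s := Nat.find hex
  refine ⟨s, h1.1, h1.2, ?_⟩
  have key : ∀ u, t ≤ u → u ≤ s → frk e P R j k u = frk e P R j k t := by
    intro u hu
    induction u, hu using Nat.le_induction with
    | base => intro _; rfl
    | succ u hu ih =>
      intro hus
      rw [h.stay (by omega) (fun hh => h2 u (by omega) ⟨hu, hh⟩), ih (by omega)]
  exact key s h1.1 le_rfl

theorem suff (h : Stuck e P R j k T0) {t t' : ℕ} (ht : T0 ≤ t) (htt : t ≤ t') :
    ∃ l, (frk e P R j k t').2.2 = l ++ (frk e P R j k t).2.2 := by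
  induction t', htt using Nat.le_induction with
  | base => exact ⟨[], rfl⟩
  | succ u hu ih =>
    obtain ⟨l, hl⟩ := ih
    by_cases hv : hev e P R j k u
    · refine ⟨((frk e P R j k u).1, (frk e P R j k u).2.1, u) :: l, ?_⟩
      rw [h.step hv]
      simp only [chp, hl, List.cons_append]
    · exact ⟨l, by rw [h.stay (by omega) hv, hl]⟩

theorem mem (h : Stuck e P R j k T0) {t : ℕ} (ht : T0 ≤ t) :
    ∀ c ∈ (frk e P R j k t).2.2, c.2.2 < t ∧ T0 ≤ c.2.2 ∧ hev e P R j k c.2.2 ∧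
      (frk e P R j k c.2.2).1 = c.1 := by
  induction t, ht using Nat.le_induction with
  | base => rw [h.nil]; simp
  | succ t ht ih =>
    intro c hc
    by_cases hv : hev e P R j k t
    · rw [h.step hv] at hc
      rcases List.mem_cons.1 hc with rfl | hc
      · exact ⟨Nat.lt_succ_self t, ht, hv, rfl⟩
      · obtain ⟨h1, h2⟩ := ih c hc
        exact ⟨by omega, h2⟩
    · rw [h.stay ht hv] at hc
      obtain ⟨h1, h2⟩ := ih c hc
      exact ⟨by omega, h2⟩

theorem finv (h : Stuck e P R j k T0) (hU : PFMachine U) (he : Enum U e) (hP : Appr A P) (hR : Appr D R)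
    (t : ℕ) : cw e j (frk e P R j k t).2.2 ≤ lam j ∧ ∀ c ∈ (frk e P R j k t).2.2, c.1 ≤ c.2.1 := by
  obtain ⟨s, hs, _⟩ := SInv_sta hU he hP hR j t
  have h1 := hs.fr k h.lt
  refine ⟨?_, fun c hc => (h1.ok c hc).lab⟩
  have := h1.wgt
  have h2 := tp_pos (xp e j (fget (sta e P R j t).1 k).1)
  unfold frk
  linarith

theorem lost_mono (hP : Appr A P) (hR : Appr D R) {c : Chunk} {t t' : ℕ} (h1 : c.2.2 ≤ t) (h2 : t ≤ t')
    (hl : lostc P R k t c = true) : lostc P R k t' c = true := by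
  unfold lostc at *
  rw [decide_eq_true_eq] at *
  exact XX_nr hP hR h1 h2 hl

theorem count_le (i : ℕ) (ch : List Chunk) :
    (ch.countP (fun c => decide (c.1 = i)) : ℝ) * tp (xp e j i) ≤ cw e j ch := by
  induction ch with
  | nil => simp [cw, tps]
  | cons c ch ih =>
    rw [cw_cons, List.countP_cons]
    have := tp_pos (xp e j c.1)
    by_cases hc : c.1 = i
    · simp only [hc, decide_true, if_true]
      push_cast
      linarith
    · simp only [hc, decide_false]
      simp only [Bool.false_eq_true, if_false, add_zero]
      linarith

theorem mem_labsU {r t a : ℕ} {ch : List Chunk} : a ∈ labsU P R r t ch ↔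
    ∃ c ∈ ch, lostc P R r t c = false ∧ c.1 = a := by
  simp [labsU, List.mem_map, List.mem_filter, and_assoc]

theorem perm (h : Stuck e P R j k T0) (hU : PFMachine U) (he : Enum U e) (hP : Appr A P) (hR : Appr D R)
    (i : ℕ) : ∃ t, T0 ≤ t ∧ ∃ c ∈ (frk e P R j k t).2.2, c.1 = i ∧
      ∀ t', t ≤ t' → lostc P R k t' c = false := by
  induction i using Nat.strong_induction_on with
  | _ i ih =>
  by_contra hcon
  push Not at hcon
  have hgrow : ∀ t, T0 ≤ t → ∃ t', t ≤ t' ∧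
      (frk e P R j k t).2.2.countP (fun c => decide (c.1 = i)) + 1 ≤
      (frk e P R j k t').2.2.countP (fun c => decide (c.1 = i)) := by
    intro t ht
    by_contra hno
    push Not at hno
    have hall : ∀ t', t ≤ t' → ∀ c ∈ (frk e P R j k t').2.2, c.1 = i → c ∈ (frk e P R j k t).2.2 := by
      intro t' ht' c hc hci
      obtain ⟨l, hl⟩ := h.suff ht ht'
      have h1 := hno t' ht'
      rw [hl, List.countP_append] at h1
      rw [hl, List.mem_append] at hc
      rcases hc with hc | hc
      · have h2 : 0 < l.countP (fun c => decide (c.1 = i)) := List.countP_pos_iff.2 ⟨c, hc, by simpa using hci⟩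
        omega
      · exact hc
    have hlost : ∃ T2, ∀ c ∈ (frk e P R j k t).2.2, c.1 = i → ∀ s, T2 ≤ s → lostc P R k s c = true := by
      have h1 : ∀ c : Chunk, ∃ s, c ∈ (frk e P R j k t).2.2 → c.1 = i → t ≤ s ∧ lostc P R k s c = true := by
        intro c
        by_cases hc : c ∈ (frk e P R j k t).2.2 ∧ c.1 = i
        · obtain ⟨s, hs, hl⟩ := hcon t ht c hc.1 hc.2
          exact ⟨s, fun _ _ => ⟨hs, by simpa using hl⟩⟩
        · exact ⟨0, fun a b => absurd ⟨a, b⟩ hc⟩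
      choose f hf using h1
      refine ⟨(frk e P R j k t).2.2.toFinset.sup f, fun c hc hci s hs => ?_⟩
      have h2 := hf c hc hci
      have h3 : f c ≤ s := (Finset.le_sup (List.mem_toFinset.2 hc)).trans hs
      have h4 := (h.mem ht c hc).1
      exact lost_mono hP hR (by omega) h3 h2.2
    obtain ⟨T2, hT2⟩ := hlost
    have hsm : ∃ T3, ∀ a, a < i → ∀ s, T3 ≤ s → ∀ s', T3 ≤ s' → a ∈ labsU P R k s (frk e P R j k s').2.2 := by
      have h1 : ∀ a, ∃ ta, a < i → ∀ s, ta ≤ s → ∀ s', ta ≤ s' → a ∈ labsU P R k s (frk e P R j k s').2.2 := by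
        intro a
        by_cases ha : a < i
        · obtain ⟨ta, hta, c, hc, hca, hl⟩ := ih a ha
          refine ⟨ta, fun _ s hs s' hs' => mem_labsU.2 ⟨c, ?_, hl s hs, hca⟩⟩
          obtain ⟨l, hl⟩ := h.suff hta hs'
          rw [hl]
          exact List.mem_append_right _ hc
        · exact ⟨0, fun h => absurd h ha⟩
      choose f hf using h1
      refine ⟨(Finset.range i).sup f, fun a ha s hs s' hs' => ?_⟩
      have h3 : f a ≤ (Finset.range i).sup f := Finset.le_sup (Finset.mem_range.2 ha)
      exact hf a ha s (h3.trans hs) s' (h3.trans hs')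
    obtain ⟨T3, hT3⟩ := hsm
    obtain ⟨s1, hs1, hv1⟩ := h.inf (max t (max T2 T3))
    have hst := h.step hv1
    have hch : (frk e P R j k (s1 + 1)).2.2 = chp s1 (frk e P R j k s1) := by rw [hst]
    have hlab : (frk e P R j k (s1 + 1)).1 = i := by
      rw [hst]
      show fresh P R k s1 (chp s1 (frk e P R j k s1)) = i
      obtain ⟨_, f2, f3⟩ := fresh_spec (P := P) (R := R) k s1 (chp s1 (frk e P R j k s1))
      rw [← hch] at f2 f3 ⊢
      rcases lt_trichotomy (fresh P R k s1 (frk e P R j k (s1 + 1)).2.2) i with hlt | heq | hgt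
      · exact absurd (hT3 _ hlt s1 (by omega) (s1 + 1) (by omega)) f2
      · exact heq
      · obtain ⟨c, hc, hl, hci⟩ := mem_labsU.1 (f3 i hgt)
        have h5 := hall (s1 + 1) (by omega) c hc hci
        have h6 := hT2 c h5 hci s1 (by omega)
        rw [h6] at hl
        exact absurd hl (by simp)
    obtain ⟨s2, hs2, hv2, hfr⟩ := h.next (t := s1 + 1) (by omega)
    have h7 := hno (s2 + 1) (by omega)
    obtain ⟨l, hl⟩ := h.suff ht (show t ≤ s2 by omega)
    rw [h.step hv2] at h7
    simp only [chp] at h7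
    rw [hfr, hlab, ← hfr, hl, List.countP_cons, List.countP_append] at h7
    simp only [decide_true, if_true] at h7
    omega
  have hbig : ∀ m : ℕ, ∃ t, T0 ≤ t ∧ m ≤ (frk e P R j k t).2.2.countP (fun c => decide (c.1 = i)) := by
    intro m
    induction m with
    | zero => exact ⟨T0, le_rfl, Nat.zero_le _⟩
    | succ m ihm =>
      obtain ⟨t, ht, hm⟩ := ihm
      obtain ⟨t', ht', hm'⟩ := hgrow t ht
      exact ⟨t', by omega, by omega⟩
  obtain ⟨m, hm⟩ := exists_nat_gt (lam j / tp (xp e j i))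
  obtain ⟨t, _, htm⟩ := hbig m
  have h1 := count_le (e := e) (j := j) i (frk e P R j k t).2.2
  have h2 := (h.finv hU he hP hR t).1
  have h3 := tp_pos (xp e j i)
  rw [div_lt_iff₀ h3] at hm
  have h4 : (m : ℝ) ≤ ((frk e P R j k t).2.2.countP (fun c => decide (c.1 = i)) : ℝ) := by exact_mod_cast htm
  nlinarith
end Stuck

/-- requests of a stuck row -/
def rqS (e : ℕ → Option (Str × Str)) (P R : ℕ → ℕ → Str) (j k T0 t : ℕ) : Option (ℕ × Str) :=
  if T0 ≤ t ∧ act e P R j t = true ∧ nidx e P R j t (sta e P R j t).1 = k then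
    Option.some (xp e j (frk e P R j k t).1 + 1, XX P R k t (labl e (frk e P R j k t).1).2)
  else Option.none

theorem pr_rqS (he : Enum U e) (hP : Appr A P) (hR : Appr D R) (j k T0 : ℕ) : Primrec (rqS e P R j k T0) := by
  have h1 := pr_act he hP hR
  have h2 := pr_sta he hP hR
  have h3 := pr_nidx he hP hR
  have h4 := pr_XX hP hR
  have h5 := pr_labl he
  have h6 := pr_xp he
  have h7 := pr_fget
  unfold rqS frk
  refine pr_ite (pr_dand (by fun_prop) (pr_dand (pr_eq (by fun_prop) (by fun_prop))
    (pr_eq (by fun_prop) (by fun_prop)))) (by fun_prop) (by fun_prop)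

theorem rqS_sum {j k T0 : ℕ} (h : Stuck e P R j k T0) {m : ℕ} (hm : T0 ≤ m) :
    ∑ t ∈ Finset.range m, rwt (rqS e P R j k T0 t) = tp 1 * cw e j (frk e P R j k m).2.2 := by
  induction m, hm using Nat.le_induction with
  | base =>
    rw [h.nil]
    rw [Finset.sum_eq_zero]
    · simp [cw, tps]
    · intro t ht
      have := Finset.mem_range.1 ht
      rw [rqS, if_neg (by omega), rwt_none]
  | succ m hm ih =>
    rw [Finset.sum_range_succ, ih]
    by_cases hv : hev e P R j k m
    · rw [rqS, if_pos ⟨hm, hv⟩, rwt_some, h.step hv]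
      simp only [chp]
      rw [cw_cons, mul_add, ← tp_add, add_comm]
      congr 2; ring
    · rw [rqS, if_neg (fun hh => hv hh.2), rwt_none, h.stay hm hv, add_zero]

theorem stuck_triv (hU : OptimalPF U) (he : Enum U e) (hP : Appr A P) (hR : Appr D R) {j k T0 : ℕ}
    (h : Stuck e P R j k T0) {X : ℕ → Bool} {Q : ℕ → ℕ → Str} (hQ : Appr X Q)
    (hQX : ∀ t x, XX P R k t x = Q t x) : KTrivialSeq U X := by
  have hsum : ∀ n, ∑ t ∈ Finset.range n, rwt (rqS e P R j k T0 t) ≤ 1 := by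
    intro n
    have h1 : ∑ t ∈ Finset.range n, rwt (rqS e P R j k T0 t) ≤
        ∑ t ∈ Finset.range (max n T0), rwt (rqS e P R j k T0 t) :=
      Finset.sum_le_sum_of_subset_of_nonneg
        (Finset.range_subset_range.2 (le_max_left _ _)) (fun _ _ _ => rwt_nonneg _)
    rw [rqS_sum h (le_max_right _ _)] at h1
    have h2 := (h.finv hU.1 he hP hR (max n T0)).1
    have h3 : tp 1 = 1 / 2 := by norm_num [tp]
    have h4 : lam j ≤ 2 := by
      have h5 : tp (ell j) ≤ tp 2 := tp_anti (by unfold ell; omega)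
      have h6 : tp 2 = 1 / 4 := by norm_num [tp]
      unfold lam; linarith
    rw [h3] at h1
    linarith
  obtain ⟨c, hc⟩ := kc_theorem hU _ (pr_rqS he hP hR j k T0) hsum
  refine ⟨ell j + 1 + c, fun n => KC_le_KC he ?_⟩
  intro i σ hi
  have hl := labl_zero hi
  obtain ⟨t, ht, b, hb, hbi, hbl⟩ := h.perm hU.1 he hP hR i
  obtain ⟨h1, h2, h3, h4⟩ := h.mem ht b hb
  have h5 := (h.finv hU.1 he hP hR t).2 b hb
  have h6 := labl_le he i
  rw [hl] at h6
  simp only at h6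
  have h7 := hc b.2.2 (xp e j i + 1) (XX P R k b.2.2 n) (by
    rw [rqS, if_pos ⟨h2, h3⟩, h4, hbi, hl])
  obtain ⟨s0, hs0⟩ := hQ.lim n
  have h8 := hbl (max t s0) (le_max_left _ _)
  unfold lostc at h8
  rw [decide_eq_false_iff_not, not_not, hQX, hQX] at h8
  have h9 : XX P R k b.2.2 n = restrSeq X n := by
    rw [hQX, ← hQ.take _ n b.2.1 (by omega), h8, hQ.take _ n b.2.1 (by omega)]
    exact hs0 _ (le_max_right _ _)
  rw [h9] at h7
  refine h7.trans (le_of_eq ?_)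
  rw [xp, hl]
  congr 1
  ring

theorem B_nt (hU : OptimalPF U) (he : Enum U e) (hP : Appr A P) (hR : Appr D R)
    (hA : ¬ KTrivialSeq U A) (hD : ¬ KTrivialSeq U D) : ¬ KTrivialSeq U (Bseq e P R) := by
  intro hB
  obtain ⟨j, hj⟩ := act_inf hU he hP hR hB
  obtain ⟨k, T0, h⟩ := exists_stuck hU.1 he hP hR hj
  by_cases hk : k % 2 = 0
  · exact hA (stuck_triv hU he hP hR h hP (fun t x => by rw [XX, if_pos hk]))
  · exact hD (stuck_triv hU he hP hR h hR (fun t x => by rw [XX, if_neg hk]))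
end

/-- There are no minimal pairs in the `K`-degrees of c.e. reals:
for any c.e. reals `A`, `D`, neither `K`-trivial, there is a c.e. real `B` that is
not `K`-trivial with `B ≤_K A` and `B ≤_K D`. -/
theorem stmt5 (U : Str →. Str) (hU : OptimalPF U)
    (A D : ℕ → Bool) (hA : CEReal A) (hD : CEReal D)
    (hAnt : ¬ KTrivialSeq U A) (hDnt : ¬ KTrivialSeq U D) :
    ∃ B : ℕ → Bool, CEReal B ∧ ¬ KTrivialSeq U B ∧ KLeSeq U B A ∧ KLeSeq U B D := by
  obtain ⟨e, he⟩ := exists_enum U hU.1.1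
  obtain ⟨P, hP⟩ := exists_appr hU he A hA hAnt
  obtain ⟨R, hR⟩ := exists_appr hU he D hD hDnt
  exact ⟨Bseq e P R, cereal_B he hP hR, B_nt hU he hP hR hAnt hDnt,
    B_le hU he hP hR hP (Or.inl rfl), B_le hU he hP hR hR (Or.inr rfl)⟩

end KPaper
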